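/- There exists a constant C > 0 such that for all x ∈ B_R(x_{j,k}), 1 ≤ j ≤ m and k ≫ 1, |v_k(x) − log( e^{v_k(x_{j,k})} / (1 + (1/8) λ_k V(x_{j,k}) e^{v_k(x_{j,k})} |x − x_{j,k}|²)² )| ≤ C; equivalently, the rescaled functions ṽ_{j,k}(x̃) = v_k(δ_{j,k} x̃ + x_{j,k}) − v_k(x_{j,k}) satisfy |ṽ_{j,k}(x) − U(x)| ≤ C for all x ∈ B_{R/δ_{j,k}}(0), where U(x) = log(1/(1 + |x|²/8)²). -/

import Mathlib

open MeasureTheory Real Filter Topology Metric Bornology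
open scoped RealInnerProductSpace

noncomputable section

/-- The plane `ℝ²`. -/
abbrev E2 : Type := EuclideanSpace ℝ (Fin 2)

/-- The Laplacian of a function on the plane, as the sum of the second partial
derivatives in the coordinate directions. -/
def lap (f : E2 → ℝ) (x : E2) : ℝ :=
  ∑ i : Fin 2,
    fderiv ℝ (fun y => fderiv ℝ f y (EuclideanSpace.single i 1)) x (EuclideanSpace.single i 1)

/-- `G` is the Dirichlet Green function of `-Δ` on `Ω`, with regular part `K`
(so that `x ↦ K x x` is the Robin function). -/
structure IsGreen (Ω : Set E2) (G K : E2 → E2 → ℝ) : Prop where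
  symm : ∀ x y, G x y = G y x
  decomp : ∀ x ∈ Ω, ∀ y ∈ Ω, x ≠ y →
    G x y = -(1 / (2 * π)) * Real.log (dist x y) + K x y
  harmK : ∀ y ∈ Ω, ∀ x ∈ Ω, lap (fun z => K z y) x = 0
  harmG : ∀ y ∈ Ω, ∀ x ∈ Ω, x ≠ y → lap (fun z => G z y) x = 0
  bdry : ∀ y ∈ Ω, ∀ x ∈ frontier Ω, G x y = 0
  contK : ContinuousOn (fun p : E2 × E2 => K p.1 p.2) (closure Ω ×ˢ Ω ∪ Ω ×ˢ closure Ω)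

/-- The Hamiltonian `H^m_V` of the system of `m`-point vortices:
`H^m_V(x₁,…,x_m) = ½ Σᵢ R(xᵢ) + Σ_{i<j} G(xᵢ,xⱼ) + (1/8π) Σᵢ log V(xᵢ)`. -/
def Ham (m : ℕ) (G K : E2 → E2 → ℝ) (V : E2 → ℝ) (x : Fin m → E2) : ℝ :=
  (1 / 2) * ∑ i, K (x i) (x i)
    + ∑ i, ∑ j, (if i < j then G (x i) (x j) else 0)
    + (1 / (8 * π)) * ∑ i, Real.log (V (x i))

/-- The standard bubble `U(x) = log (1/(1+|x|²/8)²)`. -/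
def U (x : E2) : ℝ := Real.log (1 / (1 + ‖x‖ ^ 2 / 8) ^ 2)

/-- `Λ` lists the eigenvalues (with multiplicity, in nondecreasing order) of the real
symmetric matrix `M`, as witnessed by an orthonormal eigenbasis. -/
def IsEigList {N : ℕ} (M : Matrix (Fin N) (Fin N) ℝ) (Λ : Fin N → ℝ) : Prop :=
  Monotone Λ ∧ ∃ b : Fin N → (Fin N → ℝ),
    (∀ i i', (∑ t, b i t * b i' t) = if i = i' then 1 else 0) ∧
    ∀ i, M.mulVec (b i) = Λ i • b i

/-- The standing setting: a family `v_k` of solutions of the Liouville–Gel'fand problem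
`-Δv = λ_k V e^v` in `Ω`, `v = 0` on `∂Ω`, blowing up at the `m` interior points
`x*₁, …, x*_m`, with local maximum points `x_{j,k} → x*_j`. -/
structure Setting (m : ℕ) where
  /-- the bounded planar domain -/
  Ω : Set E2
  /-- the positive coefficient `V ∈ C¹(Ω̄)` -/
  V : E2 → ℝ
  /-- the parameters `λ_k ↓ 0` -/
  lam : ℕ → ℝ
  /-- the blow-up solutions -/
  v : ℕ → E2 → ℝ
  /-- the Dirichlet Green function of `-Δ` on `Ω` -/
  G : E2 → E2 → ℝ
  /-- its regular part; `x ↦ K x x` is the Robin function -/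
  K : E2 → E2 → ℝ
  /-- the blow-up points -/
  xstar : Fin m → E2
  /-- the local maximum points `x_{j,k}` -/
  xpt : Fin m → ℕ → E2
  /-- the fixed small radius -/
  R : ℝ
  hm : 0 < m
  hopen : IsOpen Ω
  hbd : IsBounded Ω
  hconn : IsConnected Ω
  hVpos : ∀ x ∈ closure Ω, 0 < V x
  hVreg : ContDiffOn ℝ 1 V (closure Ω)
  hgreen : IsGreen Ω G K
  hlam_pos : ∀ k, 0 < lam k
  hlam_anti : StrictAnti lam
  hlam0 : Tendsto lam atTop (𝓝 0)
  hv_reg : ∀ k, ContDiffOn ℝ 2 (v k) Ω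
  hv_cont : ∀ k, ContinuousOn (v k) (closure Ω)
  hPDE : ∀ k, ∀ x ∈ Ω, -lap (v k) x = lam k * V x * Real.exp (v k x)
  hBC : ∀ k, ∀ x ∈ frontier Ω, v k x = 0
  hblow : Tendsto (fun k => ⨆ x ∈ closure Ω, |v k x|) atTop atTop
  hmass : Tendsto (fun k => ∫ x in Ω, lam k * V x * Real.exp (v k x)) atTop (𝓝 (8 * π * m))
  hx_mem : ∀ j, xstar j ∈ Ω
  hx_inj : Function.Injective xstar
  hS : {x ∈ closure Ω | ∃ z : ℕ → E2, (∀ k, z k ∈ Ω) ∧ Tendsto z atTop (𝓝 x) ∧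
      Tendsto (fun k => v k (z k)) atTop atTop} = Set.range xstar
  hR : 0 < R
  hR2 : ∀ j, closedBall (xstar j) (2 * R) ⊆ Ω
  hRdisj : ∀ i j, i ≠ j → Disjoint (ball (xstar i) R) (ball (xstar j) R)
  hxpt_lim : ∀ j, Tendsto (fun k => xpt j k) atTop (𝓝 (xstar j))
  hxpt_mem : ∀ j k, xpt j k ∈ ball (xstar j) R
  hxpt_max : ∀ j k, ∀ x ∈ ball (xpt j k) R, v k x ≤ v k (xpt j k)
  hxpt_blow : ∀ j, Tendsto (fun k => v k (xpt j k)) atTop atTop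

namespace Setting

variable {m : ℕ}

/-- The scaling parameter `δ_{j,k} > 0`, defined by
`λ_k V(x_{j,k}) e^{v_k(x_{j,k})} δ_{j,k}² = 1`. -/
def delta (S : Setting m) (j : Fin m) (k : ℕ) : ℝ :=
  (Real.sqrt (S.lam k * S.V (S.xpt j k) * Real.exp (S.v k (S.xpt j k))))⁻¹

/-- The local mass `σ_{j,k} = ∫_{B_R(x_{j,k})} λ_k V e^{v_k}`. -/
def sigmaLoc (S : Setting m) (j : Fin m) (k : ℕ) : ℝ :=
  ∫ x in ball (S.xpt j k) S.R, S.lam k * S.V x * Real.exp (S.v k x)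

/-- The entries of the matrix `(h_{ij})`:
`h_{ii} = R(x*_i) + 2 Σ_{h ≠ i} G(x*_h, x*_i) + (1/4π) log V(x*_i)`,
`h_{ij} = -G(x*_i, x*_j)` for `i ≠ j`. -/
def hEnt (S : Setting m) (i j : Fin m) : ℝ :=
  if i = j then
    S.K (S.xstar i) (S.xstar i)
      + 2 * ∑ h, (if h = i then 0 else S.G (S.xstar h) (S.xstar i))
      + 1 / (4 * π) * Real.log (S.V (S.xstar i))
  else -S.G (S.xstar i) (S.xstar j)

/-- The matrix `(h_{ij})`. -/
def hmat (S : Setting m) : Matrix (Fin m) (Fin m) ℝ := Matrix.of S.hEnt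

end Setting

/-- The eigenpairs `(μⁿ_k, wⁿ_k)` of the linearized problem
`-Δw = μ λ_k V e^{v_k} w` in `Ω`, `w = 0` on `∂Ω`, indexed by `n = 1, 2, …`,
normalized by `‖wⁿ_k‖_∞ = max wⁿ_k = 1`, ordered, and orthogonal in `H¹₀`. -/
structure EigenData {m : ℕ} (S : Setting m) where
  /-- the `n`-th eigenvalue `μⁿ_k` (`n ≥ 1`) -/
  mu : ℕ → ℕ → ℝ
  /-- the `n`-th eigenfunction `wⁿ_k` -/
  w : ℕ → ℕ → E2 → ℝ
  hw_reg : ∀ n k, ContDiffOn ℝ 2 (w n k) S.Ω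
  hw_cont : ∀ n k, ContinuousOn (w n k) (closure S.Ω)
  hPDE : ∀ n k, ∀ x ∈ S.Ω,
    -lap (w n k) x = mu n k * S.lam k * S.V x * Real.exp (S.v k x) * w n k x
  hBC : ∀ n k, ∀ x ∈ frontier S.Ω, w n k x = 0
  hbound : ∀ n k, ∀ x ∈ closure S.Ω, |w n k x| ≤ 1
  hmax : ∀ n k, ∃ x ∈ closure S.Ω, w n k x = 1
  hpos : ∀ k, 0 < mu 1 k
  hlt : ∀ k, mu 1 k < mu 2 k
  hmono : ∀ k n, 2 ≤ n → mu n k ≤ mu (n + 1) k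
  hdiv : ∀ k, Tendsto (fun n => mu n k) atTop atTop
  horth : ∀ k n n', 1 ≤ n → 1 ≤ n' → n ≠ n' →
    (∫ x in S.Ω, ⟪gradient (w n k) x, gradient (w n' k) x⟫) = 0

/-- `c = (c₁,…,c_m) ≠ 0` is the limit vector of the rescaled `n`-th eigenfunctions
`w̃ⁿ_{j,k}(x) = wⁿ_k(δ_{j,k} x + x_{j,k}) → c_j` locally uniformly in `ℝ²`,
along the subsequence `φ`. -/
def IsLimitVec {m : ℕ} (S : Setting m) (W : EigenData S) (φ : ℕ → ℕ) (n : ℕ)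
    (c : Fin m → ℝ) : Prop :=
  c ≠ 0 ∧ ∀ j : Fin m,
    TendstoLocallyUniformly
      (fun k (x : E2) => W.w n (φ k) (S.delta j (φ k) • x + S.xpt j (φ k)))
      (fun _ => c j) atTop

/-- A sequence of (eigen)functions `w_k` concentrates at `κ`: there are `C > 0`
and `κ_k → κ` in `Ω` with `|w_k(κ_k)| ≥ C` for `k ≫ 1`. -/
def ConcentratesAt {m : ℕ} (S : Setting m) (wk : ℕ → E2 → ℝ) (κ : E2) : Prop :=
  ∃ C > 0, ∃ z : ℕ → E2, (∀ k, z k ∈ S.Ω) ∧ Tendsto z atTop (𝓝 κ) ∧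
    ∀ᶠ k in atTop, C ≤ |wk k (z k)|

/-- The index `j` of the coordinate pair to which the `i`-th coordinate of
`ℝ^{2m} ≃ (ℝ²)^m` belongs. -/
def coordIdx {m : ℕ} (i : Fin (2 * m)) : Fin m := ⟨i.1 / 2, by have h := i.isLt; omega⟩

/-- The `i`-th coordinate direction of `(ℝ²)^m ≃ ℝ^{2m}`. -/
def coordBasis (m : ℕ) (i : Fin (2 * m)) : Fin m → E2 :=
  Pi.single (coordIdx i) (EuclideanSpace.single ⟨i.1 % 2, by omega⟩ 1)

/-- The Hessian of the Hamiltonian `H^m_V` at `x0`, as a `2m × 2m` array of second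
directional derivatives. -/
def hessHam (m : ℕ) (G K : E2 → E2 → ℝ) (V : E2 → ℝ) (x0 : Fin m → E2)
    (i j : Fin (2 * m)) : ℝ :=
  fderiv ℝ (fun x => fderiv ℝ (Ham m G K V) x (coordBasis m j)) x0 (coordBasis m i)


/-! ### Partial derivatives and integration by parts -/

/-- coordinate direction -/
abbrev eb (i : Fin 2) : E2 := EuclideanSpace.single i 1

/-- partial derivative -/
def pd (i : Fin 2) (u : E2 → ℝ) : E2 → ℝ := fun y => fderiv ℝ u y (eb i)

lemma lap_eq (u : E2 → ℝ) (x : E2) : lap u x = pd 0 (pd 0 u) x + pd 1 (pd 1 u) x := by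
  unfold lap
  rw [Fin.sum_univ_two]
  rfl

lemma lap_eq' {i j : Fin 2} (hij : i ≠ j) (u : E2 → ℝ) (x : E2) :
    lap u x = pd i (pd i u) x + pd j (pd j u) x := by
  rw [lap_eq]
  fin_cases i <;> fin_cases j <;> simp at hij ⊢
  ring

lemma pd_contDiff {n : ℕ} {i : Fin 2} {u : E2 → ℝ} (hu : ContDiff ℝ (n + 1 : ℕ) u) :
    ContDiff ℝ n (pd i u) := by
  unfold pd
  exact (hu.fderiv_right (m := n) (by norm_cast)).clm_apply contDiff_const

lemma pd_contDiff1 {i : Fin 2} {u : E2 → ℝ} (hu : ContDiff ℝ 2 u) :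
    ContDiff ℝ 1 (pd i u) := pd_contDiff (n := 1) (by exact_mod_cast hu)

lemma pd_continuous {i : Fin 2} {u : E2 → ℝ} (hu : ContDiff ℝ 1 u) :
    Continuous (pd i u) := (pd_contDiff (n := 0) (by exact_mod_cast hu)).continuous

lemma C1_of_C2 {u : E2 → ℝ} (hu : ContDiff ℝ 2 u) : ContDiff ℝ 1 u := hu.of_le (by norm_num)

lemma diff_of_C1 {u : E2 → ℝ} (hu : ContDiff ℝ 1 u) (x : E2) : DifferentiableAt ℝ u x :=
  (hu.differentiable (by norm_num)) x

lemma pd_pd_continuous {i j : Fin 2} {u : E2 → ℝ} (hu : ContDiff ℝ 2 u) :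
    Continuous (pd i (pd j u)) := pd_continuous (pd_contDiff1 hu)

lemma pd_comm {u : E2 → ℝ} (hu : ContDiff ℝ 2 u) (i j : Fin 2) (x : E2) :
    pd i (pd j u) x = pd j (pd i u) x := by
  have h : IsSymmSndFDerivAt ℝ u x := (hu.contDiffAt).isSymmSndFDerivAt (by simp)
  have hd : DifferentiableAt ℝ (fderiv ℝ u) x :=
    ((hu.fderiv_right (m := 1) (by norm_num)).differentiable (by norm_num)) x
  have key : ∀ a b : Fin 2, pd a (pd b u) x = fderiv ℝ (fderiv ℝ u) x (eb a) (eb b) := by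
    intro a b
    unfold pd
    rw [fderiv_clm_apply hd (by fun_prop)]
    simp
  rw [key, key]
  exact h _ _

lemma pd_mul {u g : E2 → ℝ} {x : E2} (i : Fin 2) (hu : DifferentiableAt ℝ u x)
    (hg : DifferentiableAt ℝ g x) :
    pd i (fun y => u y * g y) x = pd i u x * g x + u x * pd i g x := by
  unfold pd
  have : (fun y => u y * g y) = u * g := rfl
  rw [this, fderiv_mul hu hg]
  simp
  ring

lemma pd_add {u g : E2 → ℝ} {x : E2} (i : Fin 2) (hu : DifferentiableAt ℝ u x)
    (hg : DifferentiableAt ℝ g x) :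
    pd i (fun y => u y + g y) x = pd i u x + pd i g x := by
  unfold pd
  have : (fun y => u y + g y) = u + g := rfl
  rw [this, fderiv_add hu hg]
  simp

lemma pd_const_mul {u : E2 → ℝ} {x : E2} (i : Fin 2) (c : ℝ) (hu : DifferentiableAt ℝ u x) :
    pd i (fun y => c * u y) x = c * pd i u x := by
  rw [pd_mul i (by fun_prop) hu]
  simp [pd]

lemma pd_comp {u : E2 → ℝ} {x : E2} (i : Fin 2) {φ : ℝ → ℝ} {φ' : ℝ}
    (hφ : HasDerivAt φ φ' (u x)) (hu : DifferentiableAt ℝ u x) :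
    pd i (fun y => φ (u y)) x = φ' * pd i u x := by
  unfold pd
  have := (hφ.comp_hasFDerivAt x hu.hasFDerivAt).fderiv
  have h2 : (fun y => φ (u y)) = φ ∘ u := rfl
  rw [h2, this]
  simp

lemma pd_congr {u g : E2 → ℝ} {x : E2} (i : Fin 2) (h : u =ᶠ[𝓝 x] g) :
    pd i u x = pd i g x := by
  unfold pd
  rw [h.fderiv_eq]

lemma pd_congr' {u g : E2 → ℝ} {x : E2} (i : Fin 2) (h : u =ᶠ[𝓝 x] g) :
    pd i u =ᶠ[𝓝 x] pd i g := by
  filter_upwards [h.fderiv (𝕜 := ℝ)] with y hy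
  simp [pd, hy]

lemma lap_congr {u g : E2 → ℝ} {x : E2} (h : u =ᶠ[𝓝 x] g) : lap u x = lap g x := by
  rw [lap_eq, lap_eq, pd_congr 0 (pd_congr' 0 h), pd_congr 1 (pd_congr' 1 h)]

lemma pd_affine {u : E2 → ℝ} (i : Fin 2) (c : ℝ) (p : E2) (hu : Differentiable ℝ u) (x : E2) :
    pd i (fun y => u (p + c • y)) x = c * pd i u (p + c • x) := by
  unfold pd
  have h1 : HasFDerivAt (fun y : E2 => p + c • y) (c • ContinuousLinearMap.id ℝ E2) x := by
    have := ((hasFDerivAt_id (𝕜 := ℝ) x).const_smul c).const_add p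
    exact this
  have h2 := ((hu (p + c • x)).hasFDerivAt.comp x h1).fderiv
  have h3 : (fun y => u (p + c • y)) = u ∘ (fun y => p + c • y) := rfl
  rw [h3, h2]
  simp

lemma lap_affine {u : E2 → ℝ} (c : ℝ) (p : E2) (hu : ContDiff ℝ 2 u) (x : E2) :
    lap (fun y => u (p + c • y)) x = c ^ 2 * lap u (p + c • x) := by
  have hd : Differentiable ℝ u := hu.differentiable (by norm_num)
  have : ∀ i, pd i (pd i (fun y => u (p + c • y))) x = c ^ 2 * pd i (pd i u) (p + c • x) := by
    intro i
    have e1 : pd i (fun y => u (p + c • y)) = fun y => c * pd i u (p + c • y) := by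
      funext y; exact pd_affine i c p hd y
    have hd2 : Differentiable ℝ (pd i u) := (pd_contDiff1 hu).differentiable (by norm_num)
    rw [e1, pd_const_mul i c, pd_affine i c p hd2]
    · ring
    · exact (hd2.comp (by fun_prop : Differentiable ℝ (fun y : E2 => p + c • y))) x
  rw [lap_eq, lap_eq, this, this]; ring

lemma pd_tsupport {u : E2 → ℝ} (i : Fin 2) : tsupport (pd i u) ⊆ tsupport u := by
  unfold pd
  exact tsupport_fderiv_apply_subset ℝ (eb i)

lemma pd_eq_zero {u : E2 → ℝ} (i : Fin 2) {x : E2} (hx : x ∉ tsupport u) : pd i u x = 0 :=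
  image_eq_zero_of_notMem_tsupport (fun h => hx (pd_tsupport i h))

lemma pd_compact {u : E2 → ℝ} (i : Fin 2) (h : HasCompactSupport u) :
    HasCompactSupport (pd i u) := h.mono' ((subset_tsupport _).trans (pd_tsupport i))

lemma ibp {u g : E2 → ℝ} (i : Fin 2) (hu : ContDiff ℝ 1 u) (hg : ContDiff ℝ 1 g)
    (hc : HasCompactSupport g) : ∫ x, pd i u x * g x = - ∫ x, u x * pd i g x := by
  have := integral_mul_fderiv_eq_neg_fderiv_mul_of_integrable (μ := (volume : Measure E2))
    (f := u) (g := g) (v := eb i)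
    (((pd_continuous (i := i) hu).mul hg.continuous).integrable_of_hasCompactSupport hc.mul_left)
    ((hu.continuous.mul (pd_continuous (i := i) hg)).integrable_of_hasCompactSupport
      (pd_compact i hc).mul_left)
    ((hu.continuous.mul hg.continuous).integrable_of_hasCompactSupport hc.mul_left)
    (fun x _ => diff_of_C1 hu x) (fun x _ => diff_of_C1 hg x)
  unfold pd
  rw [this]; ring

lemma int_cs {g : E2 → ℝ} (h : Continuous g) (hc : HasCompactSupport g) : Integrable g :=
  h.integrable_of_hasCompactSupport hc

lemma ibp_lap {u g : E2 → ℝ} (hu : ContDiff ℝ 2 u) (hg : ContDiff ℝ 2 g)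
    (hc : HasCompactSupport g) : ∫ x, lap u x * g x = ∫ x, u x * lap g x := by
  have key : ∀ i, ∫ x, pd i (pd i u) x * g x = ∫ x, u x * pd i (pd i g) x := by
    intro i
    rw [ibp i (pd_contDiff1 hu) (C1_of_C2 hg) hc,
      ibp i (C1_of_C2 hu) (pd_contDiff1 hg) (pd_compact i hc)]
    ring
  simp_rw [lap_eq, add_mul, mul_add]
  rw [integral_add, integral_add, key, key]
  · exact int_cs ((C1_of_C2 hu).continuous.mul (pd_pd_continuous hg))
      (pd_compact _ (pd_compact _ hc)).mul_left
  · exact int_cs ((C1_of_C2 hu).continuous.mul (pd_pd_continuous hg))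
      (pd_compact _ (pd_compact _ hc)).mul_left
  · exact int_cs ((pd_pd_continuous hu).mul hg.continuous) hc.mul_left
  · exact int_cs ((pd_pd_continuous hu).mul hg.continuous) hc.mul_left

lemma lap_mul {u g : E2 → ℝ} (hu : ContDiff ℝ 2 u) (hg : ContDiff ℝ 2 g) (x : E2) :
    lap (fun y => u y * g y) x = lap u x * g x
      + 2 * (pd 0 u x * pd 0 g x + pd 1 u x * pd 1 g x) + u x * lap g x := by
  have key : ∀ i, pd i (pd i (fun y => u y * g y)) x = pd i (pd i u) x * g x
      + 2 * (pd i u x * pd i g x) + u x * pd i (pd i g) x := by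
    intro i
    have e1 : pd i (fun y => u y * g y) = fun y => pd i u y * g y + u y * pd i g y := by
      funext y; exact pd_mul i (diff_of_C1 (C1_of_C2 hu) y) (diff_of_C1 (C1_of_C2 hg) y)
    have a1 := diff_of_C1 (C1_of_C2 hu) x
    have a2 := diff_of_C1 (C1_of_C2 hg) x
    have a3 := diff_of_C1 (pd_contDiff1 (i := i) hu) x
    have a4 := diff_of_C1 (pd_contDiff1 (i := i) hg) x
    rw [e1, pd_add i (a3.fun_mul a2) (a1.fun_mul a4), pd_mul i a3 a2, pd_mul i a1 a4]
    ring
  rw [lap_eq, lap_eq, lap_eq, key, key]; ring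

lemma lap_comp {u : E2 → ℝ} (hu : ContDiff ℝ 2 u) {φ φ' φ'' : ℝ → ℝ}
    (h1 : ∀ t, HasDerivAt φ (φ' t) t) (h2 : ∀ t, HasDerivAt φ' (φ'' t) t) (x : E2) :
    lap (fun y => φ (u y)) x = φ'' (u x) * (pd 0 u x ^ 2 + pd 1 u x ^ 2) + φ' (u x) * lap u x := by
  have key : ∀ i, pd i (pd i (fun y => φ (u y))) x =
      φ'' (u x) * pd i u x ^ 2 + φ' (u x) * pd i (pd i u) x := by
    intro i
    have e1 : pd i (fun y => φ (u y)) = fun y => φ' (u y) * pd i u y := by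
      funext y; exact pd_comp i (h1 _) (diff_of_C1 (C1_of_C2 hu) y)
    have a1 := diff_of_C1 (C1_of_C2 hu) x
    have a3 := diff_of_C1 (pd_contDiff1 (i := i) hu) x
    have a4 : DifferentiableAt ℝ (fun y => φ' (u y)) x :=
      (h2 (u x)).differentiableAt.comp x a1
    rw [e1, pd_mul i a4 a3, pd_comp i (h2 _) a1]; ring
  rw [lap_eq, lap_eq, key, key]; ring

/-! ### Kernels -/

lemma pd_coord (i j : Fin 2) (x y : E2) :
    pd i (fun y : E2 => y j - x j) y = if i = j then 1 else 0 := by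
  unfold pd
  have h : HasFDerivAt (fun y : E2 => y j - x j) (EuclideanSpace.proj j : E2 →L[ℝ] ℝ) y :=
    ((EuclideanSpace.proj j : E2 →L[ℝ] ℝ).hasFDerivAt).sub_const (x j)
  rw [h.fderiv]
  simp [eq_comm]

lemma nsq (z : E2) : ‖z‖ ^ 2 = z 0 ^ 2 + z 1 ^ 2 := by
  rw [EuclideanSpace.real_norm_sq_eq, Fin.sum_univ_two]

lemma coord_diff (j : Fin 2) (x : E2) : ContDiff ℝ 2 (fun y : E2 => y j - x j) :=
  ((EuclideanSpace.proj j : E2 →L[ℝ] ℝ).contDiff).sub contDiff_const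

/-- regularized squared distance -/
def qf (x : E2) (ε : ℝ) (y : E2) : ℝ := ‖y - x‖ ^ 2 + ε ^ 2

/-- regularized log kernel -/
def ell (x : E2) (ε : ℝ) (y : E2) : ℝ := 1 / 2 * Real.log (qf x ε y)

/-- its gradient -/
def Kf (i : Fin 2) (x : E2) (ε : ℝ) (y : E2) : ℝ := (y i - x i) * (qf x ε y)⁻¹

/-- its Laplacian -/
def Pf (x : E2) (ε : ℝ) (y : E2) : ℝ := 2 * ε ^ 2 * ((qf x ε y)⁻¹) ^ 2

lemma qf_pos {x : E2} {ε : ℝ} (hε : 0 < ε) (y : E2) : 0 < qf x ε y := by unfold qf; positivity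

lemma qf_contDiff (x : E2) (ε : ℝ) : ContDiff ℝ 2 (qf x ε) := by
  unfold qf
  exact ((contDiff_id.sub contDiff_const).norm_sq ℝ).add contDiff_const

lemma pd_qf (i : Fin 2) (x : E2) (ε : ℝ) (y : E2) : pd i (qf x ε) y = 2 * (y i - x i) := by
  have : qf x ε = fun y => ((y 0 - x 0) * (y 0 - x 0) + (y 1 - x 1) * (y 1 - x 1)) + ε ^ 2 := by
    funext y; simp [qf, nsq]; ring
  have h0 := diff_of_C1 (C1_of_C2 (coord_diff 0 x)) y
  have h1 := diff_of_C1 (C1_of_C2 (coord_diff 1 x)) y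
  rw [this, pd_add i ((h0.fun_mul h0).fun_add (h1.fun_mul h1)) (by fun_prop),
    pd_add i (h0.fun_mul h0) (h1.fun_mul h1),
    pd_mul i h0 h0, pd_mul i h1 h1, pd_coord, pd_coord]
  fin_cases i <;> simp [pd] <;> ring

lemma ell_contDiff (x : E2) {ε : ℝ} (hε : 0 < ε) : ContDiff ℝ 2 (ell x ε) := by
  unfold ell
  exact contDiff_const.mul ((qf_contDiff x ε).log (fun y => (qf_pos hε y).ne'))

lemma Kf_contDiff (i : Fin 2) (x : E2) {ε : ℝ} (hε : 0 < ε) : ContDiff ℝ 2 (Kf i x ε) := by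
  unfold Kf
  exact (coord_diff i x).mul ((qf_contDiff x ε).inv (fun y => (qf_pos hε y).ne'))

lemma pd_ell (i : Fin 2) (x : E2) {ε : ℝ} (hε : 0 < ε) : pd i (ell x ε) = Kf i x ε := by
  funext y
  have hq := (qf_pos (x := x) hε y).ne'
  have h := pd_comp (u := qf x ε) (x := y) i (φ := fun t => 1 / 2 * Real.log t)
    ((Real.hasDerivAt_log hq).const_mul (1 / 2)) (diff_of_C1 (C1_of_C2 (qf_contDiff x ε)) y)
  have e : ell x ε = fun y => 1 / 2 * Real.log (qf x ε y) := rfl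
  rw [e, h, pd_qf, Kf]; ring

lemma pd_Kf (i j : Fin 2) (x : E2) {ε : ℝ} (hε : 0 < ε) (y : E2) :
    pd j (Kf i x ε) y = (if j = i then 1 else 0) * (qf x ε y)⁻¹
      - 2 * (y i - x i) * (y j - x j) * ((qf x ε y)⁻¹) ^ 2 := by
  have hq := (qf_pos (x := x) hε y).ne'
  have hqd := diff_of_C1 (C1_of_C2 (qf_contDiff x ε)) y
  have h := pd_comp (u := qf x ε) (x := y) j (φ := fun t => t⁻¹) (hasDerivAt_inv hq) hqd
  have e : Kf i x ε = fun y => (y i - x i) * (qf x ε y)⁻¹ := rfl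
  rw [e, pd_mul j (diff_of_C1 (C1_of_C2 (coord_diff i x)) y) (hqd.fun_inv hq), pd_coord, h, pd_qf]
  field_simp
  ring

lemma Pf_eq (x : E2) {ε : ℝ} (hε : 0 < ε) (y : E2) :
    pd 0 (Kf 0 x ε) y + pd 1 (Kf 1 x ε) y = Pf x ε y := by
  rw [pd_Kf _ _ _ hε, pd_Kf _ _ _ hε, Pf]
  have hq := (qf_pos (x := x) hε y).ne'
  have e : qf x ε y = (y 0 - x 0) ^ 2 + (y 1 - x 1) ^ 2 + ε ^ 2 := by simp [qf, nsq]
  simp only [if_true]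
  field_simp
  rw [e]; ring

lemma pd_Kf_comm (x : E2) {ε : ℝ} (hε : 0 < ε) (y : E2) :
    pd 0 (Kf 1 x ε) y = pd 1 (Kf 0 x ε) y := by
  rw [pd_Kf _ _ _ hε, pd_Kf _ _ _ hε]
  rw [if_neg (by decide), if_neg (by decide)]; ring

lemma lap_ell (x : E2) {ε : ℝ} (hε : 0 < ε) (y : E2) : lap (ell x ε) y = Pf x ε y := by
  rw [lap_eq, pd_ell _ _ hε, pd_ell _ _ hε, Pf_eq x hε]

lemma Pf_nonneg (x : E2) (ε : ℝ) (y : E2) : 0 ≤ Pf x ε y := by unfold Pf; positivity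

lemma Pf_cont (x : E2) {ε : ℝ} (hε : 0 < ε) : Continuous (Pf x ε) := by
  unfold Pf
  exact continuous_const.mul (((qf_contDiff x ε).continuous.inv₀
    (fun y => (qf_pos hε y).ne')).pow 2)

/-- the absolute kernel `1/sqrt(|y-x|²+ε²)` -/
def kabs (x : E2) (ε : ℝ) (y : E2) : ℝ := (Real.sqrt (qf x ε y))⁻¹

lemma kabs_cont (x : E2) {ε : ℝ} (hε : 0 < ε) : Continuous (kabs x ε) := by
  unfold kabs
  exact ((qf_contDiff x ε).continuous.sqrt).inv₀ (fun y => (Real.sqrt_pos.2 (qf_pos hε y)).ne')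

lemma kabs_nonneg (x : E2) (ε : ℝ) (y : E2) : 0 ≤ kabs x ε y := by unfold kabs; positivity

lemma kabs_le (x : E2) (ε : ℝ) {y : E2} {ρ : ℝ} (hρ : 0 < ρ) (h : ρ ≤ ‖y - x‖) :
    kabs x ε y ≤ ρ⁻¹ := by
  unfold kabs
  apply inv_anti₀ hρ
  apply Real.le_sqrt_of_sq_le
  unfold qf
  nlinarith [sq_nonneg ε]

lemma Kf_le (i : Fin 2) (x : E2) {ε : ℝ} (hε : 0 < ε) (y : E2) : |Kf i x ε y| ≤ kabs x ε y := by
  have hq := qf_pos (x := x) hε y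
  have hs := Real.sqrt_pos.2 hq
  unfold Kf kabs
  rw [abs_mul, abs_of_pos (inv_pos.2 hq)]
  have h1 : |y i - x i| ≤ Real.sqrt (qf x ε y) := by
    apply Real.abs_le_sqrt
    have e : qf x ε y = (y 0 - x 0) ^ 2 + (y 1 - x 1) ^ 2 + ε ^ 2 := by simp [qf, nsq]
    rw [e]
    fin_cases i <;> simp <;> nlinarith [sq_nonneg (y 0 - x 0), sq_nonneg (y 1 - x 1), sq_nonneg ε]
  calc |y i - x i| * (qf x ε y)⁻¹ ≤ Real.sqrt (qf x ε y) * (qf x ε y)⁻¹ := by gcongr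
    _ = (Real.sqrt (qf x ε y))⁻¹ := by
      nth_rewrite 2 [← Real.sq_sqrt hq.le]
      field_simp

/-! ### Radial integrals -/

lemma vol_unit : (volume : Measure E2).real (ball 0 1) = π := by
  rw [Measure.real, EuclideanSpace.volume_ball_fin_two]
  simp [Real.pi_pos.le]

lemma fr2 : Module.finrank ℝ E2 = 2 := by simp

lemma polar (f : ℝ → ℝ) : ∫ y : E2, f ‖y‖ = 2 * π * ∫ r in Set.Ioi (0 : ℝ), r * f r := by
  rw [integral_fun_norm_addHaar volume f, vol_unit, fr2]
  simp
  ring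

lemma polar_ball (f : ℝ → ℝ) {ρ : ℝ} (hρ : 0 < ρ) :
    ∫ y in ball (0 : E2) ρ, f ‖y‖ = 2 * π * ∫ r in (0 : ℝ)..ρ, r * f r := by
  rw [← integral_indicator measurableSet_ball]
  have : (fun y : E2 => (ball (0 : E2) ρ).indicator (fun y => f ‖y‖) y)
      = fun y : E2 => (Set.Iio ρ).indicator f ‖y‖ := by
    funext y
    by_cases h : ‖y‖ < ρ <;> simp [Set.indicator, h]
  rw [this, polar, intervalIntegral.integral_of_le hρ.le, integral_Ioc_eq_integral_Ioo]
  congr 1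
  rw [← integral_indicator measurableSet_Ioi, ← integral_indicator measurableSet_Ioo]
  congr 1
  funext r
  by_cases h1 : 0 < r <;> by_cases h2 : r < ρ <;> simp [Set.indicator, h1, h2]

lemma ball_translate (F : E2 → ℝ) (x : E2) (ρ : ℝ) :
    ∫ y in ball x ρ, F y = ∫ y in ball (0 : E2) ρ, F (x + y) := by
  rw [← integral_indicator measurableSet_ball, ← integral_indicator measurableSet_ball,
    ← integral_add_left_eq_self _ x]
  congr 1
  funext y
  by_cases h : ‖y‖ < ρ <;> simp [Set.indicator, h]

lemma kabs_int (x : E2) {ε ρ : ℝ} (hε : 0 < ε) (hρ : 0 < ρ) :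
    ∫ y in ball x ρ, kabs x ε y ≤ 2 * π * ρ := by
  rw [ball_translate]
  have : ∀ y : E2, kabs x ε (x + y) = (fun r : ℝ => (Real.sqrt (r ^ 2 + ε ^ 2))⁻¹) ‖y‖ := by
    intro y; simp [kabs, qf]
  simp_rw [this]
  rw [polar_ball (fun r : ℝ => (Real.sqrt (r ^ 2 + ε ^ 2))⁻¹) hρ]
  have hs : ∀ r : ℝ, 0 < Real.sqrt (r ^ 2 + ε ^ 2) := fun r => Real.sqrt_pos.2 (by positivity)
  have hc : Continuous (fun r : ℝ => r * (Real.sqrt (r ^ 2 + ε ^ 2))⁻¹) :=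
    continuous_id.mul ((by fun_prop : Continuous fun r : ℝ => Real.sqrt (r ^ 2 + ε ^ 2)).inv₀
      (fun r => (hs r).ne'))
  have : ∫ r in (0 : ℝ)..ρ, r * (Real.sqrt (r ^ 2 + ε ^ 2))⁻¹ ≤ ∫ r in (0 : ℝ)..ρ, (1 : ℝ) := by
    apply intervalIntegral.integral_mono_on hρ.le (hc.intervalIntegrable _ _) (by simp)
    intro r hr
    rw [← div_eq_mul_inv, div_le_one (hs r)]
    apply Real.le_sqrt_of_sq_le
    nlinarith [sq_nonneg ε]
  simp at this
  have hp := Real.pi_pos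
  gcongr

lemma bubble_deriv {κ : ℝ} (hκ : 0 ≤ κ) (r : ℝ) :
    HasDerivAt (fun r : ℝ => r ^ 2 / (2 * (1 + κ * r ^ 2))) (r * ((1 + κ * r ^ 2) ^ 2)⁻¹) r := by
  have h0 : 2 * (1 + κ * r ^ 2) ≠ 0 := by positivity
  have h1 : HasDerivAt (fun r : ℝ => r ^ 2) (2 * r) r := by simpa using hasDerivAt_pow 2 r
  have h2 : HasDerivAt (fun r : ℝ => 2 * (1 + κ * r ^ 2)) (2 * (κ * (2 * r))) r :=
    ((h1.const_mul κ).const_add 1).const_mul 2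
  have := h1.div h2 h0
  convert! this using 1
  field_simp
  ring

lemma bubble_int {κ ρ : ℝ} (hκ : 0 ≤ κ) (hρ : 0 < ρ) :
    ∫ y in ball (0 : E2) ρ, ((1 + κ * ‖y‖ ^ 2) ^ 2)⁻¹ = π * ρ ^ 2 / (1 + κ * ρ ^ 2) := by
  rw [polar_ball (fun r => ((1 + κ * r ^ 2) ^ 2)⁻¹) hρ,
    intervalIntegral.integral_eq_sub_of_hasDerivAt (fun r _ => bubble_deriv hκ r)]
  · have : 1 + κ * ρ ^ 2 ≠ 0 := by positivity
    field_simp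
    ring
  · apply Continuous.intervalIntegrable
    apply continuous_id.mul
    apply Continuous.inv₀ (by fun_prop)
    intro r; positivity

lemma bubble_int_all : ∫ y : E2, ((1 + ‖y‖ ^ 2) ^ 2)⁻¹ = π := by
  rw [polar (fun r => ((1 + r ^ 2) ^ 2)⁻¹)]
  have ht : Tendsto (fun r : ℝ => r ^ 2 / (2 * (1 + 1 * r ^ 2))) atTop (𝓝 (1 / 2)) := by
    have h1 : Tendsto (fun r : ℝ => 1 / 2 - 1 / 2 * (1 + r ^ 2)⁻¹) atTop (𝓝 (1 / 2 - 1 / 2 * 0)) := by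
      apply Tendsto.const_sub
      apply Tendsto.const_mul
      apply tendsto_inv_atTop_zero.comp
      exact tendsto_atTop_add_const_left _ _ (tendsto_pow_atTop (by norm_num))
    simp only [mul_zero, sub_zero] at h1
    refine h1.congr (fun r => ?_)
    have : 1 + r ^ 2 ≠ 0 := by positivity
    rw [one_mul]
    field_simp
    ring
  have := integral_Ioi_of_hasDerivAt_of_nonneg' (a := 0) (l := 1 / 2)
    (g := fun r : ℝ => r ^ 2 / (2 * (1 + 1 * r ^ 2)))
    (g' := fun r : ℝ => r * ((1 + 1 * r ^ 2) ^ 2)⁻¹)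
    (fun r _ => bubble_deriv zero_le_one r)
    (fun r hr => mul_nonneg (le_of_lt hr) (by positivity)) ht
  simp only [one_mul] at this
  rw [this]
  simp
  ring

lemma approx_id {g : E2 → ℝ} (hg : Continuous g) (hc : HasCompactSupport g) (x : E2) :
    Tendsto (fun c : ℝ => ∫ y, g y * Pf x c⁻¹ y) atTop (𝓝 (2 * π * g x)) := by
  have hpi := Real.pi_pos
  have key := tendsto_integral_comp_smul_smul_of_integrable' (μ := (volume : Measure E2))
    (φ := fun y : E2 => π⁻¹ * ((1 + ‖y‖ ^ 2) ^ 2)⁻¹) (fun y => by positivity)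
    (by rw [integral_const_mul, bubble_int_all]; field_simp)
    (by
      rw [fr2]
      have h1 : Tendsto (fun y : E2 => (1 + ‖y‖ ^ 2)⁻¹) (cobounded E2) (𝓝 0) := by
        apply tendsto_inv_atTop_zero.comp
        apply tendsto_atTop_add_const_left
        exact (tendsto_pow_atTop (by norm_num)).comp tendsto_norm_cobounded_atTop
      have h2 := h1.const_mul π⁻¹
      rw [mul_zero] at h2
      apply squeeze_zero (fun y => by positivity) (fun y => ?_) h2
      have h3 : 0 < 1 + ‖y‖ ^ 2 := by positivity
      have : ‖y‖ ^ 2 * ((1 + ‖y‖ ^ 2) ^ 2)⁻¹ ≤ (1 + ‖y‖ ^ 2)⁻¹ := by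
        rw [← div_eq_mul_inv, inv_eq_one_div, div_le_div_iff₀ (by positivity) h3]
        nlinarith [sq_nonneg ‖y‖]
      calc ‖y‖ ^ 2 * (π⁻¹ * ((1 + ‖y‖ ^ 2) ^ 2)⁻¹) = π⁻¹ * (‖y‖ ^ 2 * ((1 + ‖y‖ ^ 2) ^ 2)⁻¹) := by ring
        _ ≤ π⁻¹ * (1 + ‖y‖ ^ 2)⁻¹ := by gcongr)
    (g := g) (x₀ := x) (int_cs hg hc) hg.continuousAt
  have k2 := key.const_mul (2 * π)
  refine k2.congr' ?_
  filter_upwards [eventually_gt_atTop 0] with c hc0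
  rw [← integral_const_mul]
  congr 1
  funext y
  rw [fr2, norm_smul, Real.norm_of_nonneg hc0.le, Pf, qf, norm_sub_rev y x, smul_eq_mul]
  have h3 : 1 + (c * ‖x - y‖) ^ 2 ≠ 0 := by positivity
  have h4 : ‖x - y‖ ^ 2 + c⁻¹ ^ 2 ≠ 0 := by positivity
  have h5 : ‖x - y‖ ^ 2 + c⁻¹ ^ 2 = (1 + (c * ‖x - y‖) ^ 2) / c ^ 2 := by field_simp; ring
  rw [h5]
  field_simp


/-- A convex truncation function. -/
def Fc (t : ℝ) : ℝ := ∫ s in (0 : ℝ)..t, Real.smoothTransition (s - 1)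

lemma sT_cont : Continuous (fun s : ℝ => Real.smoothTransition (s - 1)) :=
  Real.smoothTransition.continuous.comp (continuous_id.sub continuous_const)

lemma Fc_deriv (t : ℝ) : HasDerivAt Fc (Real.smoothTransition (t - 1)) t :=
  intervalIntegral.integral_hasDerivAt_right (sT_cont.intervalIntegrable _ _)
    (sT_cont.stronglyMeasurableAtFilter _ _) sT_cont.continuousAt

lemma sT_contDiff : ContDiff ℝ 2 (fun s : ℝ => Real.smoothTransition (s - 1)) :=
  (Real.smoothTransition.contDiff (n := 2)).comp (contDiff_id.sub contDiff_const)

lemma Fc_deriv2 (t : ℝ) : HasDerivAt (fun s : ℝ => Real.smoothTransition (s - 1))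
    (deriv (fun s : ℝ => Real.smoothTransition (s - 1)) t) t :=
  ((sT_contDiff.differentiable (by norm_num)) t).hasDerivAt

lemma Fc_deriv2_nonneg (t : ℝ) : 0 ≤ deriv (fun s : ℝ => Real.smoothTransition (s - 1)) t := by
  apply Monotone.deriv_nonneg
  intro a b h
  exact Real.smoothTransition.monotone (by linarith)

lemma Fc_contDiff : ContDiff ℝ 2 Fc := by
  have h : deriv Fc = fun s : ℝ => Real.smoothTransition (s - 1) := by
    funext t; exact (Fc_deriv t).deriv
  have : ContDiff ℝ (1 + 1) Fc := by
    rw [contDiff_succ_iff_deriv]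
    refine ⟨fun t => (Fc_deriv t).differentiableAt, by simp, ?_⟩
    rw [h]; exact sT_contDiff.of_le (by norm_num)
  exact this.of_le (by norm_num)

lemma Fc_zero {t : ℝ} (ht : t ≤ 1) : Fc t = 0 := by
  unfold Fc
  rw [intervalIntegral.integral_congr (g := fun _ => (0 : ℝ))]
  · simp
  · intro s hs
    have : s ≤ 1 := by
      rcases le_total 0 t with h | h
      · rw [Set.uIcc_of_le h] at hs; linarith [hs.2]
      · rw [Set.uIcc_of_ge h] at hs; linarith [hs.2]
    exact Real.smoothTransition.zero_of_nonpos (by linarith)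

lemma Fc_mono : Monotone Fc :=
  monotone_of_deriv_nonneg (fun t => (Fc_deriv t).differentiableAt)
    (fun t => by rw [(Fc_deriv t).deriv]; exact Real.smoothTransition.nonneg _)

lemma Fc_nonneg (t : ℝ) : 0 ≤ Fc t := by
  rcases le_total t 1 with h | h
  · rw [Fc_zero h]
  · rw [← Fc_zero le_rfl]; exact Fc_mono h

lemma Fc_ge (t : ℝ) : t - 2 ≤ Fc t := by
  rcases le_total t 2 with h | h
  · linarith [Fc_nonneg t]
  · have h1 : Fc t = Fc 2 + ∫ s in (2 : ℝ)..t, Real.smoothTransition (s - 1) :=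
      (intervalIntegral.integral_add_adjacent_intervals (sT_cont.intervalIntegrable _ _)
        (sT_cont.intervalIntegrable _ _)).symm
    have h2 : ∫ s in (2 : ℝ)..t, Real.smoothTransition (s - 1) = ∫ s in (2 : ℝ)..t, (1 : ℝ) := by
      apply intervalIntegral.integral_congr
      intro s hs
      rw [Set.uIcc_of_le h] at hs
      exact Real.smoothTransition.one_of_one_le (by linarith [hs.1])
    rw [h1, h2]
    simp
    exact Fc_nonneg 2

lemma cutoff {Ω K : Set E2} (hΩ : IsOpen Ω) (hK : IsCompact K) (hKΩ : K ⊆ Ω) :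
    ∃ θ : E2 → ℝ, ContDiff ℝ 2 θ ∧ (∀ᶠ x in 𝓝ˢ K, θ x = 1) ∧ tsupport θ ⊆ Ω ∧
      HasCompactSupport θ ∧ (∀ x, 0 ≤ θ x) ∧ ∀ x, θ x ≤ 1 := by
  obtain ⟨L, hL, hKL, hLΩ⟩ := exists_compact_between hK hΩ hKΩ
  obtain ⟨f, h1, h0, hf⟩ := exists_contMDiffMap_one_nhds_of_subset_interior
    (n := 2) (modelWithCornersSelf ℝ E2) hK.isClosed hKL
  have hs : tsupport f ⊆ L := by
    apply closure_minimal _ hL.isClosed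
    intro x hx
    by_contra h
    exact hx (h0 x h)
  exact ⟨f, f.contMDiff.contDiff, h1, hs.trans hLΩ, hL.of_isClosed_subset (isClosed_tsupport _) hs,
    fun x => (hf x).1, fun x => (hf x).2⟩

lemma ext_contDiff {Ω : Set E2} (hΩ : IsOpen Ω) {n : WithTop ℕ∞} {θ v : E2 → ℝ} (hθ : ContDiff ℝ n θ)
    (hs : tsupport θ ⊆ Ω) (hv : ContDiffOn ℝ n v Ω) : ContDiff ℝ n (fun x => θ x * v x) := by
  rw [contDiff_iff_contDiffAt]
  intro x
  by_cases hx : x ∈ tsupport θ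
  · exact hθ.contDiffAt.mul (hv.contDiffAt (hΩ.mem_nhds (hs hx)))
  · have h1 : (fun x => θ x * v x) =ᶠ[𝓝 x] fun _ => (0 : ℝ) := by
      filter_upwards [notMem_tsupport_iff_eventuallyEq.1 hx] with y hy
      simp [hy]
    exact contDiffAt_const.congr_of_eventuallyEq h1

lemma lap_zero_of_notMem {g : E2 → ℝ} {x : E2} (hx : x ∉ tsupport g) : lap g x = 0 := by
  rw [lap_eq, pd_eq_zero 0 (fun h => hx (pd_tsupport 0 h)), pd_eq_zero 1 (fun h => hx (pd_tsupport 1 h))]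
  simp

lemma lap_cont {g : E2 → ℝ} (hg : ContDiff ℝ 2 g) : Continuous (lap g) := by
  have : lap g = fun x => pd 0 (pd 0 g) x + pd 1 (pd 1 g) x := by funext x; exact lap_eq g x
  rw [this]
  exact (pd_pd_continuous hg).add (pd_pd_continuous hg)

lemma lap_compact {g : E2 → ℝ} (hg : HasCompactSupport g) : HasCompactSupport (lap g) := by
  apply hg.mono'
  intro x hx
  by_contra h
  exact hx (lap_zero_of_notMem h)

lemma lap_int_zero {g : E2 → ℝ} (hg : ContDiff ℝ 2 g) (hc : HasCompactSupport g) :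
    ∫ x, lap g x = 0 := by
  have h := ibp_lap (u := fun _ => (1 : ℝ)) contDiff_const hg hc
  have h1 : ∀ x, lap (fun _ : E2 => (1 : ℝ)) x = 0 := by
    intro x; simp [lap]
  simp only [h1, zero_mul, integral_zero, one_mul] at h
  exact h.symm

lemma trunc {Ω : Set E2} (hΩ : IsOpen Ω) (hb : IsBounded Ω) {w : E2 → ℝ}
    (hw : ContDiffOn ℝ 2 w Ω) (hwc : ContinuousOn w (closure Ω)) (h0 : ∀ x ∈ frontier Ω, w x = 0) :
    ∃ g : E2 → ℝ, ContDiff ℝ 2 g ∧ HasCompactSupport g ∧ (∀ x ∈ Ω, g x = Fc (w x)) ∧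
      (∀ x ∉ Ω, lap g x = 0) ∧
      ∀ x ∈ Ω, Real.smoothTransition (w x - 1) * lap w x ≤ lap g x := by
  set K : Set E2 := closure Ω ∩ w ⁻¹' Set.Ici 1 with hKdef
  have hKc : IsCompact K := by
    apply (hb.isCompact_closure).of_isClosed_subset _ Set.inter_subset_left
    exact hwc.preimage_isClosed_of_isClosed isClosed_closure isClosed_Ici
  have hKΩ : K ⊆ Ω := by
    rintro x ⟨hx, hx1⟩
    by_contra hn
    have : x ∈ frontier Ω := by rw [frontier, hΩ.interior_eq]; exact ⟨hx, hn⟩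
    have h2 := h0 x this
    simp only [Set.mem_preimage, Set.mem_Ici] at hx1
    linarith
  obtain ⟨θ, hθ, hθ1, hθs, hθc, hθ0, hθ1'⟩ := cutoff hΩ hKc hKΩ
  set u : E2 → ℝ := fun x => θ x * w x with hu
  have hu2 : ContDiff ℝ 2 u := ext_contDiff hΩ hθ hθs hw
  have huK : ∀ x, 1 ≤ u x → x ∈ K := by
    intro x hx
    have hxθ : x ∈ tsupport θ := by
      apply subset_tsupport
      intro h
      simp only [hu, h, zero_mul] at hx
      linarith
    refine ⟨subset_closure (hθs hxθ), ?_⟩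
    simp only [Set.mem_preimage, Set.mem_Ici]
    simp only [hu] at hx
    by_contra hw1
    push Not at hw1
    rcases le_total 0 (w x) with h | h
    · nlinarith [hθ0 x, hθ1' x, mul_le_mul_of_nonneg_right (hθ1' x) h]
    · nlinarith [mul_nonneg (hθ0 x) (neg_nonneg.2 h)]
  have hun : ∀ x ∈ K, u =ᶠ[𝓝 x] w := by
    intro x hx
    filter_upwards [(eventually_nhdsSet_iff_forall.1 hθ1) x hx] with y hy
    simp [hu, hy]
  have hts : tsupport (fun x => Fc (u x)) ⊆ K := by
    apply closure_minimal _ hKc.isClosed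
    intro x hx
    apply huK
    by_contra h
    exact hx (Fc_zero (by linarith))
  refine ⟨fun x => Fc (u x), Fc_contDiff.comp hu2, ?_, ?_, ?_, ?_⟩
  · exact hKc.of_isClosed_subset (isClosed_tsupport _) hts
  · intro x hx
    by_cases hxK : x ∈ K
    · simp only [(hun x hxK).self_of_nhds]
    · have h1 : u x < 1 := by by_contra h; exact hxK (huK x (by linarith))
      have h2 : w x < 1 := by
        by_contra h; exact hxK ⟨subset_closure hx, by simp only [Set.mem_preimage, Set.mem_Ici]; linarith⟩
      simp only [Fc_zero h1.le, Fc_zero h2.le]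
  · intro x hx
    exact lap_zero_of_notMem (fun h => hx (hKΩ (hts h)))
  · intro x hx
    by_cases hxK : x ∈ K
    · rw [lap_comp hu2 Fc_deriv Fc_deriv2, lap_congr (hun x hxK), (hun x hxK).self_of_nhds]
      have := Fc_deriv2_nonneg (w x)
      nlinarith [mul_nonneg this (add_nonneg (sq_nonneg (pd 0 u x)) (sq_nonneg (pd 1 u x)))]
    · have h2 : w x < 1 := by
        by_contra h; exact hxK ⟨subset_closure hx, by simp only [Set.mem_preimage, Set.mem_Ici]; linarith⟩
      rw [lap_zero_of_notMem (fun h => hxK (hts h)), Real.smoothTransition.zero_of_nonpos (by linarith)]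
      simp

lemma lap_neg (w : E2 → ℝ) (x : E2) : lap (fun y => - w y) x = - lap w x := by
  have h : ∀ i, pd i (fun y => - w y) = fun y => - pd i w y := by
    intro i; funext y; simp [pd, fderiv_fun_neg]
  have h' : ∀ i (w : E2 → ℝ), pd i (fun y => - w y) = fun y => - pd i w y := by
    intro i w; funext y; simp [pd, fderiv_fun_neg]
  rw [lap_eq, lap_eq, h' 0 w, h' 1 w, h' 0, h' 1]
  ring

lemma lower_bound {Ω : Set E2} (hΩ : IsOpen Ω) (hb : IsBounded Ω) {v f : E2 → ℝ}
    (hv : ContDiffOn ℝ 2 v Ω) (hvc : ContinuousOn v (closure Ω)) (h0 : ∀ x ∈ frontier Ω, v x = 0)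
    (hPDE : ∀ x ∈ Ω, - lap v x = f x) (hf : ∀ x ∈ Ω, 0 < f x) : ∀ x ∈ Ω, -1 ≤ v x := by
  obtain ⟨g, hg, hgc, hgF, hg0, hgl⟩ := trunc hΩ hb (w := fun y => - v y) hv.neg hvc.neg
    (fun x hx => by simp [h0 x hx])
  have hnn : ∀ x, 0 ≤ lap g x := by
    intro x
    by_cases hx : x ∈ Ω
    · refine le_trans ?_ (hgl x hx)
      rw [lap_neg, hPDE x hx]
      exact mul_nonneg (Real.smoothTransition.nonneg _) (hf x hx).le
    · rw [hg0 x hx]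
  have hz : lap g = 0 := by
    by_contra hne
    obtain ⟨x, hx⟩ := Function.ne_iff.1 hne
    have := (lap_cont hg).integral_pos_of_hasCompactSupport_nonneg_nonzero (μ := volume)
      (lap_compact hgc) hnn hx
    rw [lap_int_zero hg hgc] at this
    exact lt_irrefl _ this
  intro x hx
  by_contra hlt
  have h1 := hgl x hx
  rw [lap_neg, hPDE x hx, hz] at h1
  have h2 : 0 < Real.smoothTransition (-v x - 1) := Real.smoothTransition.pos_of_pos (by linarith)
  have := mul_pos h2 (hf x hx)
  simp at h1
  linarith

lemma potential_bound {Ω : Set E2} (hΩ : IsOpen Ω) (hb : IsBounded Ω) {v f : E2 → ℝ}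
    (hv : ContDiffOn ℝ 2 v Ω) (hvc : ContinuousOn v (closure Ω)) (h0 : ∀ x ∈ frontier Ω, v x = 0)
    (hPDE : ∀ x ∈ Ω, - lap v x = f x) (hf : ∀ x ∈ Ω, 0 ≤ f x) (hfi : IntegrableOn f Ω)
    {M H ρ D : ℝ} (hM : ∫ x in Ω, f x ≤ M) (hH : 0 ≤ H) (hρ : 0 < ρ) (hρD : ρ ≤ D) (hD : 1 ≤ D)
    {x : E2} (hx : x ∈ Ω) (hΩD : ∀ y ∈ Ω, ‖y - x‖ ≤ D - 1)
    (hfH : ∀ y ∈ Ω, y ∈ ball x ρ → f y ≤ H) :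
    v x ≤ 2 + M / (2 * π) * Real.log (D / ρ) + H * ρ ^ 2 := by
  obtain ⟨g, hg, hgc, hgF, hg0, hgl⟩ := trunc hΩ hb hv hvc h0
  have hpi := Real.pi_pos
  have hL0 : 0 ≤ Real.log (D / ρ) := Real.log_nonneg (by rw [le_div_iff₀ hρ]; linarith)
  have key : ∀ ε : ℝ, 0 < ε → ε ≤ 1 →
      ∫ y, g y * Pf x ε y ≤ M * Real.log (D / ρ) + 2 * π * (H * ρ ^ 2) := by
    intro ε hε hε1
    have e1 : ∫ y, g y * Pf x ε y = ∫ y, ell x ε y * lap g y := by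
      rw [← ibp_lap (ell_contDiff x hε) hg hgc]
      congr 1; funext y; rw [lap_ell x hε]; ring
    have hi1 : Integrable (fun y => ell x ε y * lap g y) :=
      int_cs ((ell_contDiff x hε).continuous.mul (lap_cont hg)) ((lap_compact hgc).mul_left)
    have hi2 : Integrable (lap g) := int_cs (lap_cont hg) (lap_compact hgc)
    have e2 : ∫ y, ell x ε y * lap g y = ∫ y, (ell x ε y * lap g y - Real.log D * lap g y) := by
      rw [integral_sub hi1 (hi2.const_mul _), integral_const_mul, lap_int_zero hg hgc]
      simp
    have hbI : IntegrableOn (fun y => H * ρ * kabs x ε y) (ball x ρ) := by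
      apply IntegrableOn.mono_set _ ball_subset_closedBall
      exact (continuous_const.mul (kabs_cont x hε)).continuousOn.integrableOn_compact
        (isCompact_closedBall _ _)
    have hJ1 : Integrable (Ω.indicator (fun y => Real.log (D / ρ) * f y)) := by
      rw [integrable_indicator_iff hΩ.measurableSet]
      exact Integrable.const_mul hfi _
    have hJ2 : Integrable ((ball x ρ).indicator (fun y => H * ρ * kabs x ε y)) := by
      rw [integrable_indicator_iff measurableSet_ball]
      exact hbI
    rw [e1, e2]
    calc ∫ y, (ell x ε y * lap g y - Real.log D * lap g y)
        ≤ ∫ y, (Ω.indicator (fun y => Real.log (D / ρ) * f y) y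
            + (ball x ρ).indicator (fun y => H * ρ * kabs x ε y) y) := by
          apply integral_mono (hi1.sub (hi2.const_mul _))
          · exact hJ1.add hJ2
          intro y
          simp only [Pi.sub_apply]
          have hkn : 0 ≤ (ball x ρ).indicator (fun y => H * ρ * kabs x ε y) y :=
            Set.indicator_nonneg (fun y _ => by have := kabs_nonneg x ε y; positivity) y
          by_cases hy : y ∈ Ω
          · rw [Set.indicator_of_mem hy]
            have hq := qf_pos (x := x) hε y
            have hτ0 : ell x ε y ≤ Real.log D := by
              unfold ell
              have : Real.log (qf x ε y) ≤ Real.log (D ^ 2) := by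
                apply Real.log_le_log hq
                unfold qf
                have := hΩD y hy
                nlinarith [norm_nonneg (y - x)]
              rw [Real.log_pow] at this
              push_cast at this
              linarith
            have hlap : - f y ≤ lap g y := by
              have h1 := hgl y hy
              have h2 := hPDE y hy
              have h3 := Real.smoothTransition.le_one (v y - 1)
              have h4 := Real.smoothTransition.nonneg (v y - 1)
              nlinarith [hf y hy]
            have hfy := hf y hy
            have h5 : ell x ε y * lap g y - Real.log D * lap g y ≤ (Real.log D - ell x ε y) * f y := by
              nlinarith
            refine h5.trans ?_
            rw [Real.log_div (by linarith) hρ.ne']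
            by_cases hyb : y ∈ ball x ρ
            · rw [Set.indicator_of_mem hyb]
              have h6 : Real.log ρ - ell x ε y ≤ ρ * kabs x ε y := by
                have hs := Real.sqrt_pos.2 hq
                have h7 : ell x ε y = Real.log (Real.sqrt (qf x ε y)) := by
                  rw [Real.log_sqrt hq.le, ell]; ring
                rw [h7, ← Real.log_div hρ.ne' hs.ne', kabs, ← div_eq_mul_inv]
                exact (Real.log_le_sub_one_of_pos (by positivity)).trans (by linarith)
              have h8 := hfH y hy hyb
              have h9 := kabs_nonneg x ε y
              have h10 : (Real.log ρ - ell x ε y) * f y ≤ ρ * kabs x ε y * f y := by gcongr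
              have h11 : ρ * kabs x ε y * f y ≤ ρ * kabs x ε y * H := by gcongr
              nlinarith
            · rw [Set.indicator_of_notMem hyb]
              have h6 : Real.log ρ ≤ ell x ε y := by
                have h7 : Real.log (ρ ^ 2) ≤ Real.log (qf x ε y) := by
                  apply Real.log_le_log (by positivity)
                  rw [mem_ball, dist_eq_norm, not_lt] at hyb
                  unfold qf
                  nlinarith [sq_nonneg ε]
                rw [Real.log_pow] at h7
                push_cast at h7
                unfold ell
                linarith
              nlinarith
          · rw [Set.indicator_of_notMem hy, hg0 y hy]
            simpa using hkn
      _ = Real.log (D / ρ) * (∫ y in Ω, f y) + H * ρ * (∫ y in ball x ρ, kabs x ε y) := by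
          rw [integral_add hJ1 hJ2, integral_indicator hΩ.measurableSet,
            integral_indicator measurableSet_ball, integral_const_mul, integral_const_mul]
      _ ≤ M * Real.log (D / ρ) + 2 * π * (H * ρ ^ 2) := by
          have := kabs_int x hε hρ
          have h1 : Real.log (D / ρ) * (∫ y in Ω, f y) ≤ Real.log (D / ρ) * M := by gcongr
          have h2 : H * ρ * (∫ y in ball x ρ, kabs x ε y) ≤ H * ρ * (2 * π * ρ) := by gcongr
          nlinarith
  have hlim := approx_id hg.continuous hgc x
  have hle : 2 * π * g x ≤ M * Real.log (D / ρ) + 2 * π * (H * ρ ^ 2) := by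
    apply le_of_tendsto hlim
    filter_upwards [eventually_ge_atTop 1] with c hc
    exact key c⁻¹ (by positivity) (inv_le_one_of_one_le₀ hc)
  have h1 := hgF x hx
  have h2 := Fc_ge (v x)
  rw [h1] at hle
  have h3 : v x - 2 ≤ (M * Real.log (D / ρ) + 2 * π * (H * ρ ^ 2)) / (2 * π) := by
    rw [le_div_iff₀ (by positivity)]; nlinarith
  have h4 : (M * Real.log (D / ρ) + 2 * π * (H * ρ ^ 2)) / (2 * π) =
    M / (2 * π) * Real.log (D / ρ) + H * ρ ^ 2 := by field_simp
  linarith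


lemma lap_add {u g : E2 → ℝ} (hu : ContDiff ℝ 2 u) (hg : ContDiff ℝ 2 g) (x : E2) :
    lap (fun y => u y + g y) x = lap u x + lap g x := by
  have h : ∀ i, pd i (fun y => u y + g y) = fun y => pd i u y + pd i g y := by
    intro i; funext y
    exact pd_add i (diff_of_C1 (C1_of_C2 hu) y) (diff_of_C1 (C1_of_C2 hg) y)
  rw [lap_eq, lap_eq, lap_eq, h 0, h 1,
    pd_add 0 (diff_of_C1 (pd_contDiff1 hu) x) (diff_of_C1 (pd_contDiff1 hg) x),
    pd_add 1 (diff_of_C1 (pd_contDiff1 hu) x) (diff_of_C1 (pd_contDiff1 hg) x)]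
  ring

lemma lap_const_mul {u : E2 → ℝ} (c : ℝ) (hu : ContDiff ℝ 2 u) (x : E2) :
    lap (fun y => c * u y) x = c * lap u x := by
  have h : ∀ i, pd i (fun y => c * u y) = fun y => c * pd i u y := by
    intro i; funext y
    exact pd_const_mul i c (diff_of_C1 (C1_of_C2 hu) y)
  rw [lap_eq, lap_eq, h 0, h 1, pd_const_mul 0 c (diff_of_C1 (pd_contDiff1 hu) x),
    pd_const_mul 1 c (diff_of_C1 (pd_contDiff1 hu) x)]
  ring

lemma lap_qf (x : E2) (ε : ℝ) (y : E2) : lap (qf x ε) y = 4 := by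
  have h : ∀ i, pd i (qf x ε) = fun y => 2 * (y i - x i) := by
    intro i; funext y; exact pd_qf i x ε y
  rw [lap_eq, h 0, h 1, pd_const_mul 0 2 (diff_of_C1 (C1_of_C2 (coord_diff 0 x)) y),
    pd_const_mul 1 2 (diff_of_C1 (C1_of_C2 (coord_diff 1 x)) y), pd_coord, pd_coord]
  norm_num

lemma pd_zero_of_const {χ : E2 → ℝ} {x : E2} {c : ℝ} (i : Fin 2) (h : χ =ᶠ[𝓝 x] fun _ => c) :
    pd i χ x = 0 := by
  rw [pd_congr i h]; simp [pd]

lemma lap_zero_of_const {χ : E2 → ℝ} {x : E2} {c : ℝ} (h : χ =ᶠ[𝓝 x] fun _ => c) :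
    lap χ x = 0 := by
  rw [lap_congr h]; simp [lap]

lemma pd_bdd {χ : E2 → ℝ} (h : ContDiff ℝ 2 χ) (hc : HasCompactSupport χ) :
    ∃ A : ℝ, 0 < A ∧ ∀ x, |χ x| ≤ A ∧ (∀ i, |pd i χ x| ≤ A) ∧ (∀ i j, |pd i (pd j χ) x| ≤ A) ∧
      |lap χ x| ≤ A := by
  have b : ∀ g : E2 → ℝ, Continuous g → HasCompactSupport g → ∃ A, ∀ x, |g x| ≤ A := by
    intro g hg hgc
    obtain ⟨C, hC⟩ := hgc.exists_bound_of_continuous hg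
    exact ⟨C, hC⟩
  obtain ⟨A0, h0⟩ := b χ h.continuous hc
  choose A1 h1 using fun i => b (pd i χ) (pd_continuous (C1_of_C2 h)) (pd_compact i hc)
  choose A2 h2 using fun i => fun j => b (pd i (pd j χ)) (pd_pd_continuous h)
    (pd_compact i (pd_compact j hc))
  obtain ⟨A3, h3⟩ := b (lap χ) (lap_cont h) (lap_compact hc)
  have p0 : 0 ≤ A0 := (abs_nonneg _).trans (h0 0)
  have p1 : ∀ i, 0 ≤ A1 i := fun i => (abs_nonneg _).trans (h1 i 0)
  have p2 : ∀ i j, 0 ≤ A2 i j := fun i j => (abs_nonneg _).trans (h2 i j 0)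
  have p3 : 0 ≤ A3 := (abs_nonneg _).trans (h3 0)
  refine ⟨A0 + (∑ i, A1 i) + (∑ i, ∑ j, A2 i j) + A3 + 1, ?_, fun x => ⟨?_, ?_, ?_, ?_⟩⟩
  · have := Finset.sum_nonneg (fun i (_ : i ∈ Finset.univ) => p1 i)
    have := Finset.sum_nonneg (fun i (_ : i ∈ Finset.univ) =>
      Finset.sum_nonneg (fun j (_ : j ∈ Finset.univ) => p2 i j))
    linarith
  · have := h0 x
    simp only [Fin.sum_univ_two]
    linarith [p1 0, p1 1, p2 0 0, p2 0 1, p2 1 0, p2 1 1]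
  · intro i
    have := h1 i x
    simp only [Fin.sum_univ_two]
    fin_cases i <;> simp at this ⊢ <;> linarith [p1 0, p1 1, p2 0 0, p2 0 1, p2 1 0, p2 1 1]
  · intro i j
    have := h2 i j x
    simp only [Fin.sum_univ_two]
    fin_cases i <;> fin_cases j <;> simp at this ⊢ <;>
      linarith [p1 0, p1 1, p2 0 0, p2 0 1, p2 1 0, p2 1 1]
  · have := h3 x
    simp only [Fin.sum_univ_two]
    linarith [p1 0, p1 1, p2 0 0, p2 0 1, p2 1 0, p2 1 1]

lemma mean_unit : ∃ C > (0 : ℝ), ∀ g : E2 → ℝ, ContDiff ℝ 2 g → (∀ y ∈ ball (0 : E2) 1, 0 ≤ g y) →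
    (∀ y ∈ ball (0 : E2) 1, 0 ≤ lap g y) → g 0 ≤ C * ∫ y in ball (0 : E2) 1, g y := by
  obtain ⟨χ, hχ, hχ1, hχs, hχc, hχ0, hχ1'⟩ := cutoff (Ω := ball (0 : E2) 1)
    (K := closedBall 0 (1 / 2)) isOpen_ball (isCompact_closedBall _ _)
    (closedBall_subset_ball (by norm_num))
  obtain ⟨A, hA, hb⟩ := pd_bdd hχ hχc
  refine ⟨10 * A, by positivity, fun g hg hg0 hgl => ?_⟩
  have hpi := Real.pi_gt_three
  have hgi : IntegrableOn g (ball (0 : E2) 1) :=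
    (hg.continuous.continuousOn.integrableOn_compact (isCompact_closedBall 0 1)).mono_set
      ball_subset_closedBall
  have hI0 : 0 ≤ ∫ y in ball (0 : E2) 1, g y := setIntegral_nonneg measurableSet_ball hg0
  have key : ∀ ε : ℝ, 0 < ε → ε ≤ 1 →
      ∫ y, (g y * χ y) * Pf 0 ε y ≤ 10 * A * ∫ y in ball (0 : E2) 1, g y := by
    intro ε hε hε1
    have hell := ell_contDiff (0 : E2) hε
    have hTc : ContDiff ℝ 2 (fun y => 1 + (-1) * ell (0 : E2) ε y) :=
      contDiff_const.add (contDiff_const.mul hell)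
    have hN : ContDiff ℝ 2 (fun y => χ y * (1 + (-1) * ell (0 : E2) ε y)) := hχ.mul hTc
    have hNc : HasCompactSupport (fun y => χ y * (1 + (-1) * ell (0 : E2) ε y)) := hχc.mul_right
    have e1 := ibp_lap hg hN hNc
    have hsup : ∀ y, y ∉ ball (0 : E2) 1 → χ y = 0 := fun y hy =>
      image_eq_zero_of_notMem_tsupport (fun h => hy (hχs h))
    have hl1 : 0 ≤ ∫ y, lap g y * (χ y * (1 + (-1) * ell (0 : E2) ε y)) := by
      apply integral_nonneg
      intro y
      by_cases hy : y ∈ ball (0 : E2) 1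
      · have h1 := hgl y hy
        have h2 : ell (0 : E2) ε y ≤ 1 := by
          have hq := qf_pos (x := (0 : E2)) hε y
          have h3 : qf 0 ε y ≤ 2 := by
            rw [mem_ball, dist_eq_norm] at hy
            unfold qf
            nlinarith [norm_nonneg (y - 0)]
          have := Real.log_le_sub_one_of_pos hq
          unfold ell; linarith
        have := hχ0 y
        have : 0 ≤ 1 + (-1) * ell (0 : E2) ε y := by linarith
        simp only [Pi.zero_apply]
        positivity
      · simp [hsup y hy]
    have hlN : ∀ y, lap (fun y => χ y * (1 + (-1) * ell (0 : E2) ε y)) y =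
        lap χ y * (1 - ell 0 ε y) - 2 * (pd 0 χ y * Kf 0 0 ε y + pd 1 χ y * Kf 1 0 ε y)
          - χ y * Pf 0 ε y := by
      intro y
      have hd := diff_of_C1 (C1_of_C2 hell) y
      have hp : ∀ i, pd i (fun y => 1 + (-1) * ell (0 : E2) ε y) y = - Kf i 0 ε y := by
        intro i
        rw [pd_add i (differentiableAt_const _) (hd.const_mul _), pd_const_mul i _ hd, pd_ell i 0 hε]
        simp [pd]
      rw [lap_mul hχ hTc, hp 0, hp 1, lap_add contDiff_const (contDiff_const.mul hell),
        lap_const_mul _ hell, lap_ell 0 hε]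
      have : lap (fun _ : E2 => (1 : ℝ)) y = 0 := by simp [lap]
      rw [this]; ring
    have hi1 : Integrable (fun y => (g y * χ y) * Pf 0 ε y) :=
      int_cs ((hg.continuous.mul hχ.continuous).mul (Pf_cont 0 hε)) (hχc.mul_left.mul_right)
    have hi2 : Integrable (fun y => g y * lap (fun y => χ y * (1 + (-1) * ell (0 : E2) ε y)) y) :=
      int_cs (hg.continuous.mul (lap_cont hN)) ((lap_compact hNc).mul_left)
    have e2 : ∫ y, (g y * χ y) * Pf 0 ε y ≤
        ∫ y, ((g y * χ y) * Pf 0 ε y + g y * lap (fun y => χ y * (1 + (-1) * ell (0 : E2) ε y)) y) := by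
      rw [integral_add hi1 hi2, ← e1]; linarith
    refine e2.trans ?_
    rw [← integral_const_mul, ← integral_indicator measurableSet_ball]
    apply integral_mono (hi1.add hi2)
    · rw [integrable_indicator_iff measurableSet_ball]; exact Integrable.const_mul hgi _
    intro y
    simp only [Pi.add_apply, hlN]
    by_cases hy : y ∈ ball (0 : E2) 1
    · rw [Set.indicator_of_mem hy]
      have hgy := hg0 y hy
      have hmain : lap χ y * (1 - ell 0 ε y) - 2 * (pd 0 χ y * Kf 0 0 ε y + pd 1 χ y * Kf 1 0 ε y)
          ≤ 10 * A := by
        by_cases hyK : y ∈ closedBall (0 : E2) (1 / 2)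
        · have hev := (eventually_nhdsSet_iff_forall.1 hχ1) y hyK
          rw [pd_zero_of_const (c := 1) 0 hev, pd_zero_of_const (c := 1) 1 hev, lap_zero_of_const (c := 1) hev]
          simp; positivity
        · obtain ⟨-, hp, -, hl⟩ := hb y
          rw [mem_closedBall, dist_eq_norm, not_le] at hyK
          rw [mem_ball, dist_eq_norm] at hy
          have hq := qf_pos (x := (0 : E2)) hε y
          have hell1 : |1 - ell 0 ε y| ≤ 2 := by
            have h3 : qf 0 ε y ≤ 2 := by
              unfold qf
              nlinarith [norm_nonneg (y - 0)]
            have h4 : 1 / 4 ≤ qf 0 ε y := by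
              unfold qf
              nlinarith [norm_nonneg (y - 0)]
            have h5 := Real.log_le_sub_one_of_pos hq
            have h6 : Real.log (1 / 4) ≤ Real.log (qf 0 ε y) := Real.log_le_log (by norm_num) h4
            have h7 : Real.log (1 / 4) = - (2 * Real.log 2) := by
              rw [show (1 / 4 : ℝ) = (2 ^ 2)⁻¹ by norm_num, Real.log_inv, Real.log_pow]; push_cast; ring
            have h8 := Real.log_two_lt_d9
            rw [abs_le]; unfold ell
            constructor <;> linarith
          have hk : ∀ i, |Kf i 0 ε y| ≤ 2 := fun i => (Kf_le i 0 hε y).trans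
            ((kabs_le 0 ε (ρ := 1 / 2) (by norm_num) hyK.le).trans (by norm_num))
          have t1 : |lap χ y * (1 - ell 0 ε y)| ≤ A * 2 := by rw [abs_mul]; gcongr
          have t2 : |pd 0 χ y * Kf 0 0 ε y| ≤ A * 2 := by
            rw [abs_mul]; exact mul_le_mul (hp 0) (hk 0) (abs_nonneg _) hA.le
          have t3 : |pd 1 χ y * Kf 1 0 ε y| ≤ A * 2 := by
            rw [abs_mul]; exact mul_le_mul (hp 1) (hk 1) (abs_nonneg _) hA.le
          rw [abs_le] at t1 t2 t3
          linarith [t1.2, t2.1, t3.1]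
      nlinarith
    · rw [Set.indicator_of_notMem hy]
      have hts : y ∉ tsupport χ := fun h => hy (hχs h)
      rw [hsup y hy, pd_eq_zero 0 hts, pd_eq_zero 1 hts, lap_zero_of_notMem hts]
      simp
  have hlim := approx_id (hg.continuous.mul hχ.continuous) (hχc.mul_left) 0
  have hle : 2 * π * (g 0 * χ 0) ≤ 10 * A * ∫ y in ball (0 : E2) 1, g y := by
    apply le_of_tendsto hlim
    filter_upwards [eventually_ge_atTop 1] with c hc
    exact key c⁻¹ (by positivity) (inv_le_one_of_one_le₀ hc)
  have hχ01 : χ 0 = 1 := hχ1.self_of_nhdsSet 0 (by simp)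
  rw [hχ01] at hle
  have := hg0 0 (by simp)
  nlinarith

lemma ball_scale (F : E2 → ℝ) (p : E2) {t : ℝ} (ht : 0 < t) (r : ℝ) :
    ∫ y in ball (0 : E2) r, F (p + t • y) = (t ^ 2)⁻¹ * ∫ y in ball p (t * r), F y := by
  rw [Measure.setIntegral_comp_smul_of_pos volume (fun y => F (p + y)) _ ht, fr2, ball_translate F p,
    smul_eq_mul, _root_.smul_ball ht.ne']
  simp [abs_of_pos ht]

lemma mean_val : ∃ C > (0 : ℝ), ∀ g : E2 → ℝ, ContDiff ℝ 2 g → ∀ (p : E2) (t : ℝ), 0 < t →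
    (∀ y ∈ ball p t, 0 ≤ g y) → (∀ y ∈ ball p t, 0 ≤ lap g y) →
    t ^ 2 * g p ≤ C * ∫ y in ball p t, g y := by
  obtain ⟨C, hC, h⟩ := mean_unit
  refine ⟨C, hC, fun g hg p t ht h0 hl => ?_⟩
  have hmem : ∀ y ∈ ball (0 : E2) 1, p + t • y ∈ ball p t := by
    intro y hy
    rw [mem_ball, dist_eq_norm] at *
    rw [add_sub_cancel_left, norm_smul, Real.norm_of_nonneg ht.le]
    simp at hy
    nlinarith
  have hg' : ContDiff ℝ 2 (fun y => g (p + t • y)) :=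
    hg.comp (contDiff_const.add (contDiff_id.const_smul t))
  have := h (fun y => g (p + t • y)) hg'
    (fun y hy => h0 _ (hmem y hy)) (fun y hy => by
      rw [lap_affine t p hg]
      exact mul_nonneg (by positivity) (hl _ (hmem y hy)))
  rw [ball_scale g p ht, mul_one] at this
  simp only [smul_zero, add_zero] at this
  have h2 : t ^ 2 * g p ≤ t ^ 2 * (C * ((t ^ 2)⁻¹ * ∫ y in ball p t, g y)) := by gcongr
  refine h2.trans (le_of_eq ?_)
  field_simp

lemma eps_reg {Λ : ℝ} (hΛ : 0 < Λ) : ∃ η > (0 : ℝ), ∀ (u W : E2 → ℝ), ContDiff ℝ 2 u → Continuous W →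
    ∀ (x0 : E2) (ρ : ℝ), 0 < ρ → (∀ y ∈ ball x0 ρ, - lap u y = W y * Real.exp (u y)) →
    (∀ y ∈ ball x0 ρ, 0 < W y) → (∀ y ∈ ball x0 ρ, ∀ z ∈ ball x0 ρ, W y ≤ Λ * W z) →
    (∫ y in ball x0 ρ, W y * Real.exp (u y)) ≤ η →
    W x0 * Real.exp (u x0) * ρ ^ 2 ≤ 16 := by
  obtain ⟨C, hC, hmv⟩ := mean_val
  have hE := Real.exp_pos 1
  refine ⟨1 / (2 * C * Real.exp 1 * Λ), by positivity, ?_⟩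
  intro u W hu hW x0 ρ hρ hPDE hWp hWr hintW
  by_contra hcon
  push Not at hcon
  set f : E2 → ℝ := fun y => W y * Real.exp (u y) with hf
  have hfc : Continuous f := hW.mul (Real.continuous_exp.comp hu.continuous)
  obtain ⟨y0, hy0, hmax⟩ := (isCompact_closedBall x0 ρ).exists_isMaxOn
    ⟨x0, mem_closedBall_self hρ.le⟩
    (f := fun y => (ρ - ‖y - x0‖) ^ 2 * f y) (by fun_prop)
  have hm0 : 16 < (ρ - ‖y0 - x0‖) ^ 2 * f y0 := by
    have h := hmax (mem_closedBall_self hρ.le)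
    simp only [Set.mem_ofPred_eq, sub_self, norm_zero, sub_zero] at h
    have h1 : f x0 * ρ ^ 2 = ρ ^ 2 * f x0 := mul_comm _ _
    have h2 : 16 < f x0 * ρ ^ 2 := hcon
    linarith
  have hd0 : ‖y0 - x0‖ < ρ := by
    have h1 : ‖y0 - x0‖ ≤ ρ := by rw [mem_closedBall, dist_eq_norm] at hy0; exact hy0
    rcases h1.lt_or_eq with h | h
    · exact h
    · rw [h] at hm0; simp at hm0; linarith
  set s : ℝ := (ρ - ‖y0 - x0‖) / 2 with hs
  have hs0 : 0 < s := by rw [hs]; linarith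
  have hy0b : y0 ∈ ball x0 ρ := by rw [mem_ball, dist_eq_norm]; exact hd0
  have hf0 : 0 < f y0 := mul_pos (hWp y0 hy0b) (Real.exp_pos _)
  have hsf : 4 < s ^ 2 * f y0 := by
    have : (ρ - ‖y0 - x0‖) = 2 * s := by rw [hs]; ring
    rw [this] at hm0; nlinarith
  have hsub : ∀ y ∈ ball y0 s, y ∈ ball x0 ρ ∧ f y ≤ 4 * f y0 := by
    intro y hy
    rw [mem_ball, dist_eq_norm] at hy
    have htri : ‖y - x0‖ ≤ ‖y - y0‖ + ‖y0 - x0‖ := by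
      have := norm_add_le (y - y0) (y0 - x0); simpa using this
    have hlt : ‖y - x0‖ < ρ := by
      have : ρ = 2 * s + ‖y0 - x0‖ := by rw [hs]; ring
      linarith
    refine ⟨by rw [mem_ball, dist_eq_norm]; exact hlt, ?_⟩
    have h := hmax (show y ∈ closedBall x0 ρ by rw [mem_closedBall, dist_eq_norm]; exact hlt.le)
    simp only [Set.mem_ofPred_eq] at h
    have e : (ρ - ‖y0 - x0‖) = 2 * s := by rw [hs]; ring
    rw [e] at h
    have h1 : s ≤ ρ - ‖y - x0‖ := by linarith
    have h2 : 0 < f y := mul_pos (hWp y (by rw [mem_ball, dist_eq_norm]; exact hlt)) (Real.exp_pos _)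
    have h3 : s ^ 2 * f y ≤ (ρ - ‖y - x0‖) ^ 2 * f y := by gcongr
    have h4 : s ^ 2 * f y ≤ s ^ 2 * (4 * f y0) := by nlinarith
    exact le_of_mul_le_mul_left h4 (by positivity)
  set t : ℝ := (Real.sqrt (f y0))⁻¹ with ht
  have hsq := Real.sqrt_pos.2 hf0
  have ht0 : 0 < t := by positivity
  have ht2 : t ^ 2 * f y0 = 1 := by
    rw [ht, inv_pow, Real.sq_sqrt hf0.le]; field_simp
  have hts : t ≤ s := by
    apply le_of_sq_le_sq _ hs0.le |> fun h => h
    have : t ^ 2 * f y0 ≤ s ^ 2 * f y0 := by linarith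
    exact le_of_mul_le_mul_right this hf0
  set h : E2 → ℝ := fun y => u y + f y0 * qf y0 0 y with hh
  have hh2 : ContDiff ℝ 2 h := hu.add (contDiff_const.mul (qf_contDiff y0 0))
  have hlaph : ∀ y ∈ ball y0 s, 0 ≤ lap h y := by
    intro y hy
    obtain ⟨h1, h2⟩ := hsub y hy
    rw [hh, lap_add hu (contDiff_const.mul (qf_contDiff y0 0)), lap_const_mul _ (qf_contDiff y0 0),
      lap_qf]
    have := hPDE y h1
    have e : f y = W y * Real.exp (u y) := rfl
    linarith
  have hres := hmv (fun y => Real.exp (h y)) (Real.contDiff_exp.comp hh2) y0 t ht0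
    (fun y _ => (Real.exp_pos _).le) (fun y hy => by
      rw [lap_comp hh2 Real.hasDerivAt_exp Real.hasDerivAt_exp]
      have := hlaph y (ball_subset_ball hts hy)
      positivity)
  have hh0 : h y0 = u y0 := by simp [hh, qf]
  rw [hh0] at hres
  have hbt : ball y0 t ⊆ ball x0 ρ := fun y hy => (hsub y (ball_subset_ball hts hy)).1
  have hloc : ∀ {F : E2 → ℝ}, Continuous F → ∀ (p : E2) (r : ℝ), IntegrableOn F (ball p r) := by
    intro F hF p r
    exact (hF.continuousOn.integrableOn_compact (isCompact_closedBall p r)).mono_set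
      ball_subset_closedBall
  have hW0 := hWp y0 hy0b
  have hb1 : ∫ y in ball y0 t, Real.exp (h y) ≤ ∫ y in ball y0 t, (Real.exp 1 * Λ / W y0) * f y := by
    apply setIntegral_mono_on (hloc (Real.continuous_exp.comp hh2.continuous) _ _)
      (hloc (continuous_const.mul hfc) _ _) measurableSet_ball
    intro y hy
    have hyρ := hbt hy
    rw [mem_ball, dist_eq_norm] at hy
    have e1 : h y ≤ u y + 1 := by
      simp only [hh, qf]
      have : f y0 * (‖y - y0‖ ^ 2 + 0 ^ 2) ≤ f y0 * t ^ 2 := by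
        gcongr
        nlinarith [norm_nonneg (y - y0)]
      linarith
    have e2 : Real.exp (h y) ≤ Real.exp (u y) * Real.exp 1 := by
      rw [← Real.exp_add]; exact Real.exp_le_exp.2 e1
    refine e2.trans ?_
    have e3 := hWr y0 hy0b y hyρ
    rw [hf]
    have e4 : 1 ≤ Λ * W y / W y0 := by rw [le_div_iff₀ hW0]; linarith
    have e5 : 0 < Real.exp (u y) * Real.exp 1 := by positivity
    calc Real.exp (u y) * Real.exp 1 ≤ Real.exp (u y) * Real.exp 1 * (Λ * W y / W y0) :=
          le_mul_of_one_le_right e5.le e4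
      _ = Real.exp 1 * Λ / W y0 * (W y * Real.exp (u y)) := by ring
  have hb2 : ∫ y in ball y0 t, f y ≤ ∫ y in ball x0 ρ, f y := by
    apply setIntegral_mono_set (hloc hfc _ _) _ (LE.le.eventuallyLE hbt)
    filter_upwards [ae_restrict_mem measurableSet_ball] with y hy
    exact (mul_pos (hWp y hy) (Real.exp_pos _)).le
  rw [integral_const_mul] at hb1
  have hb3 : (Real.exp 1 * Λ / W y0) * ∫ y in ball y0 t, f y ≤
      (Real.exp 1 * Λ / W y0) * (1 / (2 * C * Real.exp 1 * Λ)) := by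
    apply mul_le_mul_of_nonneg_left _ (by positivity)
    exact hb2.trans hintW
  have hb4 : t ^ 2 * Real.exp (u y0) ≤ C * ((Real.exp 1 * Λ / W y0) * (1 / (2 * C * Real.exp 1 * Λ))) :=
    hres.trans (by gcongr; exact hb1.trans hb3)
  have hb5 : C * ((Real.exp 1 * Λ / W y0) * (1 / (2 * C * Real.exp 1 * Λ))) = 1 / (2 * W y0) := by
    field_simp
  rw [hb5, le_div_iff₀ (by positivity)] at hb4
  have : t ^ 2 * f y0 = t ^ 2 * Real.exp (u y0) * W y0 := by rw [hf]; ring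
  nlinarith


lemma int_add {f g : E2 → ℝ} {μ : Measure E2} (hf : Integrable f μ) (hg : Integrable g μ) :
    Integrable (fun y => f y + g y) μ := hf.add hg

lemma int_sub {f g : E2 → ℝ} {μ : Measure E2} (hf : Integrable f μ) (hg : Integrable g μ) :
    Integrable (fun y => f y - g y) μ := hf.sub hg

/-- First component of the traceless Hopf tensor. -/
def af (u : E2 → ℝ) (x : E2) : ℝ :=
  pd 0 (pd 0 u) x - pd 1 (pd 1 u) x - 1 / 2 * (pd 0 u x ^ 2 - pd 1 u x ^ 2)

/-- Second component of the traceless Hopf tensor. -/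
def bf (u : E2 → ℝ) (x : E2) : ℝ := 2 * pd 0 (pd 1 u) x - pd 0 u x * pd 1 u x

lemma af_cont {u : E2 → ℝ} (hu : ContDiff ℝ 2 u) : Continuous (af u) := by
  have h1 := fun i => pd_continuous (i := i) (C1_of_C2 hu)
  have h2 := fun i j => pd_pd_continuous (i := i) (j := j) hu
  exact ((h2 0 0).sub (h2 1 1)).sub (continuous_const.mul (((h1 0).pow 2).sub ((h1 1).pow 2)))

lemma bf_cont {u : E2 → ℝ} (hu : ContDiff ℝ 2 u) : Continuous (bf u) := by
  have h1 := fun i => pd_continuous (i := i) (C1_of_C2 hu)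
  have h2 := fun i j => pd_pd_continuous (i := i) (j := j) hu
  exact (continuous_const.mul (h2 0 1)).sub ((h1 0).mul (h1 1))

lemma weak_id {i j : Fin 2} (hij : i ≠ j) {u W η : E2 → ℝ} (hu : ContDiff ℝ 2 u)
    (hW : ContDiff ℝ 1 W) (hη : ContDiff ℝ 2 η) (hc : HasCompactSupport η)
    (hPDE : ∀ y ∈ tsupport η, - lap u y = W y * Real.exp (u y)) :
    ∫ y, ((pd i (pd i u) y - pd j (pd j u) y - 1 / 2 * (pd i u y ^ 2 - pd j u y ^ 2)) * pd i η y
      + (2 * pd i (pd j u) y - pd i u y * pd j u y) * pd j η y) =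
    ∫ y, pd i W y * Real.exp (u y) * η y := by
  have c1 := fun i => pd_contDiff1 (i := i) hu
  have d1 := fun i y => diff_of_C1 (c1 i) y
  have k1 := fun i => (c1 i).continuous
  have k2 := fun i j => pd_pd_continuous (i := i) (j := j) hu
  have e1 := fun i => pd_contDiff1 (i := i) hη
  have ec := fun i => pd_compact i hc
  have n1 := fun i => (e1 i).continuous
  have hI : ∀ {g h : E2 → ℝ}, Continuous g → Continuous h → HasCompactSupport h →
      Integrable (fun y => g y * h y) := fun hg hh hhc => int_cs (hg.mul hh) hhc.mul_left
  have hWe : ContDiff ℝ 1 (fun y => W y * Real.exp (u y)) :=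
    hW.mul (Real.contDiff_exp.comp (C1_of_C2 hu))
  have a1 : ∫ y, pd j (pd j u) y * pd i η y = ∫ y, pd i (pd j u) y * pd j η y := by
    rw [ibp j (c1 j) (e1 i) (ec i), ibp i (c1 j) (e1 j) (ec j)]
    simp only [pd_comm hη j i]
  have a2 : ∫ y, (pd i (pd i u) y + pd j (pd j u) y) * pd i η y
      = ∫ y, (pd i W y * Real.exp (u y) + W y * Real.exp (u y) * pd i u y) * η y := by
    have : ∀ y, (pd i (pd i u) y + pd j (pd j u) y) * pd i η y =
        - (W y * Real.exp (u y) * pd i η y) := by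
      intro y
      by_cases hy : y ∈ tsupport η
      · rw [← lap_eq' hij, ← hPDE y hy]; ring
      · rw [pd_eq_zero i hy]; simp
    simp only [this]
    rw [integral_neg, ← ibp i hWe (C1_of_C2 hη) hc]
    congr 1
    funext y
    rw [pd_mul i (diff_of_C1 hW y) ((diff_of_C1 (C1_of_C2 hu) y).exp),
      pd_comp i (Real.hasDerivAt_exp (u y)) (diff_of_C1 (C1_of_C2 hu) y)]
    ring
  have a3 : ∫ y, (1 / 2 * (pd i u y * pd i u y - pd j u y * pd j u y)) * pd i η y =
      - ∫ y, (pd i u y * pd i (pd i u) y - pd j u y * pd i (pd j u) y) * η y := by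
    have h := ibp i (u := fun y => 1 / 2 * (pd i u y * pd i u y + (-1) * (pd j u y * pd j u y))) (g := η)
      (contDiff_const.mul (((c1 i).mul (c1 i)).add (contDiff_const.mul ((c1 j).mul (c1 j)))))
      (C1_of_C2 hη) hc
    have e : ∀ y, pd i (fun y => 1 / 2 * (pd i u y * pd i u y + (-1) * (pd j u y * pd j u y))) y =
        pd i u y * pd i (pd i u) y - pd j u y * pd i (pd j u) y := by
      intro y
      rw [pd_const_mul i _ (((d1 i y).fun_mul (d1 i y)).fun_add (((d1 j y).fun_mul (d1 j y)).const_mul _)),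
        pd_add i ((d1 i y).fun_mul (d1 i y)) (((d1 j y).fun_mul (d1 j y)).const_mul _),
        pd_const_mul i _ ((d1 j y).fun_mul (d1 j y)), pd_mul i (d1 i y) (d1 i y),
        pd_mul i (d1 j y) (d1 j y)]
      ring
    simp only [e] at h
    rw [h, neg_neg]
    congr 1; funext y; ring
  have a4 : ∫ y, (pd i u y * pd j u y) * pd j η y =
      - ∫ y, (pd i (pd j u) y * pd j u y + pd i u y * pd j (pd j u) y) * η y := by
    have h := ibp j (u := fun y => pd i u y * pd j u y) (g := η) ((c1 i).mul (c1 j)) (C1_of_C2 hη) hc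
    have e : ∀ y, pd j (fun y => pd i u y * pd j u y) y =
        pd i (pd j u) y * pd j u y + pd i u y * pd j (pd j u) y := by
      intro y
      rw [pd_mul j (d1 i y) (d1 j y), pd_comm hu j i]
    simp only [e] at h
    rw [h, neg_neg]
  have i1 := hI ((k2 i i).add (k2 j j)) (n1 i) (ec i)
  have i2 := hI (k2 j j) (n1 i) (ec i)
  have i3 := hI (k2 i j) (n1 j) (ec j)
  have i4 := hI (continuous_const.mul (((k1 i).mul (k1 i)).sub ((k1 j).mul (k1 j))) :
    Continuous fun y => 1 / 2 * (pd i u y * pd i u y - pd j u y * pd j u y)) (n1 i) (ec i)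
  have i5 := hI ((k1 i).mul (k1 j)) (n1 j) (ec j)
  have j1 := hI (((k1 i).mul (k2 i i)).sub ((k1 j).mul (k2 i j))) hη.continuous hc
  have j2 := hI (((k2 i j).mul (k1 j)).add ((k1 i).mul (k2 j j))) hη.continuous hc
  have j3 := hI (((pd_continuous (i := i) hW).mul (Real.continuous_exp.comp hu.continuous)).add
    (((hW.continuous).mul (Real.continuous_exp.comp hu.continuous)).mul (k1 i))) hη.continuous hc
  simp only [Pi.mul_apply, Pi.add_apply, Pi.sub_apply, Function.comp_apply] at i1 i2 i3 i4 i5 j1 j2 j3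
  calc _ = ∫ y, ((pd i (pd i u) y + pd j (pd j u) y) * pd i η y
        - 2 * (pd j (pd j u) y * pd i η y) + 2 * (pd i (pd j u) y * pd j η y)
        - (1 / 2 * (pd i u y * pd i u y - pd j u y * pd j u y)) * pd i η y
        - (pd i u y * pd j u y) * pd j η y) := by
        congr 1; funext y; ring
    _ = (∫ y, (pd i (pd i u) y + pd j (pd j u) y) * pd i η y)
        - 2 * (∫ y, pd j (pd j u) y * pd i η y) + 2 * (∫ y, pd i (pd j u) y * pd j η y)
        - (∫ y, (1 / 2 * (pd i u y * pd i u y - pd j u y * pd j u y)) * pd i η y)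
        - ∫ y, (pd i u y * pd j u y) * pd j η y := by
        rw [integral_sub (int_sub (int_add (int_sub i1 (i2.const_mul 2)) (i3.const_mul 2)) i4) i5,
          integral_sub (int_add (int_sub i1 (i2.const_mul 2)) (i3.const_mul 2)) i4,
          integral_add (int_sub i1 (i2.const_mul 2)) (i3.const_mul 2),
          integral_sub i1 (i2.const_mul 2), integral_const_mul, integral_const_mul]
    _ = (∫ y, (pd i W y * Real.exp (u y) + W y * Real.exp (u y) * pd i u y) * η y)
        + (∫ y, (pd i u y * pd i (pd i u) y - pd j u y * pd i (pd j u) y) * η y)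
        + ∫ y, (pd i (pd j u) y * pd j u y + pd i u y * pd j (pd j u) y) * η y := by
        rw [a1, a2, a3, a4]; ring
    _ = ∫ y, ((pd i W y * Real.exp (u y) + W y * Real.exp (u y) * pd i u y) * η y
        + (pd i u y * pd i (pd i u) y - pd j u y * pd i (pd j u) y) * η y
        + (pd i (pd j u) y * pd j u y + pd i u y * pd j (pd j u) y) * η y) := by
        rw [integral_add (int_add j3 j1) j2, integral_add j3 j1]
    _ = _ := by
        congr 1; funext y
        by_cases hy : y ∈ tsupport η
        · have h1 := hPDE y hy
          rw [lap_eq' hij] at h1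
          rw [← h1]; ring
        · rw [image_eq_zero_of_notMem_tsupport hy]; ring

lemma weak0 {u W η : E2 → ℝ} (hu : ContDiff ℝ 2 u)
    (hW : ContDiff ℝ 1 W) (hη : ContDiff ℝ 2 η) (hc : HasCompactSupport η)
    (hPDE : ∀ y ∈ tsupport η, - lap u y = W y * Real.exp (u y)) :
    ∫ y, (af u y * pd 0 η y + bf u y * pd 1 η y) = ∫ y, pd 0 W y * Real.exp (u y) * η y :=
  weak_id (i := 0) (j := 1) (by decide) hu hW hη hc hPDE

lemma weak1 {u W η : E2 → ℝ} (hu : ContDiff ℝ 2 u)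
    (hW : ContDiff ℝ 1 W) (hη : ContDiff ℝ 2 η) (hc : HasCompactSupport η)
    (hPDE : ∀ y ∈ tsupport η, - lap u y = W y * Real.exp (u y)) :
    ∫ y, (- af u y * pd 1 η y + bf u y * pd 0 η y) = ∫ y, pd 1 W y * Real.exp (u y) * η y := by
  rw [← weak_id (i := 1) (j := 0) (by decide) hu hW hη hc hPDE]
  congr 1; funext y
  rw [pd_comm hu 1 0]
  unfold af bf; ring

lemma energy {u f χ : E2 → ℝ} (hu : ContDiff ℝ 2 u) (hf : Continuous f) (hχ : ContDiff ℝ 2 χ)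
    (hc : HasCompactSupport χ) (hPDE : ∀ y ∈ tsupport χ, - lap u y = f y) :
    ∫ y, χ y * (pd 0 u y ^ 2 + pd 1 u y ^ 2) =
      (∫ y, u y ^ 2 / 2 * lap χ y) + ∫ y, χ y * (u y * f y) := by
  have hsq : ContDiff ℝ 2 (fun y => u y ^ 2 / 2) := (hu.pow 2).div_const 2
  have hl : ∀ y, lap (fun y => u y ^ 2 / 2) y = (pd 0 u y ^ 2 + pd 1 u y ^ 2) + u y * lap u y := by
    intro y
    rw [lap_comp (φ := fun t => t ^ 2 / 2) (φ' := fun t => t) (φ'' := fun _ => 1) hu]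
    · ring
    · intro t
      have := ((hasDerivAt_id t).pow 2).div_const 2
      simp at this
      exact this
    · intro t; exact hasDerivAt_id t
  rw [← ibp_lap hsq hχ hc, ← integral_add]
  · congr 1; funext y
    rw [hl]
    by_cases hy : y ∈ tsupport χ
    · rw [← hPDE y hy]; ring
    · rw [image_eq_zero_of_notMem_tsupport hy]; ring
  · exact int_cs ((lap_cont hsq).mul hχ.continuous) hc.mul_left
  · exact int_cs (hχ.continuous.mul (hu.continuous.mul hf)) hc.mul_right


lemma int_neg {f : E2 → ℝ} (hf : Integrable f) : Integrable (fun y => - f y) := hf.neg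

lemma zeta_est {u ζ χ : E2 → ℝ} (hu : ContDiff ℝ 2 u) (hζ : ContDiff ℝ 1 ζ) (hζc : HasCompactSupport ζ)
    (hχ : Continuous χ) (hχc : HasCompactSupport χ) {Z : ℝ} (hZ : 0 ≤ Z)
    (h0 : ∀ y, 0 ≤ χ y) (h1 : ∀ y, |ζ y| ≤ Z * χ y) (h2 : ∀ i y, |pd i ζ y| ≤ Z * χ y) :
    |∫ y, af u y * ζ y| ≤ 3 * Z * ∫ y, χ y * (1 + (pd 0 u y ^ 2 + pd 1 u y ^ 2)) ∧
    |∫ y, bf u y * ζ y| ≤ 3 * Z * ∫ y, χ y * (1 + (pd 0 u y ^ 2 + pd 1 u y ^ 2)) := by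
  have c1 := fun i => pd_contDiff1 (i := i) hu
  have k1 := fun i => (c1 i).continuous
  have k2 := fun i j => pd_pd_continuous (i := i) (j := j) hu
  have hI : ∀ {g h : E2 → ℝ}, Continuous g → Continuous h → HasCompactSupport h →
      Integrable (fun y => g y * h y) := fun hg hh hhc => int_cs (hg.mul hh) hhc.mul_left
  have zc := hζ.continuous
  have zp := fun i => pd_continuous (i := i) hζ
  have zs := fun i => pd_compact i hζc
  have hE : Integrable (fun y => 3 * Z * (χ y * (1 + (pd 0 u y ^ 2 + pd 1 u y ^ 2)))) := by
    apply Integrable.const_mul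
    exact int_cs (hχ.mul (continuous_const.add (((k1 0).pow 2).add ((k1 1).pow 2)))) hχc.mul_right
  have q1 : Continuous fun y => 1 / 2 * (pd 0 u y ^ 2 - pd 1 u y ^ 2) :=
    continuous_const.mul (((k1 0).pow 2).sub ((k1 1).pow 2))
  have q2 : Continuous fun y => pd 0 u y * pd 1 u y := (k1 0).mul (k1 1)
  rw [← integral_const_mul]
  constructor
  · have e : ∫ y, af u y * ζ y = ∫ y, (- (pd 0 u y * pd 0 ζ y) + pd 1 u y * pd 1 ζ y
        - 1 / 2 * (pd 0 u y ^ 2 - pd 1 u y ^ 2) * ζ y) := by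
      have e1 : ∀ y, af u y * ζ y = pd 0 (pd 0 u) y * ζ y - pd 1 (pd 1 u) y * ζ y
          - 1 / 2 * (pd 0 u y ^ 2 - pd 1 u y ^ 2) * ζ y := by
        intro y; unfold af; ring
      simp only [e1]
      rw [integral_sub (int_sub (hI (k2 0 0) zc hζc) (hI (k2 1 1) zc hζc)) (hI q1 zc hζc),
        integral_sub (hI (k2 0 0) zc hζc) (hI (k2 1 1) zc hζc), ibp 0 (c1 0) hζ hζc,
        ibp 1 (c1 1) hζ hζc,
        integral_sub (int_add (int_neg (hI (k1 0) (zp 0) (zs 0))) (hI (k1 1) (zp 1) (zs 1))) (hI q1 zc hζc),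
        integral_add (int_neg (hI (k1 0) (zp 0) (zs 0))) (hI (k1 1) (zp 1) (zs 1)), integral_neg]
      ring
    rw [e]
    rw [← Real.norm_eq_abs]
    apply norm_integral_le_of_norm_le hE
    refine Eventually.of_forall fun y => ?_
    rw [Real.norm_eq_abs]
    have t0 := h2 0 y
    have t1 := h2 1 y
    have t2 := h1 y
    have hχy := h0 y
    have b0 : |pd 0 u y * pd 0 ζ y| ≤ |pd 0 u y| * (Z * χ y) := by rw [abs_mul]; gcongr
    have b1 : |pd 1 u y * pd 1 ζ y| ≤ |pd 1 u y| * (Z * χ y) := by rw [abs_mul]; gcongr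
    have b2 : |1 / 2 * (pd 0 u y ^ 2 - pd 1 u y ^ 2) * ζ y| ≤
        1 / 2 * (pd 0 u y ^ 2 + pd 1 u y ^ 2) * (Z * χ y) := by
      rw [abs_mul]
      apply mul_le_mul _ t2 (abs_nonneg _) (by positivity)
      rw [abs_le]; constructor <;> nlinarith [sq_nonneg (pd 0 u y), sq_nonneg (pd 1 u y)]
    have c0 : |pd 0 u y| ≤ 1 / 2 * (1 + pd 0 u y ^ 2) := by
      nlinarith [sq_abs (pd 0 u y), sq_nonneg (|pd 0 u y| - 1)]
    have c1 : |pd 1 u y| ≤ 1 / 2 * (1 + pd 1 u y ^ 2) := by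
      nlinarith [sq_abs (pd 1 u y), sq_nonneg (|pd 1 u y| - 1)]
    have hZχ : 0 ≤ Z * χ y := mul_nonneg hZ hχy
    have d0 := mul_le_mul_of_nonneg_right c0 hZχ
    have d1 := mul_le_mul_of_nonneg_right c1 hZχ
    have tri : ∀ a b c : ℝ, |-a + b - c| ≤ |a| + |b| + |c| := by
      intro a b c
      refine (abs_sub _ _).trans ?_
      have := abs_add_le (-a) b
      rw [abs_neg] at this
      linarith
    refine (tri _ _ _).trans ?_
    nlinarith [mul_nonneg hZχ (sq_nonneg (pd 0 u y)), mul_nonneg hZχ (sq_nonneg (pd 1 u y))]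
  · have e : ∫ y, bf u y * ζ y = ∫ y, (- (2 * (pd 1 u y * pd 0 ζ y))
        - pd 0 u y * pd 1 u y * ζ y) := by
      have e1 : ∀ y, bf u y * ζ y = 2 * (pd 0 (pd 1 u) y * ζ y)
          - pd 0 u y * pd 1 u y * ζ y := by
        intro y; unfold bf; ring
      simp only [e1]
      rw [integral_sub ((hI (k2 0 1) zc hζc).const_mul 2) (hI q2 zc hζc), integral_const_mul,
        ibp 0 (c1 1) hζ hζc,
        integral_sub (int_neg ((hI (k1 1) (zp 0) (zs 0)).const_mul 2)) (hI q2 zc hζc), integral_neg,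
        integral_const_mul]
      ring
    rw [e]
    rw [← Real.norm_eq_abs]
    apply norm_integral_le_of_norm_le hE
    refine Eventually.of_forall fun y => ?_
    rw [Real.norm_eq_abs]
    have t0 := h2 0 y
    have t2 := h1 y
    have hχy := h0 y
    have b1 : |pd 1 u y * pd 0 ζ y| ≤ |pd 1 u y| * (Z * χ y) := by rw [abs_mul]; gcongr
    have b2 : |pd 0 u y * pd 1 u y * ζ y| ≤
        1 / 2 * (pd 0 u y ^ 2 + pd 1 u y ^ 2) * (Z * χ y) := by
      rw [abs_mul]
      apply mul_le_mul _ t2 (abs_nonneg _) (by positivity)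
      rw [abs_le]; constructor <;>
        nlinarith [sq_nonneg (pd 0 u y - pd 1 u y), sq_nonneg (pd 0 u y + pd 1 u y)]
    have c1 : |pd 1 u y| ≤ 1 / 2 * (1 + pd 1 u y ^ 2) := by
      nlinarith [sq_abs (pd 1 u y), sq_nonneg (|pd 1 u y| - 1)]
    have hZχ : 0 ≤ Z * χ y := mul_nonneg hZ hχy
    have d1 := mul_le_mul_of_nonneg_right c1 hZχ
    have tri : ∀ a c : ℝ, |-(2 * a) - c| ≤ 2 * |a| + |c| := by
      intro a c
      refine (abs_sub _ _).trans ?_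
      rw [abs_neg, abs_mul]; norm_num
    refine (tri _ _).trans ?_
    nlinarith [mul_nonneg hZχ (sq_nonneg (pd 0 u y)), mul_nonneg hZχ (sq_nonneg (pd 1 u y))]

lemma pd_Kf_le (i j : Fin 2) (x : E2) {ε r : ℝ} (hε : 0 < ε) (hr : 0 < r) {y : E2} (h : r ≤ ‖y - x‖) :
    |pd j (Kf i x ε) y| ≤ 3 * (r⁻¹) ^ 2 := by
  have hq := qf_pos (x := x) hε y
  rw [pd_Kf i j x hε]
  have h1 : (qf x ε y)⁻¹ ≤ (r⁻¹) ^ 2 := by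
    rw [inv_pow]
    apply inv_anti₀ (by positivity)
    unfold qf; nlinarith [sq_nonneg ε]
  have h2 : |(y i - x i) * (y j - x j)| * (qf x ε y)⁻¹ ≤ 1 := by
    rw [← div_eq_mul_inv, div_le_one hq]
    have e : qf x ε y = (y 0 - x 0) ^ 2 + (y 1 - x 1) ^ 2 + ε ^ 2 := by
      unfold qf; rw [nsq]; simp
    have e2 : ∀ k : Fin 2, (y k - x k) ^ 2 ≤ qf x ε y := by
      intro k
      rw [e]
      fin_cases k <;> simp <;> nlinarith [sq_nonneg (y 0 - x 0), sq_nonneg (y 1 - x 1), sq_nonneg ε]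
    rw [abs_le]
    constructor <;> nlinarith [e2 i, e2 j, sq_nonneg ((y i - x i) - (y j - x j)),
      sq_nonneg ((y i - x i) + (y j - x j))]
  have hq' : 0 < (qf x ε y)⁻¹ := by positivity
  have h3 : |(if j = i then (1 : ℝ) else 0) * (qf x ε y)⁻¹| ≤ (qf x ε y)⁻¹ := by
    rw [abs_mul, abs_of_pos hq']
    split_ifs <;> simp; positivity
  have h4 : |2 * (y i - x i) * (y j - x j) * ((qf x ε y)⁻¹) ^ 2| ≤ 2 * (qf x ε y)⁻¹ := by
    have : |2 * (y i - x i) * (y j - x j) * ((qf x ε y)⁻¹) ^ 2| =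
        2 * (|(y i - x i) * (y j - x j)| * (qf x ε y)⁻¹) * (qf x ε y)⁻¹ := by
      rw [show 2 * (y i - x i) * (y j - x j) * ((qf x ε y)⁻¹) ^ 2 =
        (2 * ((qf x ε y)⁻¹) ^ 2) * ((y i - x i) * (y j - x j)) by ring, abs_mul,
        abs_of_pos (by positivity)]
      ring
    rw [this]
    nlinarith
  refine (abs_sub _ _).trans ?_
  linarith

set_option maxHeartbeats 1600000 in
lemma hopf_bound {R Λ M : ℝ} (hR : 0 < R) (hΛ : 0 < Λ) (hM : 0 < M) : ∃ C > (0 : ℝ),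
    ∀ (u W : E2 → ℝ), ContDiff ℝ 2 u → ContDiff ℝ 1 W →
    (∀ y ∈ ball (0 : E2) R, - lap u y = W y * Real.exp (u y)) →
    (∀ y ∈ ball (0 : E2) R, 0 < W y) → (∀ y ∈ ball (0 : E2) R, ∀ i, |pd i W y| ≤ Λ * W y) →
    (∫ y in ball (0 : E2) R, W y * Real.exp (u y)) ≤ M → ∀ B : ℝ, 1 ≤ B →
    (∀ y : E2, R / 4 < ‖y‖ → ‖y‖ < R → |u y| ≤ B) →
    ∀ x ∈ ball (0 : E2) (R / 4), ∀ H ρ : ℝ, 0 ≤ H → 0 < ρ →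
    (∀ y ∈ ball (0 : E2) R, y ∈ ball x ρ → W y * Real.exp (u y) ≤ H) →
    |af u x| ≤ C * (B ^ 2 + H * ρ + 1 / ρ) ∧ |bf u x| ≤ C * (B ^ 2 + H * ρ + 1 / ρ) := by
  obtain ⟨χ, hχ, hχ1, hχs, hχc, hχ0, hχ1'⟩ := cutoff (Ω := ball (0 : E2) (3 * R / 4))
    (K := closedBall 0 (R / 2)) isOpen_ball (isCompact_closedBall _ _)
    (closedBall_subset_ball (by linarith))
  obtain ⟨ψ, hψ, hψ1, hψs, hψc, hψ0, hψ1'⟩ := cutoff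
    (Ω := ball (0 : E2) R \ closedBall 0 (R / 4))
    (K := closedBall (0 : E2) (3 * R / 4) \ ball 0 (R / 2))
    (isOpen_ball.sdiff isClosed_closedBall) ((isCompact_closedBall _ _).diff isOpen_ball)
    (by
      rintro y ⟨hy1, hy2⟩
      rw [mem_closedBall, dist_zero_right] at hy1
      rw [mem_ball, dist_zero_right, not_lt] at hy2
      refine ⟨by rw [mem_ball, dist_zero_right]; linarith, ?_⟩
      rw [mem_closedBall, dist_zero_right, not_le]; linarith)
  obtain ⟨A, hA, hb⟩ := pd_bdd hχ hχc
  obtain ⟨A', hA', hb'⟩ := pd_bdd hψ hψc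
  have hpi := Real.pi_pos
  set vol : ℝ := (volume : Measure E2).real (ball 0 R) with hvol
  have hvol0 : 0 ≤ vol := measureReal_nonneg
  set Z : ℝ := A * (4 / R) + A * (48 / R ^ 2) with hZ
  have hZ0 : 0 < Z := by positivity
  set CE : ℝ := vol + A' * vol + M with hCE
  refine ⟨12 * Z * CE + 4 * π * Λ + 2 * Λ * M, by positivity, ?_⟩
  intro u W hu hW hPDE hWp hWd hmass B hB huB x hx H ρ hH hρ hfH
  have huc := hu.continuous
  set f : E2 → ℝ := fun y => W y * Real.exp (u y) with hf
  have hfc : Continuous f := hW.continuous.mul (Real.continuous_exp.comp huc)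
  have hfp : ∀ y ∈ ball (0 : E2) R, 0 < f y := fun y hy => mul_pos (hWp y hy) (Real.exp_pos _)
  have hloc : ∀ {F : E2 → ℝ}, Continuous F → ∀ (p : E2) (r : ℝ), IntegrableOn F (ball p r) := by
    intro F hF p r
    exact (hF.continuousOn.integrableOn_compact (isCompact_closedBall p r)).mono_set
      ball_subset_closedBall
  have hind : ∀ {F : E2 → ℝ}, Continuous F → ∀ (p : E2) (r : ℝ),
      Integrable ((ball p r).indicator F) := by
    intro F hF p r
    rw [integrable_indicator_iff measurableSet_ball]; exact hloc hF p r
  have hxn : ‖x‖ < R / 4 := by rw [mem_ball, dist_zero_right] at hx; exact hx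
  have c1 := fun i => pd_contDiff1 (i := i) hu
  have k1 := fun i => (c1 i).continuous
  have hψR : ∀ y ∉ ball (0 : E2) R, y ∉ tsupport ψ := fun y hy h => hy (hψs h).1
  have hχR : ∀ y ∈ tsupport χ, y ∈ ball (0 : E2) R := fun y hy =>
    ball_subset_ball (by linarith) (hχs hy)
  -- the energy
  set E : ℝ := ∫ y, ψ y * (1 + (pd 0 u y ^ 2 + pd 1 u y ^ 2)) with hE
  have hEle : E ≤ CE * B ^ 2 := by
    have g1 : Integrable (fun y => ψ y * (pd 0 u y ^ 2 + pd 1 u y ^ 2)) :=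
      int_cs (hψ.continuous.mul (((k1 0).pow 2).add ((k1 1).pow 2))) hψc.mul_right
    have g2 : Integrable ψ := int_cs hψ.continuous hψc
    have e1 : E = (∫ y, ψ y) + ∫ y, ψ y * (pd 0 u y ^ 2 + pd 1 u y ^ 2) := by
      rw [hE, ← integral_add g2 g1]; congr 1; funext y; ring
    rw [e1, energy hu hfc hψ hψc (fun y hy => hPDE y (hψs hy).1)]
    have t1 : ∫ y, ψ y ≤ vol := by
      have : ∫ y, ψ y ≤ ∫ y, (ball (0 : E2) R).indicator (fun _ => (1 : ℝ)) y := by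
        apply integral_mono g2 (hind continuous_const _ _)
        intro y
        by_cases hy : y ∈ ball (0 : E2) R
        · rw [Set.indicator_of_mem hy]; exact hψ1' y
        · rw [Set.indicator_of_notMem hy, image_eq_zero_of_notMem_tsupport (hψR y hy)]
      refine this.trans (le_of_eq ?_)
      rw [integral_indicator measurableSet_ball]
      simp [hvol]
    have t2 : ∫ y, u y ^ 2 / 2 * lap ψ y ≤ A' * B ^ 2 * vol := by
      have : ∫ y, u y ^ 2 / 2 * lap ψ y ≤ ∫ y, (ball (0 : E2) R).indicator (fun _ => A' * B ^ 2) y := by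
        apply integral_mono _ (hind continuous_const _ _)
        · intro y
          beta_reduce
          by_cases hy : y ∈ tsupport ψ
          · obtain ⟨hy1, hy2⟩ := hψs hy
            rw [Set.indicator_of_mem hy1]
            rw [mem_ball, dist_zero_right] at hy1
            rw [mem_closedBall, dist_zero_right, not_le] at hy2
            have h1 := huB y hy2 hy1
            have h2 := (hb' y).2.2.2
            have h3 : u y ^ 2 ≤ B ^ 2 := sq_le_sq' (by linarith [(abs_le.1 h1).1]) (abs_le.1 h1).2
            have h4 : u y ^ 2 / 2 * lap ψ y ≤ u y ^ 2 / 2 * A' := by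
              gcongr; exact (le_abs_self _).trans h2
            nlinarith [mul_le_mul_of_nonneg_left h3 hA'.le, sq_nonneg (u y), mul_nonneg hA'.le (sq_nonneg (u y))]
          · rw [lap_zero_of_notMem hy]
            simp only [mul_zero]
            exact Set.indicator_nonneg (fun _ _ => by positivity) y
        · exact int_cs (((huc.pow 2).div_const 2).mul (lap_cont hψ)) (lap_compact hψc).mul_left
      refine this.trans (le_of_eq ?_)
      rw [integral_indicator measurableSet_ball]
      simp [hvol]; ring
    have t3 : ∫ y, ψ y * (u y * f y) ≤ B * M := by
      have hBf : Continuous fun y => B * f y := continuous_const.mul hfc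
      have : ∫ y, ψ y * (u y * f y) ≤ ∫ y, (ball (0 : E2) R).indicator (fun y => B * f y) y := by
        apply integral_mono _ (hind hBf _ _)
        · intro y
          beta_reduce
          by_cases hy : y ∈ tsupport ψ
          · obtain ⟨hy1, hy2⟩ := hψs hy
            rw [Set.indicator_of_mem hy1]
            have hfy := hfp y hy1
            rw [mem_ball, dist_zero_right] at hy1
            rw [mem_closedBall, dist_zero_right, not_le] at hy2
            have h1 := huB y hy2 hy1
            have h2 : u y * f y ≤ B * f y := by
              gcongr; exact (le_abs_self _).trans h1
            have h3 : ψ y * (u y * f y) ≤ ψ y * (B * f y) := mul_le_mul_of_nonneg_left h2 (hψ0 y)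
            have h4 : ψ y * (B * f y) ≤ 1 * (B * f y) :=
              mul_le_mul_of_nonneg_right (hψ1' y) (by positivity)
            linarith
          · rw [image_eq_zero_of_notMem_tsupport hy]
            simp only [zero_mul]
            exact Set.indicator_nonneg (fun y hy => by have := hfp y hy; positivity) y
        · exact int_cs (hψ.continuous.mul (huc.mul hfc)) hψc.mul_right
      refine this.trans ?_
      rw [integral_indicator measurableSet_ball, integral_const_mul]
      gcongr
    have hB2 : B ≤ B ^ 2 := by nlinarith
    have hB3 : 1 ≤ B ^ 2 := by nlinarith
    rw [hCE]
    nlinarith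
  -- the source
  set Q : ℝ := Λ * (2 * π * H * ρ + M / ρ) with hQ
  have hsource : ∀ ε : ℝ, 0 < ε → ∀ i l : Fin 2,
      |∫ y, pd i W y * Real.exp (u y) * (χ y * Kf l x ε y)| ≤ Q := by
    intro ε hε i l
    have hk := kabs_cont x hε
    have hk1 : Continuous fun y => Λ * H * kabs x ε y := continuous_const.mul hk
    have hk2 : Continuous fun y => Λ / ρ * f y := continuous_const.mul hfc
    have hJ := int_add (hind hk1 x ρ) (hind hk2 0 R)
    have : |∫ y, pd i W y * Real.exp (u y) * (χ y * Kf l x ε y)| ≤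
        ∫ y, ((ball x ρ).indicator (fun y => Λ * H * kabs x ε y) y
          + (ball (0 : E2) R).indicator (fun y => Λ / ρ * f y) y) := by
      rw [← Real.norm_eq_abs]
      apply norm_integral_le_of_norm_le hJ
      refine Eventually.of_forall fun y => ?_
      rw [Real.norm_eq_abs]
      have n1 : 0 ≤ (ball x ρ).indicator (fun y => Λ * H * kabs x ε y) y :=
        Set.indicator_nonneg (fun y _ => by have := kabs_nonneg x ε y; positivity) y
      have n2 : 0 ≤ (ball (0 : E2) R).indicator (fun y => Λ / ρ * f y) y :=
        Set.indicator_nonneg (fun y hy => by have := hfp y hy; positivity) y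
      by_cases hy : y ∈ tsupport χ
      · have hyR := hχR y hy
        have hfy := hfp y hyR
        have hkn := kabs_nonneg x ε y
        have b1 : |pd i W y * Real.exp (u y) * (χ y * Kf l x ε y)| ≤ Λ * f y * kabs x ε y := by
          rw [abs_mul, abs_mul, abs_mul, abs_of_pos (Real.exp_pos _), abs_of_nonneg (hχ0 y)]
          have h1 : |pd i W y| * Real.exp (u y) ≤ Λ * W y * Real.exp (u y) :=
            mul_le_mul_of_nonneg_right (hWd y hyR i) (Real.exp_pos _).le
          have h2 : χ y * |Kf l x ε y| ≤ 1 * kabs x ε y :=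
            mul_le_mul (hχ1' y) (Kf_le l x hε y) (abs_nonneg _) zero_le_one
          have h3 := mul_le_mul h1 h2 (mul_nonneg (hχ0 y) (abs_nonneg _))
            (by have := hWp y hyR; positivity)
          refine h3.trans (le_of_eq ?_)
          rw [hf]; ring
        refine b1.trans ?_
        rw [Set.indicator_of_mem hyR] at n2 ⊢
        by_cases hyb : y ∈ ball x ρ
        · rw [Set.indicator_of_mem hyb] at n1 ⊢
          have h1 := hfH y hyR hyb
          have h2 : Λ * f y * kabs x ε y ≤ Λ * H * kabs x ε y := by gcongr
          linarith
        · rw [Set.indicator_of_notMem hyb, zero_add]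
          rw [mem_ball, dist_eq_norm, not_lt] at hyb
          have h1 := kabs_le x ε hρ hyb
          have h2 : Λ * f y * kabs x ε y ≤ Λ * f y * ρ⁻¹ := by gcongr
          refine h2.trans (le_of_eq ?_)
          ring
      · rw [image_eq_zero_of_notMem_tsupport hy]
        simp only [zero_mul, mul_zero, abs_zero]
        linarith
    refine this.trans ?_
    rw [integral_add (hind hk1 x ρ) (hind hk2 0 R),
      integral_indicator measurableSet_ball, integral_indicator measurableSet_ball,
      integral_const_mul, integral_const_mul]
    have h1 := kabs_int x hε hρ
    have h2 : Λ * H * (∫ y in ball x ρ, kabs x ε y) ≤ Λ * H * (2 * π * ρ) := by gcongr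
    have h3 : Λ / ρ * (∫ y in ball (0 : E2) R, f y) ≤ Λ / ρ * M := by gcongr
    refine (add_le_add h2 h3).trans (le_of_eq ?_)
    rw [hQ]; ring
  -- the boundary terms
  have hbdry : ∀ ε : ℝ, 0 < ε → ∀ i l : Fin 2,
      |∫ y, af u y * (pd i χ y * Kf l x ε y)| ≤ 3 * Z * E ∧
      |∫ y, bf u y * (pd i χ y * Kf l x ε y)| ≤ 3 * Z * E := by
    intro ε hε i l
    have hKC := C1_of_C2 (Kf_contDiff l x hε)
    have hχi := pd_contDiff1 (i := i) hχ
    have hcase : ∀ y, (pd i χ y = 0 ∧ ∀ m, pd m (pd i χ) y = 0) ∨ (ψ y = 1 ∧ R / 4 ≤ ‖y - x‖) := by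
      intro y
      by_cases hy : y ∈ tsupport χ
      · by_cases hy2 : y ∈ closedBall (0 : E2) (R / 2)
        · left
          have hev : χ =ᶠ[𝓝 y] fun _ => (1 : ℝ) := (eventually_nhdsSet_iff_forall.1 hχ1) y hy2
          refine ⟨pd_zero_of_const i hev, fun m => ?_⟩
          rw [pd_congr m (pd_congr' i hev)]
          have : pd i (fun _ : E2 => (1 : ℝ)) = fun _ => 0 := by funext z; simp [pd]
          rw [this]; simp [pd]
        · right
          have h1 := hχs hy
          rw [mem_ball, dist_zero_right] at h1
          rw [mem_closedBall, dist_zero_right, not_le] at hy2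
          refine ⟨hψ1.self_of_nhdsSet y ⟨?_, ?_⟩, ?_⟩
          · rw [mem_closedBall, dist_zero_right]; exact h1.le
          · rw [mem_ball, dist_zero_right, not_lt]; exact hy2.le
          · have := norm_sub_norm_le y x
            linarith
      · left
        exact ⟨pd_eq_zero i hy, fun m => pd_eq_zero m (fun h => hy (pd_tsupport i h))⟩
    apply zeta_est hu (hχi.mul hKC) ((pd_compact i hχc).mul_right) hψ.continuous hψc hZ0.le hψ0
    · intro y
      rcases hcase y with ⟨h1, -⟩ | ⟨h1, h2⟩
      · simp only [h1, zero_mul, abs_zero]; exact mul_nonneg hZ0.le (hψ0 y)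
      · rw [h1, mul_one, abs_mul]
        have h3 := (Kf_le l x hε y).trans (kabs_le x ε (by positivity) h2)
        have h4 := mul_le_mul ((hb y).2.1 i) h3 (abs_nonneg _) hA.le
        refine h4.trans ?_
        rw [hZ, inv_div]
        have : 0 ≤ A * (48 / R ^ 2) := by positivity
        linarith
    · intro m y
      rw [pd_mul m (diff_of_C1 hχi y) (diff_of_C1 hKC y)]
      rcases hcase y with ⟨h1, h1'⟩ | ⟨h1, h2⟩
      · simp only [h1, h1', zero_mul, abs_zero, add_zero]; exact mul_nonneg hZ0.le (hψ0 y)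
      · rw [h1, mul_one]
        refine (abs_add_le _ _).trans ?_
        rw [abs_mul, abs_mul]
        have h3 := (Kf_le l x hε y).trans (kabs_le x ε (by positivity) h2)
        have h4 := mul_le_mul ((hb y).2.2.1 m i) h3 (abs_nonneg _) hA.le
        have h5 := mul_le_mul ((hb y).2.1 i) (pd_Kf_le l m x hε (by positivity) h2) (abs_nonneg _) hA.le
        refine (add_le_add h4 h5).trans (le_of_eq ?_)
        rw [hZ, inv_div]; ring
  have haC := af_cont hu
  have hbC := bf_cont hu
  have hI : ∀ {g h : E2 → ℝ}, Continuous g → Continuous h → HasCompactSupport h →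
      Integrable (fun y => g y * h y) := fun hg hh hhc => int_cs (hg.mul hh) hhc.mul_left
  have key : ∀ ε : ℝ, 0 < ε → |∫ y, (af u y * χ y) * Pf x ε y| ≤ 12 * Z * E + 2 * Q ∧
      |∫ y, (bf u y * χ y) * Pf x ε y| ≤ 12 * Z * E + 2 * Q := by
    intro ε hε
    have hK := fun l => Kf_contDiff l x hε
    have hη := fun l => hχ.mul (hK l)
    have hηc : ∀ l, HasCompactSupport (fun y => χ y * Kf l x ε y) := fun l => hχc.mul_right
    have hPl : ∀ l, ∀ y ∈ tsupport (fun y => χ y * Kf l x ε y), - lap u y = W y * Real.exp (u y) := by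
      intro l y hy
      exact hPDE y (hχR y (tsupport_mul_subset_left hy))
    have hpm : ∀ i l y, pd i (fun y => χ y * Kf l x ε y) y = pd i χ y * Kf l x ε y + χ y * pd i (Kf l x ε) y :=
      fun i l y => pd_mul i (diff_of_C1 (C1_of_C2 hχ) y) (diff_of_C1 (C1_of_C2 (hK l)) y)
    have w0 := fun l => weak0 hu hW (hη l) (hηc l) (hPl l)
    have w1 := fun l => weak1 hu hW (hη l) (hηc l) (hPl l)
    have gz : ∀ (i l : Fin 2), Continuous (fun y => pd i χ y * Kf l x ε y) := fun i l =>
      (pd_continuous (C1_of_C2 hχ)).mul (hK l).continuous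
    have gzc : ∀ (i l : Fin 2), HasCompactSupport (fun y => pd i χ y * Kf l x ε y) := fun i l =>
      (pd_compact i hχc).mul_right
    have ia := fun i l => hI haC (gz i l) (gzc i l)
    have ib := fun i l => hI hbC (gz i l) (gzc i l)
    have hpη := fun i l => pd_continuous (i := i) (C1_of_C2 (hη l))
    have hpηc := fun i l => pd_compact i (hηc l)
    have i0 : ∀ l, Integrable (fun y => af u y * pd 0 (fun y => χ y * Kf l x ε y) y
        + bf u y * pd 1 (fun y => χ y * Kf l x ε y) y) := fun l =>
      int_add (hI haC (hpη 0 l) (hpηc 0 l)) (hI hbC (hpη 1 l) (hpηc 1 l))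
    have i1 : ∀ l, Integrable (fun y => - af u y * pd 1 (fun y => χ y * Kf l x ε y) y
        + bf u y * pd 0 (fun y => χ y * Kf l x ε y) y) := fun l =>
      int_add (hI haC.neg (hpη 1 l) (hpηc 1 l)) (hI hbC (hpη 0 l) (hpηc 0 l))
    constructor
    · have e : ∫ y, (af u y * χ y) * Pf x ε y =
          (∫ y, pd 0 W y * Real.exp (u y) * (χ y * Kf 0 x ε y))
          - (∫ y, pd 1 W y * Real.exp (u y) * (χ y * Kf 1 x ε y))
          - (∫ y, af u y * (pd 0 χ y * Kf 0 x ε y)) - (∫ y, af u y * (pd 1 χ y * Kf 1 x ε y))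
          - (∫ y, bf u y * (pd 1 χ y * Kf 0 x ε y)) + ∫ y, bf u y * (pd 0 χ y * Kf 1 x ε y) := by
        rw [← w0 0, ← w1 1, ← integral_sub (i0 0) (i1 1), ← integral_sub (int_sub (i0 0) (i1 1)) (ia 0 0),
          ← integral_sub (int_sub (int_sub (i0 0) (i1 1)) (ia 0 0)) (ia 1 1),
          ← integral_sub (int_sub (int_sub (int_sub (i0 0) (i1 1)) (ia 0 0)) (ia 1 1)) (ib 1 0),
          ← integral_add (int_sub (int_sub (int_sub (int_sub (i0 0) (i1 1)) (ia 0 0)) (ia 1 1)) (ib 1 0)) (ib 0 1)]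
        congr 1
        funext y
        rw [hpm, hpm, hpm, hpm, ← Pf_eq x hε, pd_Kf_comm x hε]
        ring
      rw [e]
      have s0 := abs_le.1 (hsource ε hε 0 0)
      have s1 := abs_le.1 (hsource ε hε 1 1)
      have t0 := abs_le.1 (hbdry ε hε 0 0).1
      have t1 := abs_le.1 (hbdry ε hε 1 1).1
      have t2 := abs_le.1 (hbdry ε hε 1 0).2
      have t3 := abs_le.1 (hbdry ε hε 0 1).2
      rw [abs_le]
      constructor <;> linarith [s0.1, s0.2, s1.1, s1.2, t0.1, t0.2, t1.1, t1.2, t2.1, t2.2, t3.1, t3.2]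
    · have e : ∫ y, (bf u y * χ y) * Pf x ε y =
          (∫ y, pd 0 W y * Real.exp (u y) * (χ y * Kf 1 x ε y))
          + (∫ y, pd 1 W y * Real.exp (u y) * (χ y * Kf 0 x ε y))
          - (∫ y, bf u y * (pd 0 χ y * Kf 0 x ε y)) - (∫ y, bf u y * (pd 1 χ y * Kf 1 x ε y))
          - (∫ y, af u y * (pd 0 χ y * Kf 1 x ε y)) + ∫ y, af u y * (pd 1 χ y * Kf 0 x ε y) := by
        rw [← w0 1, ← w1 0, ← integral_add (i0 1) (i1 0), ← integral_sub (int_add (i0 1) (i1 0)) (ib 0 0),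
          ← integral_sub (int_sub (int_add (i0 1) (i1 0)) (ib 0 0)) (ib 1 1),
          ← integral_sub (int_sub (int_sub (int_add (i0 1) (i1 0)) (ib 0 0)) (ib 1 1)) (ia 0 1),
          ← integral_add (int_sub (int_sub (int_sub (int_add (i0 1) (i1 0)) (ib 0 0)) (ib 1 1)) (ia 0 1)) (ia 1 0)]
        congr 1
        funext y
        rw [hpm, hpm, hpm, hpm, ← Pf_eq x hε, pd_Kf_comm x hε]
        ring
      rw [e]
      have s0 := abs_le.1 (hsource ε hε 0 1)
      have s1 := abs_le.1 (hsource ε hε 1 0)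
      have t0 := abs_le.1 (hbdry ε hε 0 0).2
      have t1 := abs_le.1 (hbdry ε hε 1 1).2
      have t2 := abs_le.1 (hbdry ε hε 0 1).1
      have t3 := abs_le.1 (hbdry ε hε 1 0).1
      rw [abs_le]
      constructor <;> linarith [s0.1, s0.2, s1.1, s1.2, t0.1, t0.2, t1.1, t1.2, t2.1, t2.2, t3.1, t3.2]
  have hχx : χ x = 1 := hχ1.self_of_nhdsSet x (by
    rw [mem_closedBall, dist_zero_right]; linarith)
  have hfin : 12 * Z * E + 2 * Q ≤ (12 * Z * CE + 4 * π * Λ + 2 * Λ * M) * (B ^ 2 + H * ρ + 1 / ρ) := by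
    have h1 : 12 * Z * E ≤ 12 * Z * (CE * B ^ 2) := by gcongr
    have p1 : 0 ≤ 12 * Z * CE := by positivity
    have p2 : 0 ≤ H * ρ := by positivity
    have p3 : 0 ≤ 1 / ρ := by positivity
    have p4 : 0 ≤ B ^ 2 := by positivity
    have e : Q = 2 * π * Λ * (H * ρ) + Λ * M * (1 / ρ) := by rw [hQ]; ring
    rw [e]
    have p5 : 0 ≤ 4 * π * Λ := by positivity
    have p6 : 0 ≤ 2 * Λ * M := by positivity
    nlinarith [mul_nonneg p1 p2, mul_nonneg p1 p3, mul_nonneg p5 p4, mul_nonneg p5 p3,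
      mul_nonneg p6 p4, mul_nonneg p6 p2]
  have hgen : ∀ g : E2 → ℝ, Continuous g →
      (∀ ε : ℝ, 0 < ε → |∫ y, (g y * χ y) * Pf x ε y| ≤ 12 * Z * E + 2 * Q) →
      |g x| ≤ (12 * Z * CE + 4 * π * Λ + 2 * Λ * M) * (B ^ 2 + H * ρ + 1 / ρ) := by
    intro g hg hk
    have hlim := (approx_id (hg.mul hχ.continuous) (hχc.mul_left) x).abs
    have hle : |2 * π * (g x * χ x)| ≤ 12 * Z * E + 2 * Q := by
      apply le_of_tendsto hlim
      filter_upwards [eventually_gt_atTop 0] with c hc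
      exact hk c⁻¹ (by positivity)
    rw [hχx, mul_one, abs_mul, abs_of_pos (by positivity)] at hle
    have h3 : 1 * |g x| ≤ 2 * π * |g x| :=
      mul_le_mul_of_nonneg_right (by linarith [Real.pi_gt_three]) (abs_nonneg _)
    rw [one_mul] at h3
    exact h3.trans (hle.trans hfin)
  exact ⟨hgen _ haC (fun ε hε => (key ε hε).1), hgen _ hbC (fun ε hε => (key ε hε).2)⟩


lemma mvt {f f' : ℝ → ℝ} {C r : ℝ} (hr : 0 ≤ r) (hf : ∀ t ∈ Set.Icc 0 r, HasDerivAt f (f' t) t)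
    (hC : ∀ t ∈ Set.Icc 0 r, |f' t| ≤ C) : |f r - f 0| ≤ C * r := by
  have := Convex.norm_image_sub_le_of_norm_hasDerivWithin_le (f := f) (f' := f') (C := C)
    (s := Set.Icc 0 r) (x := 0) (y := r) (fun t ht => (hf t ht).hasDerivWithinAt)
    (fun t ht => hC t ht) (convex_Icc 0 r) ⟨le_refl _, hr⟩ ⟨hr, le_refl _⟩
  rw [Real.norm_eq_abs, Real.norm_eq_abs, sub_zero, abs_of_nonneg hr] at this
  exact this

lemma bootstrap {D : ℝ → ℝ} {r1 : ℝ} (hc : ∀ t ∈ Set.Icc 0 r1, ContinuousAt D t)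
    (h : ∀ r ∈ Set.Icc 0 r1, (∀ t ∈ Set.Ico 0 r, D t < 1) → D r < 1) :
    ∀ r ∈ Set.Icc 0 r1, D r < 1 := by
  by_contra hcon
  push Not at hcon
  obtain ⟨r, hr, hDr⟩ := hcon
  set S : Set ℝ := {t | t ∈ Set.Icc 0 r1 ∧ 1 ≤ D t} with hS
  have hne : S.Nonempty := ⟨r, hr, hDr⟩
  have hbb : BddBelow S := ⟨0, fun t ht => ht.1.1⟩
  set t := sInf S with ht
  have ht1 : t ∈ Set.Icc 0 r1 :=
    ⟨le_csInf hne (fun s hs => hs.1.1), (csInf_le hbb ⟨hr, hDr⟩).trans hr.2⟩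
  have h1 : ∀ s ∈ Set.Ico 0 t, D s < 1 := by
    intro s hs
    by_contra hcc
    push Not at hcc
    have : t ≤ s := csInf_le hbb ⟨⟨hs.1, hs.2.le.trans ht1.2⟩, hcc⟩
    exact absurd hs.2 (not_lt.2 this)
  have h2 := h t ht1 h1
  have h3 : ∀ᶠ s in 𝓝 t, D s < 1 := (hc t ht1).eventually (gt_mem_nhds h2)
  obtain ⟨η, hη, h4⟩ := Metric.eventually_nhds_iff.1 h3
  obtain ⟨s, hs, hst⟩ := exists_lt_of_csInf_lt hne (show sInf S < t + η by linarith)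
  have h5 : t ≤ s := csInf_le hbb hs
  have := h4 (y := s) (by rw [Real.dist_eq, abs_lt]; constructor <;> linarith)
  linarith [hs.2]

lemma ode_G {w g0 g1 H H' T0 T1 : ℝ → ℝ} {e0 e1 ε r1 : ℝ} (he : e0 ^ 2 + e1 ^ 2 = 1) (hε : 0 ≤ ε)
    (hr1 : 0 ≤ r1)
    (hw : ∀ r ∈ Set.Icc 0 r1, HasDerivAt w (e0 * g0 r + e1 * g1 r) r)
    (hg0 : ∀ r ∈ Set.Icc 0 r1, HasDerivAt g0 ((H r + g0 r ^ 2 + g1 r ^ 2) / w r / 2 * e0 + T0 r) r)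
    (hg1 : ∀ r ∈ Set.Icc 0 r1, HasDerivAt g1 ((H r + g0 r ^ 2 + g1 r ^ 2) / w r / 2 * e1 + T1 r) r)
    (hH : ∀ r ∈ Set.Icc 0 r1, HasDerivAt H (H' r) r)
    (hH' : ∀ r ∈ Set.Icc 0 r1, |H' r| ≤ ε) (hH0 : ∀ r ∈ Set.Icc 0 r1, 0 ≤ H r)
    (hT0 : ∀ r ∈ Set.Icc 0 r1, |T0 r| ≤ ε * w r / (1 + r))
    (hT1 : ∀ r ∈ Set.Icc 0 r1, |T1 r| ≤ ε * w r / (1 + r))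
    (hw1 : ∀ r ∈ Set.Icc 0 r1, 1 ≤ w r) (w0 : w 0 = 1) (g00 : g0 0 = 0) (g10 : g1 0 = 0)
    (H0 : H 0 = 1 / 2) (hs : ε * (1 + r1) ≤ 1 / 20) :
    ∀ r ∈ Set.Icc 0 r1, |w r - 1 - r ^ 2 / 8| ≤ 5 * (ε * (1 + r1)) * r ^ 2 := by
  set D : ℝ → ℝ := fun r => (H r + g0 r ^ 2 + g1 r ^ 2) / w r with hD
  have hDd : ∀ r ∈ Set.Icc 0 r1, HasDerivAt D ((H' r + 2 * g0 r * T0 r + 2 * g1 r * T1 r) / w r) r := by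
    intro r hr
    have hwr := hw1 r hr
    have hw0 : w r ≠ 0 := by linarith
    have := (((hH r hr).add ((hg0 r hr).pow 2)).add ((hg1 r hr).pow 2)).div (hw r hr) hw0
    refine HasDerivAt.congr_deriv this ?_
    simp only [Pi.add_apply, Pi.pow_apply]
    field_simp
    ring
  have e0b : |e0| ≤ 1 := by rw [abs_le]; constructor <;> nlinarith [sq_nonneg e1]
  have e1b : |e1| ≤ 1 := by rw [abs_le]; constructor <;> nlinarith [sq_nonneg e0]
  have gsq : ∀ r ∈ Set.Icc 0 r1, D r ≤ 1 → g0 r ^ 2 + g1 r ^ 2 ≤ w r := by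
    intro r hr hDr
    have hwr := hw1 r hr
    have : D r * w r = H r + g0 r ^ 2 + g1 r ^ 2 := by
      simp only [hD]; field_simp
    nlinarith [hH0 r hr]
  have wb : ∀ r ∈ Set.Icc 0 r1, (∀ t ∈ Set.Icc 0 r, D t ≤ 1) → w r ≤ (1 + r) ^ 2 := by
    intro r hr hDr
    have := mvt (f := fun t => Real.sqrt (w t)) (f' := fun t => (e0 * g0 t + e1 * g1 t) / (2 * Real.sqrt (w t)))
      (C := 1 / 2) hr.1 ?_ ?_
    · have h1 := hw1 r hr
      have hsq := Real.sq_sqrt (show 0 ≤ w r by linarith)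
      simp only [w0, Real.sqrt_one] at this
      have h2 := (abs_le.1 this).2
      have h3 := Real.sqrt_nonneg (w r)
      nlinarith [hr.1]
    · intro t ht
      have ht' : t ∈ Set.Icc 0 r1 := ⟨ht.1, ht.2.trans hr.2⟩
      exact (hw t ht').sqrt (by linarith [hw1 t ht'])
    · intro t ht
      have ht' : t ∈ Set.Icc 0 r1 := ⟨ht.1, ht.2.trans hr.2⟩
      have h1 := hw1 t ht'
      have hsp : 0 < Real.sqrt (w t) := Real.sqrt_pos.2 (by linarith)
      have hsq := Real.sq_sqrt (show 0 ≤ w t by linarith)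
      rw [abs_div, abs_of_pos (show 0 < 2 * Real.sqrt (w t) by positivity), div_le_iff₀ (by positivity)]
      have h4 : (e0 * g0 t + e1 * g1 t) ^ 2 ≤ (Real.sqrt (w t)) ^ 2 := by
        rw [hsq]
        have := gsq t ht' (hDr t ht)
        nlinarith [sq_nonneg (e0 * g1 t - e1 * g0 t)]
      have := abs_le_of_sq_le_sq h4 hsp.le
      linarith
  have gb : ∀ r ∈ Set.Icc 0 r1, (∀ t ∈ Set.Icc 0 r, D t ≤ 1) → |g0 r| ≤ 1 + r ∧ |g1 r| ≤ 1 + r := by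
    intro r hr hDr
    have h1 := wb r hr hDr
    have h2 := gsq r hr (hDr r ⟨hr.1, le_refl _⟩)
    have h3 := hr.1
    constructor <;> apply abs_le_of_sq_le_sq _ (by linarith) <;>
      nlinarith [sq_nonneg (g0 r), sq_nonneg (g1 r)]
  have Db : ∀ r ∈ Set.Icc 0 r1, (∀ t ∈ Set.Icc 0 r, D t ≤ 1) → |D r - 1 / 2| ≤ 5 * ε * r := by
    intro r hr hDr
    have hD0 : D 0 = 1 / 2 := by simp [hD, w0, g00, g10, H0]
    rw [← hD0]
    apply mvt hr.1 (fun t ht => hDd t ⟨ht.1, ht.2.trans hr.2⟩)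
    intro t ht
    have ht' : t ∈ Set.Icc 0 r1 := ⟨ht.1, ht.2.trans hr.2⟩
    have h1 := hw1 t ht'
    have hwp : 0 < w t := by linarith
    rw [abs_div, abs_of_pos hwp, div_le_iff₀ hwp]
    obtain ⟨b0, b1⟩ := gb t ht' (fun s hs => hDr s ⟨hs.1, hs.2.trans ht.2⟩)
    have htp : 0 < 1 + t := by linarith [ht.1]
    have m0 : |2 * g0 t * T0 t| ≤ 2 * (ε * w t) := by
      rw [abs_mul, abs_mul, abs_two]
      have := mul_le_mul b0 (hT0 t ht') (abs_nonneg _) htp.le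
      rw [mul_div_cancel₀ _ htp.ne'] at this
      linarith
    have m1 : |2 * g1 t * T1 t| ≤ 2 * (ε * w t) := by
      rw [abs_mul, abs_mul, abs_two]
      have := mul_le_mul b1 (hT1 t ht') (abs_nonneg _) htp.le
      rw [mul_div_cancel₀ _ htp.ne'] at this
      linarith
    have m2 := hH' t ht'
    refine (abs_add_three _ _ _).trans ?_
    nlinarith
  have Dlt : ∀ r ∈ Set.Icc 0 r1, D r < 1 := by
    apply bootstrap (fun t ht => (hDd t ht).continuousAt)
    intro r hr hlt
    have hDr : ∀ t ∈ Set.Ico 0 r, D t ≤ 1 := fun t ht => (hlt t ht).le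
    have hle : D r ≤ 1 := by
      rcases hr.1.eq_or_lt with h0 | h0
      · rw [← h0]; simp [hD, w0, g00, g10, H0]; norm_num
      · have hcl : r ∈ closure (Set.Ico 0 r) := by
          rw [closure_Ico h0.ne]; exact ⟨h0.le, le_refl _⟩
        have hcw : ContinuousWithinAt D (Set.Ico 0 r) r := (hDd r hr).continuousAt.continuousWithinAt
        have := mem_closure_iff_nhdsWithin_neBot.1 hcl
        apply le_of_tendsto hcw
        filter_upwards [self_mem_nhdsWithin] with t ht using hDr t ht
    have h1 := Db r hr (fun t ht => by
      rcases ht.2.eq_or_lt with h | h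
      · rw [h]; exact hle
      · exact hDr t ⟨ht.1, h⟩)
    have h2 := (abs_le.1 h1).2
    have h3 : ε * r ≤ ε * (1 + r1) := mul_le_mul_of_nonneg_left (by linarith [hr.2]) hε
    linarith
  have all : ∀ r ∈ Set.Icc 0 r1, ∀ t ∈ Set.Icc 0 r, D t ≤ 1 := fun r hr t ht =>
    (Dlt t ⟨ht.1, ht.2.trans hr.2⟩).le
  set s := ε * (1 + r1) with hsdef
  have hb1 : ∀ r ∈ Set.Icc 0 r1, |e0 * g0 r + e1 * g1 r - r / 4| ≤ 5 * s * r := by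
    intro r hr
    have := mvt (f := fun t => e0 * g0 t + e1 * g1 t - t / 4)
      (f' := fun t => e0 * (D t / 2 * e0 + T0 t) + e1 * (D t / 2 * e1 + T1 t) - 1 / 4)
      (C := 5 * s) hr.1 ?_ ?_
    · simpa [g00, g10] using this
    · intro t ht
      have ht' : t ∈ Set.Icc 0 r1 := ⟨ht.1, ht.2.trans hr.2⟩
      exact (((hg0 t ht').const_mul e0).add ((hg1 t ht').const_mul e1)).sub ((hasDerivAt_id t).div_const 4)
    · intro t ht
      have ht' : t ∈ Set.Icc 0 r1 := ⟨ht.1, ht.2.trans hr.2⟩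
      have htp : 0 < 1 + t := by linarith [ht.1]
      have h1 := Db t ht' (all t ht')
      have h2 := wb t ht' (all t ht')
      have h4 : ε * w t / (1 + t) ≤ s := by
        rw [div_le_iff₀ htp, hsdef]
        have : ε * w t ≤ ε * (1 + t) ^ 2 := mul_le_mul_of_nonneg_left h2 hε
        have h5 : ε * (1 + t) ≤ ε * (1 + r1) := mul_le_mul_of_nonneg_left (by linarith [ht'.2]) hε
        nlinarith
      have h6 : ε * t ≤ s := mul_le_mul_of_nonneg_left (by linarith [ht'.2]) hε
      have n0 : |e0 * T0 t| ≤ s := by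
        rw [abs_mul]
        have := mul_le_mul e0b ((hT0 t ht').trans h4) (abs_nonneg _) zero_le_one
        linarith
      have n1 : |e1 * T1 t| ≤ s := by
        rw [abs_mul]
        have := mul_le_mul e1b ((hT1 t ht').trans h4) (abs_nonneg _) zero_le_one
        linarith
      have e : e0 * (D t / 2 * e0 + T0 t) + e1 * (D t / 2 * e1 + T1 t) - 1 / 4 =
          1 / 2 * (D t - 1 / 2) + e0 * T0 t + e1 * T1 t := by
        linear_combination (D t / 2) * he
      rw [e]
      refine (abs_add_three _ _ _).trans ?_
      rw [abs_mul, abs_of_pos (show (0 : ℝ) < 1 / 2 by norm_num)]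
      linarith [(abs_nonneg (T0 t)).trans ((hT0 t ht').trans h4)]
  intro r hr
  have := mvt (f := fun t => w t - t ^ 2 / 8)
      (f' := fun t => e0 * g0 t + e1 * g1 t - t / 4)
      (C := 5 * s * r) hr.1 ?_ ?_
  · simp only [w0] at this
    rw [show w r - 1 - r ^ 2 / 8 = w r - r ^ 2 / 8 - (1 - 0 ^ 2 / 8) by ring]
    linarith
  · intro t ht
    have ht' : t ∈ Set.Icc 0 r1 := ⟨ht.1, ht.2.trans hr.2⟩
    refine HasDerivAt.congr_deriv ((hw t ht').sub (((hasDerivAt_id t).pow 2).div_const 8)) ?_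
    simp only [id]
    ring
  · intro t ht
    have ht' : t ∈ Set.Icc 0 r1 := ⟨ht.1, ht.2.trans hr.2⟩
    refine (hb1 t ht').trans ?_
    apply mul_le_mul_of_nonneg_left ht.2
    have : 0 ≤ s := mul_nonneg hε (by linarith)
    linarith


lemma ray_deriv {F : E2 → ℝ} (hF : ContDiff ℝ 1 F) (z : E2) (r : ℝ) :
    HasDerivAt (fun t : ℝ => F (t • z)) (z 0 * pd 0 F (r • z) + z 1 * pd 1 F (r • z)) r := by
  have h1 : HasDerivAt (fun t : ℝ => t • z) z r := by
    simpa using (hasDerivAt_id r).smul_const z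
  have h2 := (diff_of_C1 hF (r • z)).hasFDerivAt.comp_hasDerivAt r h1
  refine h2.congr_deriv ?_
  have hz : z = z 0 • eb 0 + z 1 • eb 1 := by
    ext i; fin_cases i <;> simp [eb]
  conv_lhs => rw [hz]
  rw [map_add, map_smul, map_smul, ← hz]
  simp [pd]

lemma core2 {u W : E2 → ℝ} {R Λ δ r1 Γ : ℝ} (hu : ContDiff ℝ 2 u) (hW : ContDiff ℝ 1 W)
    (hΛ : 0 < Λ) (hδ : 0 < δ) (hr1 : 0 ≤ r1) (hrR : δ * r1 < R) (hΓ : 0 ≤ Γ)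
    (hδ1 : δ ^ 2 * (W 0 * Real.exp (u 0)) = 1)
    (hPDE : ∀ y ∈ ball (0 : E2) R, - lap u y = W y * Real.exp (u y))
    (hWp : ∀ y ∈ ball (0 : E2) R, 0 < W y)
    (hWd : ∀ y ∈ ball (0 : E2) R, ∀ i, |pd i W y| ≤ Λ * W y)
    (hWr : ∀ y ∈ ball (0 : E2) R, W y ≤ Λ * W 0)
    (hmax : ∀ y ∈ ball (0 : E2) R, u y ≤ u 0)
    (hab : ∀ x : E2, ‖x‖ ≤ δ * r1 → |af u x| ≤ Γ / (δ + ‖x‖) ∧ |bf u x| ≤ Γ / (δ + ‖x‖))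
    (hs : δ * (Γ + Λ ^ 2) * (1 + r1) ≤ 1 / 20) :
    ∀ x : E2, ‖x‖ ≤ δ * r1 → |Real.exp ((u 0 - u x) / 2) - 1 - (‖x‖ / δ) ^ 2 / 8| ≤
      5 * (δ * (Γ + Λ ^ 2) * (1 + r1)) * (‖x‖ / δ) ^ 2 := by
  have hR : 0 < R := lt_of_le_of_lt (by positivity) hrR
  have h0R : (0 : E2) ∈ ball (0 : E2) R := mem_ball_self hR
  have hW0 := hWp 0 h0R
  intro x hx
  rcases eq_or_ne x 0 with rfl | hx0
  · simp
  have hxn : 0 < ‖x‖ := norm_pos_iff.2 hx0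
  set e : E2 := ‖x‖⁻¹ • x with he
  have hen : ‖e‖ = 1 := by rw [he, norm_smul, norm_inv, norm_norm, inv_mul_cancel₀ hxn.ne']
  have hesq : e 0 ^ 2 + e 1 ^ 2 = 1 := by rw [← nsq, hen]; norm_num
  set z : E2 := δ • e with hz
  have hzi : ∀ i, z i = δ * e i := fun i => by simp [hz]
  have hzr : ∀ r : ℝ, 0 ≤ r → ‖r • z‖ = δ * r := by
    intro r hr
    rw [hz, norm_smul, norm_smul, hen, Real.norm_eq_abs, Real.norm_eq_abs, abs_of_nonneg hr, abs_of_pos hδ]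
    ring
  have hzb : ∀ r ∈ Set.Icc 0 r1, r • z ∈ ball (0 : E2) R := by
    intro r hr
    rw [mem_ball, dist_zero_right, hzr r hr.1]
    exact lt_of_le_of_lt (mul_le_mul_of_nonneg_left hr.2 hδ.le) hrR
  have c1 := fun i => pd_contDiff1 (i := i) hu
  have hu1 := C1_of_C2 hu
  set w : ℝ → ℝ := fun r => Real.exp ((u 0 - u (r • z)) / 2) with hw
  have hwp : ∀ r, 0 < w r := fun r => Real.exp_pos _
  have hwd : ∀ r, HasDerivAt w (-(1 / 2) * (z 0 * pd 0 u (r • z) + z 1 * pd 1 u (r • z)) * w r) r := by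
    intro r
    refine HasDerivAt.congr_deriv ((((ray_deriv hu1 z r).const_sub (u 0)).div_const 2).exp) ?_
    simp only [hw]; ring
  have hp0 : ∀ i, pd i u 0 = 0 := by
    intro i
    have : IsLocalMax u 0 := by
      filter_upwards [isOpen_ball.mem_nhds h0R] with y hy using hmax y hy
    unfold pd
    rw [this.fderiv_eq_zero]; simp
  set g : Fin 2 → ℝ → ℝ := fun i r => -(1 / 2) * δ * pd i u (r • z) * w r with hg
  set H : ℝ → ℝ := fun r => 1 / 2 * W (r • z) / W 0 with hH
  have hwsq : ∀ r, δ ^ 2 * (W (r • z) * Real.exp (u (r • z))) * w r ^ 2 = 2 * H r := by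
    intro r
    have h1 : Real.exp (u (r • z)) * w r ^ 2 = Real.exp (u 0) := by
      simp only [hw]; rw [← Real.exp_nat_mul, ← Real.exp_add]; congr 1; push_cast; ring
    have h2 : 2 * H r = W (r • z) / W 0 := by simp only [hH]; ring
    rw [h2, eq_div_iff hW0.ne']
    linear_combination (δ ^ 2 * W (r • z) * W 0) * h1 + W (r • z) * hδ1
  have hgd : ∀ i r, HasDerivAt (g i) (-(1 / 2) * δ * (z 0 * pd 0 (pd i u) (r • z) + z 1 * pd 1 (pd i u) (r • z)) * w r
      + -(1 / 2) * δ * pd i u (r • z) * (-(1 / 2) * (z 0 * pd 0 u (r • z) + z 1 * pd 1 u (r • z)) * w r)) r := by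
    intro i r
    exact ((ray_deriv (c1 i) z r).const_mul (-(1 / 2) * δ)).mul (hwd r)
  have hdiv : ∀ r, (H r + g 0 r ^ 2 + g 1 r ^ 2) / w r / 2 =
      1 / 4 * δ ^ 2 * w r * (W (r • z) * Real.exp (u (r • z))) +
      1 / 8 * δ ^ 2 * w r * (pd 0 u (r • z) ^ 2 + pd 1 u (r • z) ^ 2) := by
    intro r
    have h1 := (hwp r).ne'
    have h2 : H r = 1 / 2 * (δ ^ 2 * (W (r • z) * Real.exp (u (r • z))) * w r ^ 2) := by
      rw [hwsq]; ring
    rw [h2]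
    simp only [hg]
    field_simp
    ring
  have hlapr : ∀ r ∈ Set.Icc 0 r1, pd 0 (pd 0 u) (r • z) + pd 1 (pd 1 u) (r • z) =
      - (W (r • z) * Real.exp (u (r • z))) := by
    intro r hr
    have := hPDE _ (hzb r hr)
    rw [lap_eq] at this
    linarith
  have hTb : ∀ (c d : ℝ), |c| ≤ 1 → |d| ≤ 1 → ∀ r ∈ Set.Icc 0 r1,
      |-(1 / 4) * δ ^ 2 * w r * (af u (r • z) * c + bf u (r • z) * d)| ≤
        δ * (Γ + Λ ^ 2) * w r / (1 + r) := by
    intro c d hc hd r hr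
    have hr0 := hr.1
    obtain ⟨h1, h2⟩ := hab (r • z) (by rw [hzr r hr.1]; exact mul_le_mul_of_nonneg_left hr.2 hδ.le)
    rw [hzr r hr.1] at h1 h2
    have h3 : |af u (r • z) * c + bf u (r • z) * d| ≤ 2 * (Γ / (δ + δ * r)) := by
      refine (abs_add_le _ _).trans ?_
      rw [abs_mul, abs_mul]
      have p1 := mul_le_mul h1 hc (abs_nonneg _) (by positivity)
      have p2 := mul_le_mul h2 hd (abs_nonneg _) (by positivity)
      linarith
    have hwr := hwp r
    rw [abs_mul, show |-(1 / 4) * δ ^ 2 * w r| = 1 / 4 * δ ^ 2 * w r by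
      rw [abs_mul, abs_mul, abs_of_pos hwr, abs_of_pos (show 0 < δ ^ 2 by positivity)]; norm_num]
    refine (mul_le_mul_of_nonneg_left h3 (by positivity)).trans ?_
    rw [show 1 / 4 * δ ^ 2 * w r * (2 * (Γ / (δ + δ * r))) = (1 / 2 * δ * Γ * w r) / (1 + r) by
      field_simp; ring]
    apply div_le_div_of_nonneg_right _ (by linarith)
    have : 0 ≤ δ * Γ * w r := by positivity
    have : 0 ≤ δ * Λ ^ 2 * w r := by positivity
    nlinarith
  have e0b : |e 0| ≤ 1 := by rw [abs_le]; constructor <;> nlinarith [sq_nonneg (e 1)]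
  have e1b : |e 1| ≤ 1 := by rw [abs_le]; constructor <;> nlinarith [sq_nonneg (e 0)]
  have main := ode_G (w := w) (g0 := g 0) (g1 := g 1) (H := H)
    (H' := fun r => 1 / 2 * (z 0 * pd 0 W (r • z) + z 1 * pd 1 W (r • z)) / W 0)
    (T0 := fun r => -(1 / 4) * δ ^ 2 * w r * (af u (r • z) * e 0 + bf u (r • z) * e 1))
    (T1 := fun r => -(1 / 4) * δ ^ 2 * w r * (af u (r • z) * (- e 1) + bf u (r • z) * e 0))
    (e0 := e 0) (e1 := e 1) (ε := δ * (Γ + Λ ^ 2)) (r1 := r1) hesq (by positivity) hr1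
    ?_ ?_ ?_ ?_ ?_ ?_ ?_ ?_ ?_ ?_ ?_ ?_ ?_ hs (‖x‖ / δ) ⟨by positivity, by
      rw [div_le_iff₀ hδ]; linarith⟩
  · have hxz : (‖x‖ / δ) • z = x := by
      rw [hz, he, smul_smul, smul_smul, div_mul_cancel₀ _ hδ.ne', mul_inv_cancel₀ hxn.ne', one_smul]
    simp only [hw, hxz] at main
    exact main
  · intro r hr
    refine (hwd r).congr_deriv ?_
    simp only [hg, hzi]; ring
  · intro r hr
    refine (hgd 0 r).congr_deriv ?_
    rw [hdiv, hzi, hzi, pd_comm hu 1 0]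
    have := hlapr r hr
    unfold af bf
    linear_combination (-(1 / 4) * δ ^ 2 * w r * e 0) * this
  · intro r hr
    refine (hgd 1 r).congr_deriv ?_
    rw [hdiv, hzi, hzi]
    have := hlapr r hr
    unfold af bf
    linear_combination (-(1 / 4) * δ ^ 2 * w r * e 1) * this
  · intro r hr
    exact ((ray_deriv hW z r).const_mul (1 / 2)).div_const (W 0)
  · intro r hr
    have hb := hzb r hr
    have d0 := (hWd _ hb 0).trans (mul_le_mul_of_nonneg_left (hWr _ hb) hΛ.le)
    have d1 := (hWd _ hb 1).trans (mul_le_mul_of_nonneg_left (hWr _ hb) hΛ.le)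
    rw [abs_div, abs_of_pos hW0, div_le_iff₀ hW0, abs_mul, hzi, hzi]
    have m0 : |δ * e 0 * pd 0 W (r • z)| ≤ δ * (Λ * (Λ * W 0)) := by
      rw [abs_mul, abs_mul, abs_of_pos hδ]
      have := mul_le_mul e0b d0 (abs_nonneg _) zero_le_one
      nlinarith
    have m1 : |δ * e 1 * pd 1 W (r • z)| ≤ δ * (Λ * (Λ * W 0)) := by
      rw [abs_mul, abs_mul, abs_of_pos hδ]
      have := mul_le_mul e1b d1 (abs_nonneg _) zero_le_one
      nlinarith
    have m2 := abs_add_le (δ * e 0 * pd 0 W (r • z)) (δ * e 1 * pd 1 W (r • z))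
    rw [abs_of_pos (show (0 : ℝ) < 1 / 2 by norm_num)]
    have : 0 ≤ δ * Γ * W 0 := by positivity
    nlinarith
  · intro r hr
    have := hWp _ (hzb r hr)
    simp only [hH]; positivity
  · exact hTb _ _ e0b e1b
  · exact hTb _ _ (by rw [abs_neg]; exact e1b) e0b
  · intro r hr
    have := hmax _ (hzb r hr)
    simp only [hw]
    apply Real.one_le_exp; linarith
  · simp [hw]
  · simp [hg, hp0]
  · simp [hg, hp0]
  · simp only [hH, zero_smul]; field_simp


/-- Local data around a concentration point, translated to the origin. -/
structure Loc (R Λ M δ : ℝ) (u W : E2 → ℝ) : Prop where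
  hu : ContDiff ℝ 2 u
  hW : ContDiff ℝ 1 W
  hδ : 0 < δ
  hδ1 : δ ^ 2 * (W 0 * Real.exp (u 0)) = 1
  hPDE : ∀ y ∈ ball (0 : E2) (3 * R / 2), - lap u y = W y * Real.exp (u y)
  hWp : ∀ y ∈ ball (0 : E2) (3 * R / 2), 0 < W y
  hWd : ∀ y ∈ ball (0 : E2) (3 * R / 2), ∀ i, |pd i W y| ≤ Λ * W y
  hWr : ∀ y ∈ ball (0 : E2) (3 * R / 2), ∀ z ∈ ball (0 : E2) (3 * R / 2), W y ≤ Λ * W z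
  hmax : ∀ y ∈ ball (0 : E2) R, u y ≤ u 0
  hM : (∫ y in ball (0 : E2) R, W y * Real.exp (u y)) ≤ M

lemma Loc.sub {R : ℝ} (hR : 0 < R) {y : E2} (hy : y ∈ ball (0 : E2) R) : y ∈ ball (0 : E2) (3 * R / 2) :=
  ball_subset_ball (by linarith) hy

lemma Loc.f_le {R Λ M δ : ℝ} {u W : E2 → ℝ} (hR : 0 < R) (hΛ : 0 < Λ) (h : Loc R Λ M δ u W) {y : E2}
    (hy : y ∈ ball (0 : E2) R) : W y * Real.exp (u y) ≤ Λ * (δ ^ 2)⁻¹ := by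
  have hδ := h.hδ
  have h0 : (0 : E2) ∈ ball (0 : E2) (3 * R / 2) := mem_ball_self (by linarith)
  have e : W 0 * Real.exp (u 0) = (δ ^ 2)⁻¹ := by
    apply eq_inv_of_mul_eq_one_left; linarith [h.hδ1]
  have h1 := h.hWr y (Loc.sub hR hy) 0 h0
  have h2 : Real.exp (u y) ≤ Real.exp (u 0) := Real.exp_le_exp.2 (h.hmax y hy)
  have h3 := h.hWp y (Loc.sub hR hy)
  have h4 := h.hWp 0 h0
  rw [← e, ← mul_assoc]
  exact mul_le_mul h1 h2 (Real.exp_pos _).le (by positivity)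

lemma Loc.f_eq {R Λ M δ : ℝ} {u W : E2 → ℝ} (hR : 0 < R) (h : Loc R Λ M δ u W) (y : E2) :
    W y * Real.exp (u y) = W y / W 0 * (δ ^ 2)⁻¹ * ((Real.exp ((u 0 - u y) / 2)) ^ 2)⁻¹ := by
  have hδ := h.hδ
  have h0 : (0 : E2) ∈ ball (0 : E2) (3 * R / 2) := mem_ball_self (by linarith)
  have h4 := h.hWp 0 h0
  have e : W 0 * Real.exp (u 0) = (δ ^ 2)⁻¹ := by
    apply eq_inv_of_mul_eq_one_left; linarith [h.hδ1]
  rw [← e, ← Real.exp_nat_mul, ← Real.exp_neg]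
  rw [show W y / W 0 * (W 0 * Real.exp (u 0)) * Real.exp (-((2 : ℕ) * ((u 0 - u y) / 2))) =
    W y * (Real.exp (u 0) * Real.exp (-((2 : ℕ) * ((u 0 - u y) / 2)))) by field_simp]
  rw [← Real.exp_add]
  congr 2
  push_cast; ring

lemma stepA {R Λ M K : ℝ} (hR : 0 < R) (hΛ : 0 < Λ) (hM : 0 < M) (hK : 1 ≤ K) :
    ∃ C > (0 : ℝ), ∃ t0 > (0 : ℝ), ∀ (t : ℝ) (u W : E2 → ℝ), 0 < t → t < t0 → Loc R Λ M (t ^ 4) u W →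
    (∀ y : E2, R / 4 < ‖y‖ → ‖y‖ < R → |u y| ≤ K / t ^ 2) → ∀ x : E2, ‖x‖ ≤ t ^ 3 →
    |Real.exp ((u 0 - u x) / 2) - 1 - (‖x‖ / t ^ 4) ^ 2 / 8| ≤ C * t ^ 2 * (‖x‖ / t ^ 4) ^ 2 := by
  obtain ⟨Ch, hCh, hopf⟩ := hopf_bound hR hΛ hM
  set C1 : ℝ := Ch * (K ^ 2 + Λ + 1) with hC1
  have hC1p : 0 < C1 := by positivity
  set C2 : ℝ := 2 * (2 * C1 + Λ ^ 2) with hC2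
  have hC2p : 0 < C2 := by positivity
  refine ⟨5 * C2, by positivity, min (min 1 (R / 4)) (1 / (20 * C2)), by positivity, ?_⟩
  intro t u W ht htlt h hann x hx
  have ht1 : t < 1 := htlt.trans_le ((min_le_left _ _).trans (min_le_left _ _))
  have htR : t < R / 4 := htlt.trans_le ((min_le_left _ _).trans (min_le_right _ _))
  have htC : t < 1 / (20 * C2) := htlt.trans_le (min_le_right _ _)
  rw [lt_div_iff₀ (by positivity)] at htC
  have ht3 : t ^ 3 < R / 4 := by
    have : t ^ 3 ≤ t := by nlinarith [pow_le_one₀ ht.le ht1.le (n := 2)]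
    linarith
  have hδ := h.hδ
  have hsub : ∀ y ∈ ball (0 : E2) R, y ∈ ball (0 : E2) (3 * R / 2) := fun y hy => Loc.sub hR hy
  have hKt : 1 ≤ K / t ^ 2 := by
    rw [le_div_iff₀ (by positivity)]
    nlinarith [pow_le_one₀ ht.le ht1.le (n := 2)]
  have h1t : t ^ 4 * (1 / t) = t ^ 3 := by field_simp
  have hs : t ^ 4 * (C1 * (1 + 1 / t) + Λ ^ 2) * (1 + 1 / t) ≤ C2 * t ^ 2 := by
    have e : t ^ 4 * (C1 * (1 + 1 / t) + Λ ^ 2) * (1 + 1 / t) =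
        t ^ 2 * ((C1 * (t + 1) + Λ ^ 2 * t) * (t + 1)) := by field_simp
    rw [e, mul_comm C2]
    apply mul_le_mul_of_nonneg_left _ (by positivity)
    have p1 : C1 * (t + 1) + Λ ^ 2 * t ≤ 2 * C1 + Λ ^ 2 := by nlinarith [sq_nonneg Λ]
    have p2 := mul_le_mul p1 (show t + 1 ≤ 2 by linarith) (by linarith) (by positivity)
    linarith
  have hC2t : C2 * t ^ 2 ≤ 1 / 20 := by
    have : C2 * t ^ 2 ≤ C2 * t := by
      apply mul_le_mul_of_nonneg_left _ hC2p.le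
      nlinarith
    linarith
  have main := core2 (r1 := 1 / t) (Γ := C1 * (1 + 1 / t)) (R := R) h.hu h.hW hΛ hδ (by positivity)
    (by rw [h1t]; linarith) (by positivity) h.hδ1 (fun y hy => h.hPDE y (hsub y hy))
    (fun y hy => h.hWp y (hsub y hy)) (fun y hy => h.hWd y (hsub y hy))
    (fun y hy => h.hWr y (hsub y hy) 0 (mem_ball_self (by linarith))) h.hmax ?_ (hs.trans hC2t) x
    (by rw [h1t]; exact hx)
  · refine main.trans ?_
    apply mul_le_mul_of_nonneg_right _ (by positivity)
    linarith
  · intro y hy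
    rw [h1t] at hy
    have hyR : y ∈ ball (0 : E2) (R / 4) := by rw [mem_ball, dist_zero_right]; linarith
    have := hopf u W h.hu h.hW (fun y hy => h.hPDE y (hsub y hy))
      (fun y hy => h.hWp y (hsub y hy)) (fun y hy => h.hWd y (hsub y hy)) h.hM _ hKt hann y hyR
      (Λ * ((t ^ 4) ^ 2)⁻¹) (t ^ 4) (by positivity) hδ (fun z hz _ => h.f_le hR hΛ hz)
    have hle : Ch * ((K / t ^ 2) ^ 2 + Λ * ((t ^ 4) ^ 2)⁻¹ * t ^ 4 + 1 / t ^ 4) ≤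
        C1 * (1 + 1 / t) / (t ^ 4 + ‖y‖) := by
      have e : Ch * ((K / t ^ 2) ^ 2 + Λ * ((t ^ 4) ^ 2)⁻¹ * t ^ 4 + 1 / t ^ 4) = C1 / t ^ 4 := by
        rw [hC1]; field_simp
      rw [e, div_le_div_iff₀ (by positivity) (by positivity)]
      have : C1 * (1 + 1 / t) * t ^ 4 = C1 * (t ^ 4 + t ^ 3) := by rw [← h1t]; ring
      rw [this]
      gcongr
    exact ⟨this.1.trans hle, this.2.trans hle⟩

lemma stepB' {R Λ M t C : ℝ} {u W : E2 → ℝ} (hR : 0 < R) (hΛ : 0 < Λ) (ht : 0 < t) (hC : C * t ^ 2 ≤ 1 / 16)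
    (htR : t ^ 3 < R)
    (h : Loc R Λ M (t ^ 4) u W) (hp : ∀ x : E2, ‖x‖ ≤ t ^ 3 →
    |Real.exp ((u 0 - u x) / 2) - 1 - (‖x‖ / t ^ 4) ^ 2 / 8| ≤ C * t ^ 2 * (‖x‖ / t ^ 4) ^ 2) :
    ∀ x : E2, ‖x‖ ≤ t ^ 3 → W x * Real.exp (u x) * ‖x‖ ^ 2 ≤ 16 * Λ := by
  intro x hx
  have hxR : x ∈ ball (0 : E2) R := by rw [mem_ball, dist_zero_right]; linarith
  have h0 : (0 : E2) ∈ ball (0 : E2) (3 * R / 2) := mem_ball_self (by linarith)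
  have hW0 := h.hWp 0 h0
  have hWx := h.hWp x (Loc.sub hR hxR)
  rw [h.f_eq hR x]
  set w := Real.exp ((u 0 - u x) / 2) with hw
  set r := ‖x‖ / t ^ 4 with hr
  have hw1 : 1 ≤ w := Real.one_le_exp (by linarith [h.hmax x hxR])
  have h1 := (abs_le.1 (hp x hx)).1
  have h2 : C * t ^ 2 * r ^ 2 ≤ 1 / 16 * r ^ 2 := mul_le_mul_of_nonneg_right hC (sq_nonneg _)
  have h3 : r ^ 2 / 16 ≤ w ^ 2 := by nlinarith
  have h4 : W x / W 0 ≤ Λ := by rw [div_le_iff₀ hW0]; exact h.hWr x (Loc.sub hR hxR) 0 h0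
  have e : W x / W 0 * ((t ^ 4) ^ 2)⁻¹ * (w ^ 2)⁻¹ * ‖x‖ ^ 2 = W x / W 0 * (r ^ 2 / w ^ 2) := by
    rw [hr]; field_simp
  rw [e]
  have h5 : r ^ 2 / w ^ 2 ≤ 16 := by
    rw [div_le_iff₀ (by positivity)]; linarith
  have := mul_le_mul h4 h5 (by positivity) hΛ.le
  linarith

lemma stepB {R Λ M C η : ℝ} (hR : 0 < R) (hΛ : 0 < Λ) (hCp : 0 < C) (hη : 0 < η) :
    ∃ t0 > (0 : ℝ), ∀ (t : ℝ) (u W : E2 → ℝ), 0 < t → t < t0 → Loc R Λ M (t ^ 4) u W →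
    (∀ x : E2, ‖x‖ ≤ t ^ 3 →
    |Real.exp ((u 0 - u x) / 2) - 1 - (‖x‖ / t ^ 4) ^ 2 / 8| ≤ C * t ^ 2 * (‖x‖ / t ^ 4) ^ 2) →
    8 * π - η ≤ ∫ y in ball (0 : E2) (t ^ 3 / 2), W y * Real.exp (u y) := by
  have hlim : Tendsto (fun t : ℝ => (1 - 2 * Λ ^ 2 * t) * (π / (4 * t ^ 2 + (1 / 8 + C * t ^ 2)))) (𝓝 0)
      (𝓝 ((1 - 2 * Λ ^ 2 * 0) * (π / (4 * 0 ^ 2 + (1 / 8 + C * 0 ^ 2))))) := by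
    apply ContinuousAt.tendsto
    apply ContinuousAt.mul (by fun_prop)
    apply ContinuousAt.div (by fun_prop) (by fun_prop) (by norm_num)
  have hev := hlim.eventually (lt_mem_nhds (a := 8 * π - η) (by norm_num; linarith))
  obtain ⟨τ, hτ, hev⟩ := Metric.eventually_nhds_iff.1 hev
  refine ⟨min (min τ (min 1 R)) (1 / (2 * Λ ^ 2)), by positivity, ?_⟩
  intro t u W ht htlt h hp
  have ht1 : t < 1 := htlt.trans_le ((min_le_left _ _).trans ((min_le_right _ _).trans (min_le_left _ _)))
  have htR : t < R := htlt.trans_le ((min_le_left _ _).trans ((min_le_right _ _).trans (min_le_right _ _)))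
  have htτ : t < τ := htlt.trans_le ((min_le_left _ _).trans (min_le_left _ _))
  have htΛ : t < 1 / (2 * Λ ^ 2) := htlt.trans_le (min_le_right _ _)
  rw [lt_div_iff₀ (by positivity)] at htΛ
  have hev' := hev (y := t) (by rw [dist_zero_right, Real.norm_eq_abs, abs_of_pos ht]; exact htτ)
  have ht3 : t ^ 3 ≤ t := by nlinarith [pow_le_one₀ ht.le ht1.le (n := 2)]
  have h0 : (0 : E2) ∈ ball (0 : E2) (3 * R / 2) := mem_ball_self (by linarith)
  have hW0 := h.hWp 0 h0
  -- lower bound for the potential ratio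
  have hWlow : ∀ x : E2, ‖x‖ ≤ t → 1 - 2 * Λ ^ 2 * t ≤ W x / W 0 := by
    intro x hx
    have hb : ∀ s ∈ Set.Icc (0 : ℝ) 1, s • x ∈ ball (0 : E2) (3 * R / 2) := by
      intro s hs
      rw [mem_ball, dist_zero_right, norm_smul, Real.norm_eq_abs, abs_of_nonneg hs.1]
      nlinarith [norm_nonneg x, hs.2]
    have := mvt (f := fun s => W (s • x)) (f' := fun s => x 0 * pd 0 W (s • x) + x 1 * pd 1 W (s • x))
      (C := 2 * Λ ^ 2 * W 0 * t) zero_le_one (fun s _ => ray_deriv h.hW x s) ?_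
    · simp only [one_smul, zero_smul, mul_one] at this
      rw [le_div_iff₀ hW0]
      linarith [(abs_le.1 this).1]
    · intro s hs
      have hxi : ∀ i, |x i| ≤ t := fun i => by
        have := EuclideanSpace.norm_eq x
        have := PiLp.norm_apply_le x i
        rw [Real.norm_eq_abs] at this
        linarith
      have d : ∀ i, |pd i W (s • x)| ≤ Λ * (Λ * W 0) := fun i =>
        (h.hWd _ (hb s hs) i).trans (mul_le_mul_of_nonneg_left (h.hWr _ (hb s hs) 0 h0) hΛ.le)
      refine (abs_add_le _ _).trans ?_
      rw [abs_mul, abs_mul]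
      have p0 := mul_le_mul (hxi 0) (d 0) (abs_nonneg _) ht.le
      have p1 := mul_le_mul (hxi 1) (d 1) (abs_nonneg _) ht.le
      nlinarith
  set κ : ℝ := (1 / 8 + C * t ^ 2) / (t ^ 4) ^ 2 with hκ
  have hκ0 : 0 ≤ κ := by positivity
  have hbub := bubble_int (κ := κ) (ρ := t ^ 3 / 2) hκ0 (by positivity)
  have hcont : Continuous fun y : E2 => ((1 + κ * ‖y‖ ^ 2) ^ 2)⁻¹ := by
    apply Continuous.inv₀ (by fun_prop)
    intro y; positivity
  have hfc : Continuous fun y => W y * Real.exp (u y) :=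
    h.hW.continuous.mul (Real.continuous_exp.comp h.hu.continuous)
  have hloc : ∀ {F : E2 → ℝ}, Continuous F → ∀ (p : E2) (r : ℝ), IntegrableOn F (ball p r) := by
    intro F hF p r
    exact (hF.continuousOn.integrableOn_compact (isCompact_closedBall p r)).mono_set
      ball_subset_closedBall
  have hc2 : Continuous fun y : E2 => (1 - 2 * Λ ^ 2 * t) * ((t ^ 4) ^ 2)⁻¹ * ((1 + κ * ‖y‖ ^ 2) ^ 2)⁻¹ :=
    continuous_const.mul hcont
  have hmono : (∫ y in ball (0 : E2) (t ^ 3 / 2), (1 - 2 * Λ ^ 2 * t) * ((t ^ 4) ^ 2)⁻¹ * ((1 + κ * ‖y‖ ^ 2) ^ 2)⁻¹)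
      ≤ ∫ y in ball (0 : E2) (t ^ 3 / 2), W y * Real.exp (u y) := by
    apply setIntegral_mono_on (hloc hc2 _ _) (hloc hfc _ _) measurableSet_ball
    intro y hy
    rw [mem_ball, dist_zero_right] at hy
    have hy3 : ‖y‖ ≤ t ^ 3 := by linarith [pow_pos ht 3]
    have h1 := (abs_le.1 (hp y hy3)).2
    have hwp := Real.exp_pos ((u 0 - u y) / 2)
    have h2 : Real.exp ((u 0 - u y) / 2) ≤ 1 + κ * ‖y‖ ^ 2 := by
      have : κ * ‖y‖ ^ 2 = (1 / 8 + C * t ^ 2) * (‖y‖ / t ^ 4) ^ 2 := by rw [hκ]; field_simp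
      rw [this]; linarith
    rw [h.f_eq hR y]
    have h3 : ((1 + κ * ‖y‖ ^ 2) ^ 2)⁻¹ ≤ ((Real.exp ((u 0 - u y) / 2)) ^ 2)⁻¹ := by
      apply inv_anti₀ (by positivity)
      gcongr
    apply mul_le_mul _ h3 (by positivity)
    · have : (0 : ℝ) ≤ 1 - 2 * Λ ^ 2 * t := by linarith
      exact mul_nonneg (this.trans (hWlow y (hy3.trans ht3))) (by positivity)
    · exact mul_le_mul_of_nonneg_right (hWlow y (hy3.trans ht3)) (by positivity)
  refine le_trans ?_ hmono
  rw [integral_const_mul, hbub]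
  refine hev'.le.trans (le_of_eq ?_)
  rw [hκ]
  field_simp
  ring


lemma stepC {R Λ M K B : ℝ} (hR : 0 < R) (hΛ : 0 < Λ) (hM : 0 < M) (hK : 0 < K) (hB : 1 ≤ B) :
    ∃ σ > (0 : ℝ), σ < R / 4 ∧ ∃ δ0 > (0 : ℝ), ∀ (δ : ℝ) (u W : E2 → ℝ), δ < δ0 → Loc R Λ M δ u W →
    (∀ y : E2, R / 4 < ‖y‖ → ‖y‖ < R → |u y| ≤ B) →
    (∀ x : E2, ‖x‖ ≤ R / 2 → W x * Real.exp (u x) * ‖x‖ ^ 2 ≤ K) → ∀ x : E2, ‖x‖ ≤ σ →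
    |u x - u 0 + 2 * Real.log (1 + (‖x‖ / δ) ^ 2 / 8)| ≤ 2 := by
  obtain ⟨Ch, hCh, hopf⟩ := hopf_bound hR hΛ hM
  set Γ : ℝ := 2 * Ch * (B ^ 2 * R + Λ + 2 * K + 2) with hΓ
  have hΓp : 0 < Γ := by positivity
  set σ : ℝ := min (R / 8) (1 / (200 * (Γ + Λ ^ 2))) with hσ
  have hσp : 0 < σ := by positivity
  have hσR : σ ≤ R / 8 := min_le_left _ _
  have hσΓ : σ ≤ 1 / (200 * (Γ + Λ ^ 2)) := min_le_right _ _
  rw [le_div_iff₀ (by positivity)] at hσΓ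
  refine ⟨σ, hσp, by linarith, σ, hσp, ?_⟩
  intro δ u W hδσ h hann hf x hx
  have hδ := h.hδ
  have hsub : ∀ y ∈ ball (0 : E2) R, y ∈ ball (0 : E2) (3 * R / 2) := fun y hy => Loc.sub hR hy
  have hs : δ * (Γ + Λ ^ 2) * (1 + σ / δ) ≤ 1 / 100 := by
    have : δ * (Γ + Λ ^ 2) * (1 + σ / δ) = (Γ + Λ ^ 2) * (δ + σ) := by field_simp
    rw [this]
    have hp : 0 < Γ + Λ ^ 2 := by positivity
    nlinarith
  have hδσ' : δ * (σ / δ) = σ := by field_simp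
  have main := core2 (r1 := σ / δ) (Γ := Γ) (R := R) h.hu h.hW hΛ hδ (by positivity)
    (by rw [hδσ']; linarith) hΓp.le h.hδ1 (fun y hy => h.hPDE y (hsub y hy))
    (fun y hy => h.hWp y (hsub y hy)) (fun y hy => h.hWd y (hsub y hy))
    (fun y hy => h.hWr y (hsub y hy) 0 (mem_ball_self (by linarith))) h.hmax ?_ (by linarith) x
    (by rw [hδσ']; exact hx)
  · set w := Real.exp ((u 0 - u x) / 2) with hw
    set q := (‖x‖ / δ) ^ 2 with hq
    have hq0 : 0 ≤ q := sq_nonneg _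
    have hlw : Real.log w = (u 0 - u x) / 2 := Real.log_exp _
    have hm : 5 * (δ * (Γ + Λ ^ 2) * (1 + σ / δ)) * q ≤ 1 / 20 * q :=
      mul_le_mul_of_nonneg_right (by linarith) hq0
    obtain ⟨m1, m2⟩ := abs_le.1 main
    have hwp : 0 < w := Real.exp_pos _
    have hl2 : Real.log 2 ≤ 1 := by
      have := Real.log_two_lt_d9; linarith
    have l1 : Real.log w ≤ Real.log 2 + Real.log (1 + q / 8) := by
      rw [← Real.log_mul (by norm_num) (by positivity)]
      apply Real.log_le_log hwp; linarith
    have l2 : Real.log (1 + q / 8) ≤ Real.log 2 + Real.log w := by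
      rw [← Real.log_mul (by norm_num) (by positivity)]
      apply Real.log_le_log (by positivity); linarith
    rw [abs_le]; constructor <;> linarith
  · intro y hy
    rw [hδσ'] at hy
    have hyR : y ∈ ball (0 : E2) (R / 4) := by rw [mem_ball, dist_zero_right]; linarith
    have hh := hopf u W h.hu h.hW (fun y hy => h.hPDE y (hsub y hy))
      (fun y hy => h.hWp y (hsub y hy)) (fun y hy => h.hWd y (hsub y hy)) h.hM B hB hann y hyR
    have hgen : ∀ m : ℝ, 0 < m → δ + ‖y‖ ≤ 2 * m → m ≤ R → ∀ c : ℝ, 0 ≤ c → c ≤ Λ + 2 * K + 2 →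
        Ch * (B ^ 2 + c / m) ≤ Γ / (δ + ‖y‖) := by
      intro m hm h1 h2 c hc0 hc
      have h3 : B ^ 2 + c / m ≤ (B ^ 2 * R + Λ + 2 * K + 2) / m := by
        rw [le_div_iff₀ hm]
        have : (B ^ 2 + c / m) * m = B ^ 2 * m + c := by field_simp
        rw [this]
        nlinarith [mul_le_mul_of_nonneg_left h2 (sq_nonneg B)]
      have h4 : Γ / (2 * m) ≤ Γ / (δ + ‖y‖) := by
        apply div_le_div_of_nonneg_left hΓp.le (by positivity) h1
      refine le_trans ?_ h4
      refine (mul_le_mul_of_nonneg_left h3 hCh.le).trans (le_of_eq ?_)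
      rw [hΓ]; field_simp
    rcases lt_or_ge ‖y‖ δ with hlt | hge
    · have := hh (Λ * (δ ^ 2)⁻¹) δ (by positivity) hδ (fun z hz _ => h.f_le hR hΛ hz)
      have e : B ^ 2 + Λ * (δ ^ 2)⁻¹ * δ + 1 / δ = B ^ 2 + (Λ + 1) / δ := by field_simp; ring
      rw [e] at this
      have g := hgen δ hδ (by linarith) (by linarith) (Λ + 1) (by linarith) (by linarith)
      exact ⟨this.1.trans g, this.2.trans g⟩
    · have hyp : 0 < ‖y‖ := lt_of_lt_of_le hδ hge
      have := hh (4 * K / ‖y‖ ^ 2) (‖y‖ / 2) (by positivity) (by positivity) (by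
        intro z hz hzy
        rw [mem_ball, dist_eq_norm] at hzy
        have n1 := norm_sub_norm_le y z
        rw [norm_sub_rev] at n1
        have n2 := norm_sub_norm_le z y
        have hz1 : ‖y‖ / 2 ≤ ‖z‖ := by linarith
        have hzf := hf z (by linarith)
        have hfz : 0 < W z * Real.exp (u z) := mul_pos (h.hWp z (hsub z hz)) (Real.exp_pos _)
        rw [le_div_iff₀ (by positivity)]
        have : (‖y‖ / 2) ^ 2 ≤ ‖z‖ ^ 2 := by gcongr
        nlinarith [mul_le_mul_of_nonneg_left this hfz.le])
      have e : B ^ 2 + 4 * K / ‖y‖ ^ 2 * (‖y‖ / 2) + 1 / (‖y‖ / 2) = B ^ 2 + (2 * K + 2) / ‖y‖ := by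
        field_simp; ring
      rw [e] at this
      have g := hgen ‖y‖ hyp (by linarith) (by linarith) (2 * K + 2) (by linarith) (by linarith)
      exact ⟨this.1.trans g, this.2.trans g⟩

lemma stepD {R δ σ B : ℝ} {u : E2 → ℝ} (hδ : 0 < δ) (hσ : 0 < σ) (hσR : σ < R) (hB : 0 ≤ B)
    (h1 : ∀ x : E2, ‖x‖ ≤ σ → |u x - u 0 + 2 * Real.log (1 + (‖x‖ / δ) ^ 2 / 8)| ≤ 2)
    (h2 : ∀ x : E2, σ ≤ ‖x‖ → ‖x‖ < R → |u x| ≤ B) :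
    ∀ x : E2, ‖x‖ < R → |u x - u 0 + 2 * Real.log (1 + (‖x‖ / δ) ^ 2 / 8)| ≤
      2 + 2 * B + 4 * Real.log (R / σ) := by
  intro x hx
  have hlog : 0 ≤ Real.log (R / σ) := Real.log_nonneg (by rw [le_div_iff₀ hσ]; linarith)
  rcases le_or_gt ‖x‖ σ with h | h
  · linarith [h1 x h]
  · have hxp : 0 < ‖x‖ := hσ.trans h
    have hn : ‖(σ / ‖x‖) • x‖ = σ := by
      rw [norm_smul, Real.norm_eq_abs, abs_of_pos (by positivity)]; field_simp
    have a1 := h1 ((σ / ‖x‖) • x) hn.le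
    have a2 := h2 ((σ / ‖x‖) • x) hn.ge (by rw [hn]; exact hσR)
    have a3 := h2 x h.le hx
    rw [hn] at a1
    have l1 : Real.log (1 + (σ / δ) ^ 2 / 8) ≤ Real.log (1 + (‖x‖ / δ) ^ 2 / 8) := by
      apply Real.log_le_log (by positivity)
      gcongr
    have l2 : Real.log (1 + (‖x‖ / δ) ^ 2 / 8) ≤ 2 * Real.log (R / σ) + Real.log (1 + (σ / δ) ^ 2 / 8) := by
      have : 2 * Real.log (R / σ) = Real.log ((R / σ) ^ 2) := by rw [Real.log_pow]; norm_num
      have hRp : 0 < R := by linarith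
      rw [this, ← Real.log_mul (by positivity) (by positivity)]
      apply Real.log_le_log (by positivity)
      have e : (R / σ) ^ 2 * (1 + (σ / δ) ^ 2 / 8) = (R / σ) ^ 2 + (R / δ) ^ 2 / 8 := by field_simp
      rw [e]
      have b1 : 1 ≤ (R / σ) ^ 2 := by
        apply one_le_pow₀; rw [le_div_iff₀ hσ]; linarith
      have b2 : (‖x‖ / δ) ^ 2 ≤ (R / δ) ^ 2 := by gcongr
      linarith
    obtain ⟨a11, a12⟩ := abs_le.1 a1
    obtain ⟨a21, a22⟩ := abs_le.1 a2
    obtain ⟨a31, a32⟩ := abs_le.1 a3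
    rw [abs_le]; constructor <;> linarith


/-- the nonlinearity -/
def ff {m : ℕ} (S : Setting m) (k : ℕ) (x : E2) : ℝ := S.lam k * S.V x * Real.exp (S.v k x)

lemma ff_pos {m : ℕ} (S : Setting m) (k : ℕ) {x : E2} (hx : x ∈ S.Ω) : 0 < ff S k x :=
  mul_pos (mul_pos (S.hlam_pos k) (S.hVpos x (subset_closure hx))) (Real.exp_pos _)

lemma ff_int {m : ℕ} (S : Setting m) (k : ℕ) : IntegrableOn (ff S k) S.Ω := by
  have hc : IsCompact (closure S.Ω) := S.hbd.isCompact_closure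
  have : ContinuousOn (ff S k) (closure S.Ω) :=
    (continuousOn_const.mul S.hVreg.continuousOn).mul (Real.continuous_exp.comp_continuousOn (S.hv_cont k))
  exact (this.integrableOn_compact hc).mono_set subset_closure

lemma ff_mono {m : ℕ} (S : Setting m) (k : ℕ) {A : Set E2} (hA : A ⊆ S.Ω) :
    (∫ x in A, ff S k x) ≤ ∫ x in S.Ω, ff S k x := by
  apply setIntegral_mono_set (ff_int S k)
  · filter_upwards [ae_restrict_mem S.hopen.measurableSet] with x hx using (ff_pos S k hx).le
  · exact hA.eventuallyLE

lemma mass_ev {m : ℕ} (S : Setting m) : ∀ᶠ k in atTop, (∫ x in S.Ω, ff S k x) ≤ 8 * π * m + 1 := by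
  have := S.hmass.eventually (gt_mem_nhds (show 8 * π * m < 8 * π * m + 1 by linarith))
  filter_upwards [this] with k hk using hk.le

lemma delta_pos {m : ℕ} (S : Setting m) (j : Fin m) (k : ℕ) : 0 < S.delta j k ∧
    S.delta j k ^ 2 * (S.lam k * S.V (S.xpt j k) * Real.exp (S.v k (S.xpt j k))) = 1 := by
  have hx : S.xpt j k ∈ S.Ω := S.hR2 j (by
    have := S.hxpt_mem j k
    rw [mem_ball] at this
    rw [mem_closedBall]; linarith [S.hR])
  have := ff_pos S k hx
  unfold ff at this
  unfold Setting.delta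
  refine ⟨by positivity, ?_⟩
  rw [inv_pow, Real.sq_sqrt this.le, inv_mul_cancel₀ this.ne']

lemma loc_exists {m : ℕ} (S : Setting m) : ∃ Λ > (0 : ℝ), ∀ᶠ k in atTop, ∀ j : Fin m, ∃ u W : E2 → ℝ,
    Loc S.R Λ (8 * π * m + 1) (S.delta j k) u W ∧ ∀ y ∈ ball (0 : E2) (3 * S.R / 2),
      S.xpt j k + y ∈ S.Ω ∧ u y = S.v k (S.xpt j k + y) ∧ W y = S.lam k * S.V (S.xpt j k + y) := by
  have hR := S.hR
  set K : Set E2 := ⋃ j, closedBall (S.xstar j) (2 * S.R) with hK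
  have hKc : IsCompact K := isCompact_iUnion (fun j => isCompact_closedBall _ _)
  have hKΩ : K ⊆ S.Ω := Set.iUnion_subset S.hR2
  obtain ⟨θ, hθ, hθ1, hθs, hθc, -, -⟩ := cutoff S.hopen hKc hKΩ
  have hθn : ∀ x ∈ K, ∀ᶠ y in 𝓝 x, θ y = 1 := fun x hx => eventually_nhdsSet_iff_forall.1 hθ1 x hx
  have hV1 : ContDiff ℝ 1 (fun x => θ x * S.V x) :=
    ext_contDiff S.hopen (C1_of_C2 hθ) hθs (S.hVreg.mono subset_closure)
  set Vt : E2 → ℝ := fun x => θ x * S.V x with hVt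
  have hVtK : ∀ x ∈ K, Vt x = S.V x := fun x hx => by simp [hVt, (hθn x hx).self_of_nhds]
  have hVtp : ∀ x ∈ K, 0 < Vt x := fun x hx => by
    rw [hVtK x hx]; exact S.hVpos x (subset_closure (hKΩ hx))
  have hKne : K.Nonempty := by
    refine ⟨S.xstar ⟨0, S.hm⟩, Set.mem_iUnion.2 ⟨⟨0, S.hm⟩, mem_closedBall_self (by linarith)⟩⟩
  obtain ⟨a, haK, ha⟩ := hKc.exists_isMinOn hKne hV1.continuous.continuousOn
  obtain ⟨b, hbK, hb⟩ := hKc.exists_isMaxOn hKne hV1.continuous.continuousOn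
  obtain ⟨c0, hc0⟩ := hKc.exists_bound_of_continuousOn (pd_continuous (i := 0) hV1).continuousOn
  obtain ⟨c1, hc1⟩ := hKc.exists_bound_of_continuousOn (pd_continuous (i := 1) hV1).continuousOn
  have hap := hVtp a haK
  have hbp := hVtp b hbK
  set N : ℝ := Vt b + |c0| + |c1| with hN
  have hNp : 0 < N := by positivity
  have hmin : ∀ x ∈ K, N ≤ N / Vt a * Vt x := by
    intro x hx
    have : Vt a ≤ Vt x := ha hx
    rw [div_mul_eq_mul_div, le_div_iff₀ hap]
    gcongr
  refine ⟨N / Vt a, by positivity, ?_⟩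
  have hcl : ∀ᶠ k in atTop, ∀ j : Fin m, dist (S.xpt j k) (S.xstar j) < S.R / 32 := by
    rw [eventually_all]
    intro j
    exact (S.hxpt_lim j).eventually (ball_mem_nhds _ (by positivity))
  filter_upwards [hcl, mass_ev S] with k hk hmk j
  set p := S.xpt j k with hp
  have hpK : ∀ y ∈ ball (0 : E2) (3 * S.R / 2), p + y ∈ K := by
    intro y hy
    rw [mem_ball, dist_zero_right] at hy
    refine Set.mem_iUnion.2 ⟨j, ?_⟩
    rw [mem_closedBall]
    have h1 : dist (p + y) (S.xstar j) ≤ dist (p + y) p + dist p (S.xstar j) := dist_triangle _ _ _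
    have h2 : dist (p + y) p = ‖y‖ := by simp [dist_eq_norm]
    have := hk j
    linarith
  have hlam := S.hlam_pos k
  have hvt : ContDiff ℝ 2 (fun x => θ x * S.v k x) := ext_contDiff S.hopen hθ hθs (S.hv_reg k)
  set vt : E2 → ℝ := fun x => θ x * S.v k x with hvtd
  have hvtK : ∀ x ∈ K, vt x = S.v k x := fun x hx => by simp [hvtd, (hθn x hx).self_of_nhds]
  have hvtl : ∀ x ∈ K, lap vt x = lap (S.v k) x := fun x hx => lap_congr (by
    filter_upwards [hθn x hx] with y hy; simp [hvtd, hy])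
  have hWd0 : ContDiff ℝ 1 (fun x : E2 => Vt (p + x)) := hV1.comp (contDiff_const.add contDiff_id)
  have hmem0 : (0 : E2) ∈ ball (0 : E2) (3 * S.R / 2) := mem_ball_self (by linarith)
  have hcomb : ∀ y ∈ ball (0 : E2) (3 * S.R / 2), S.lam k * Vt (p + y) * Real.exp (vt (p + y)) = ff S k (p + y) := by
    intro y hy
    rw [hvtK _ (hpK y hy), hVtK _ (hpK y hy)]; rfl
  refine ⟨fun y => vt (p + y), fun y => S.lam k * Vt (p + y), ⟨?_, ?_, (delta_pos S j k).1, ?_, ?_, ?_, ?_, ?_, ?_, ?_⟩, ?_⟩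
  · exact hvt.comp (contDiff_const.add contDiff_id)
  · exact contDiff_const.mul hWd0
  · have := (delta_pos S j k).2
    have h2 := hcomb 0 hmem0
    simp only [add_zero] at h2 ⊢
    rw [h2]; exact this
  · intro y hy
    have := lap_affine 1 p hvt y
    simp only [one_smul, one_pow, one_mul] at this
    rw [this, hvtl _ (hpK y hy), S.hPDE k _ (hKΩ (hpK y hy))]
    exact (hcomb y hy).symm
  · intro y hy
    exact mul_pos hlam (hVtp _ (hpK y hy))
  · intro y hy i
    have h1 := pd_affine i 1 p (hV1.differentiable (by norm_num)) y
    simp only [one_smul, one_mul] at h1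
    rw [pd_const_mul i _ (diff_of_C1 hWd0 y), h1, abs_mul, abs_of_pos hlam]
    have h2 : |pd i Vt (p + y)| ≤ N := by
      have b0 := hc0 _ (hpK y hy)
      have b1 := hc1 _ (hpK y hy)
      rw [Real.norm_eq_abs] at b0 b1
      have := le_abs_self c0
      have := le_abs_self c1
      have := abs_nonneg c0
      have := abs_nonneg c1
      fin_cases i
      · simp only [Fin.zero_eta]; linarith
      · simp only [Fin.mk_one]; linarith
    have h3 := mul_le_mul_of_nonneg_left (h2.trans (hmin _ (hpK y hy))) hlam.le
    linarith
  · intro y hy z hz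
    have h1 : Vt (p + y) ≤ Vt b := hb (hpK y hy)
    have h2 : Vt b ≤ N := by linarith [abs_nonneg c0, abs_nonneg c1]
    have h3 := mul_le_mul_of_nonneg_left ((h1.trans h2).trans (hmin _ (hpK z hz))) hlam.le
    linarith
  · intro y hy
    simp only [add_zero]
    rw [hvtK _ (hpK y (Loc.sub hR hy))]
    have := hpK 0 hmem0
    rw [add_zero] at this
    rw [hvtK _ this]
    apply S.hxpt_max j k
    rw [mem_ball, dist_zero_right] at hy
    rw [mem_ball, dist_eq_norm]
    simpa [hp] using hy
  · refine le_trans (le_of_eq ?_) ((ff_mono S k (A := ball p S.R) ?_).trans hmk)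
    · rw [ball_translate (ff S k)]
      apply setIntegral_congr_fun measurableSet_ball
      intro y hy
      exact hcomb y (Loc.sub hR hy)
    · intro x hx
      have := hKΩ (hpK (x - p) (Loc.sub hR (by
        rw [mem_ball, dist_zero_right]; rwa [mem_ball, dist_eq_norm] at hx)))
      simpa using this
  · intro y hy
    exact ⟨hKΩ (hpK y hy), hvtK _ (hpK y hy), by rw [← hVtK _ (hpK y hy)]⟩

lemma D_exists {m : ℕ} (S : Setting m) : ∃ D : ℝ, 1 ≤ D ∧ S.R ≤ D ∧ ∀ x ∈ S.Ω, ∀ y ∈ S.Ω, ‖y - x‖ ≤ D - 1 := by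
  refine ⟨max (diam S.Ω + 1) S.R, ?_, le_max_right _ _, ?_⟩
  · have : 0 ≤ diam S.Ω := diam_nonneg
    exact le_trans (by linarith) (le_max_left _ _)
  · intro x hx y hy
    have h1 := dist_le_diam_of_mem S.hbd hy hx
    rw [dist_eq_norm] at h1
    have := le_max_left (diam S.Ω + 1) S.R
    linarith


/-- Local data for the solution number `k` at the point number `j`. -/
def Good {m : ℕ} (S : Setting m) (Λ : ℝ) (k : ℕ) (j : Fin m) (u W : E2 → ℝ) : Prop :=
  Loc S.R Λ (8 * π * m + 1) (S.delta j k) u W ∧ ∀ y ∈ ball (0 : E2) (3 * S.R / 2),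
      S.xpt j k + y ∈ S.Ω ∧ u y = S.v k (S.xpt j k + y) ∧ W y = S.lam k * S.V (S.xpt j k + y)

lemma Good.ff_eq {m : ℕ} {S : Setting m} {Λ : ℝ} {k : ℕ} {j : Fin m} {u W : E2 → ℝ} (h : Good S Λ k j u W)
    {y : E2} (hy : y ∈ ball (0 : E2) (3 * S.R / 2)) : W y * Real.exp (u y) = ff S k (S.xpt j k + y) := by
  obtain ⟨-, h2, h3⟩ := h.2 y hy
  rw [h2, h3]; rfl

lemma Good.u0 {m : ℕ} {S : Setting m} {Λ : ℝ} {k : ℕ} {j : Fin m} {u W : E2 → ℝ} (h : Good S Λ k j u W) :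
    u 0 = S.v k (S.xpt j k) := by
  have := (h.2 0 (mem_ball_self (by linarith [S.hR]))).2.1
  rwa [add_zero] at this

lemma Good.ff_le {m : ℕ} {S : Setting m} {Λ : ℝ} (hΛ : 0 < Λ) {k : ℕ} {j : Fin m} {u W : E2 → ℝ}
    (h : Good S Λ k j u W)
    {x : E2} (hx : x ∈ ball (S.xpt j k) S.R) : ff S k x ≤ Λ * (S.delta j k ^ 2)⁻¹ := by
  have hx' : x - S.xpt j k ∈ ball (0 : E2) S.R := by
    rw [mem_ball, dist_zero_right]; rwa [mem_ball, dist_eq_norm] at hx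
  have h1 := h.1.f_le S.hR hΛ hx'
  rw [h.ff_eq (Loc.sub S.hR hx')] at h1
  simpa using h1

lemma pot {m : ℕ} (S : Setting m) {k : ℕ} (hk : (∫ x in S.Ω, ff S k x) ≤ 8 * π * m + 1) {D : ℝ} (hD : 1 ≤ D)
    (hΩD : ∀ x ∈ S.Ω, ∀ y ∈ S.Ω, ‖y - x‖ ≤ D - 1) {H ρ : ℝ} (hH : 0 ≤ H) (hρ : 0 < ρ) (hρD : ρ ≤ D)
    {x : E2} (hx : x ∈ S.Ω) (hf : ∀ y ∈ S.Ω, y ∈ ball x ρ → ff S k y ≤ H) :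
    S.v k x ≤ 2 + (8 * π * m + 1) / (2 * π) * Real.log (D / ρ) + H * ρ ^ 2 :=
  potential_bound S.hopen S.hbd (S.hv_reg k) (S.hv_cont k) (S.hBC k) (S.hPDE k)
    (fun _ hx => (ff_pos S k hx).le) (ff_int S k) hk hH hρ hρD hD hx (hΩD x hx) hf

lemma low {m : ℕ} (S : Setting m) (k : ℕ) : ∀ x ∈ S.Ω, -1 ≤ S.v k x :=
  lower_bound S.hopen S.hbd (S.hv_reg k) (S.hv_cont k) (S.hBC k) (S.hPDE k)
    (fun _ hx => ff_pos S k hx)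

lemma xpt_mem {m : ℕ} (S : Setting m) (j : Fin m) (k : ℕ) : S.xpt j k ∈ S.Ω := S.hR2 j (by
    have := S.hxpt_mem j k
    rw [mem_ball] at this
    rw [mem_closedBall]; linarith [S.hR])

lemma delta_small {m : ℕ} (S : Setting m) {Λ : ℝ} (hΛ : 0 < Λ)
    (hG : ∀ᶠ k in atTop, ∀ j : Fin m, ∃ u W, Good S Λ k j u W) {ε : ℝ} (hε : 0 < ε) :
    ∀ᶠ k in atTop, ∀ j : Fin m, S.delta j k < ε := by
  obtain ⟨D, hD, hRD, hΩD⟩ := D_exists S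
  have hR := S.hR
  set B : ℝ := 2 + (8 * π * m + 1) / (2 * π) * Real.log (D / S.R) + Λ * (ε ^ 2)⁻¹ * S.R ^ 2 with hB
  have hbl : ∀ᶠ k in atTop, ∀ j : Fin m, B < S.v k (S.xpt j k) := by
    rw [eventually_all]; intro j
    exact (S.hxpt_blow j).eventually (eventually_gt_atTop B)
  filter_upwards [hG, hbl, mass_ev S] with k hk hb hmk j
  by_contra hcon
  push Not at hcon
  obtain ⟨u, W, h⟩ := hk j
  have hδ := h.1.hδ
  have := pot S hmk hD hΩD (H := Λ * (S.delta j k ^ 2)⁻¹) (ρ := S.R) (by positivity) hR hRD (xpt_mem S j k)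
    (fun y _ hy => h.ff_le hΛ hy)
  have h2 : Λ * (S.delta j k ^ 2)⁻¹ * S.R ^ 2 ≤ Λ * (ε ^ 2)⁻¹ * S.R ^ 2 := by
    gcongr
  have := hb j
  linarith

/-- fourth root of the scaling parameter -/
def tt {m : ℕ} (S : Setting m) (j : Fin m) (k : ℕ) : ℝ := Real.sqrt (Real.sqrt (S.delta j k))

lemma tt_pos {m : ℕ} (S : Setting m) (j : Fin m) (k : ℕ) : 0 < tt S j k := by
  have := (delta_pos S j k).1
  unfold tt; positivity

lemma tt_pow {m : ℕ} (S : Setting m) (j : Fin m) (k : ℕ) : tt S j k ^ 4 = S.delta j k := by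
  have := (delta_pos S j k).1
  unfold tt
  rw [show 4 = 2 * 2 by norm_num, pow_mul, Real.sq_sqrt (Real.sqrt_nonneg _), Real.sq_sqrt this.le]

lemma tt_small {m : ℕ} (S : Setting m) {Λ : ℝ} (hΛ : 0 < Λ)
    (hG : ∀ᶠ k in atTop, ∀ j : Fin m, ∃ u W, Good S Λ k j u W) {ε : ℝ} (hε : 0 < ε) :
    ∀ᶠ k in atTop, ∀ j : Fin m, tt S j k < ε := by
  filter_upwards [delta_small S hΛ hG (pow_pos hε 4)] with k hk j
  have := hk j
  rw [← tt_pow] at this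
  exact lt_of_pow_lt_pow_left₀ 4 hε.le this

lemma pass1 {m : ℕ} (S : Setting m) {Λ : ℝ} (hΛ : 0 < Λ)
    (hG : ∀ᶠ k in atTop, ∀ j : Fin m, ∃ u W, Good S Λ k j u W) {η : ℝ} (hη : 0 < η) :
    ∀ᶠ k in atTop, ∀ j : Fin m,
      8 * π - η ≤ (∫ x in ball (S.xpt j k) (tt S j k ^ 3 / 2), ff S k x) ∧
      ∀ x : E2, ‖x‖ ≤ tt S j k ^ 3 → ff S k (S.xpt j k + x) * ‖x‖ ^ 2 ≤ 16 * Λ := by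
  obtain ⟨D, hD, hRD, hΩD⟩ := D_exists S
  have hR := S.hR
  have hpi := Real.pi_pos
  have hM : (0 : ℝ) < 8 * π * m + 1 := by positivity
  set M : ℝ := 8 * π * m + 1 with hMd
  set K : ℝ := 3 + Λ + M / (2 * π) * (2 * Real.sqrt D) with hK
  have hK1 : 1 ≤ K := by
    have : 0 ≤ M / (2 * π) * (2 * Real.sqrt D) := by positivity
    linarith
  obtain ⟨C, hC, t0, ht0, hA⟩ := stepA (R := S.R) hR hΛ hM hK1
  obtain ⟨t1, ht1, hBm⟩ := stepB (R := S.R) (M := M) hR hΛ hC hη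
  have hτ : 0 < min (min t0 t1) (min (min 1 S.R) (1 / (16 * C))) := by positivity
  filter_upwards [hG, mass_ev S, tt_small S hΛ hG hτ] with k hk hmk htk j
  obtain ⟨u, W, h⟩ := hk j
  set t := tt S j k with ht
  have htp : 0 < t := tt_pos S j k
  have hlt := htk j
  have htt0 : t < t0 := hlt.trans_le ((min_le_left _ _).trans (min_le_left _ _))
  have htt1 : t < t1 := hlt.trans_le ((min_le_left _ _).trans (min_le_right _ _))
  have ht1' : t < 1 := hlt.trans_le ((min_le_right _ _).trans ((min_le_left _ _).trans (min_le_left _ _)))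
  have htR : t < S.R := hlt.trans_le ((min_le_right _ _).trans ((min_le_left _ _).trans (min_le_right _ _)))
  have htC : t < 1 / (16 * C) := hlt.trans_le ((min_le_right _ _).trans (min_le_right _ _))
  rw [lt_div_iff₀ (by positivity)] at htC
  have hL : Loc S.R Λ M (t ^ 4) u W := by rw [ht, tt_pow]; exact h.1
  have ht2 : t ^ 2 ≤ t := by nlinarith
  have ht3 : t ^ 3 ≤ t := by nlinarith [pow_le_one₀ htp.le ht1'.le (n := 2)]
  have ht4 : t ^ 4 ≤ t := by nlinarith [pow_le_one₀ htp.le ht1'.le (n := 3)]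
  have hδt : S.delta j k = t ^ 4 := (tt_pow S j k).symm
  have hvp : S.v k (S.xpt j k) ≤ K / t ^ 2 := by
    have := pot S hmk hD hΩD (H := Λ * (S.delta j k ^ 2)⁻¹) (ρ := t ^ 4) (by positivity) (by positivity)
      (by linarith) (xpt_mem S j k)
      (fun y _ hy => h.ff_le hΛ (ball_subset_ball (by linarith) hy))
    rw [hδt] at this
    have e1 : Λ * ((t ^ 4) ^ 2)⁻¹ * (t ^ 4) ^ 2 = Λ := by field_simp
    have e2 : Real.log (D / t ^ 4) ≤ 2 * Real.sqrt D / t ^ 2 := by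
      have : D / t ^ 4 = (Real.sqrt D / t ^ 2) ^ 2 := by
        rw [div_pow, Real.sq_sqrt (by linarith)]; ring
      rw [this, Real.log_pow]
      have hp : 0 < Real.sqrt D / t ^ 2 := by
        have := Real.sqrt_pos.2 (show 0 < D by linarith)
        positivity
      have := Real.log_le_sub_one_of_pos hp
      push_cast
      rw [mul_div_assoc]
      linarith
    rw [e1] at this
    have e3 : M / (2 * π) * Real.log (D / t ^ 4) ≤ M / (2 * π) * (2 * Real.sqrt D / t ^ 2) :=
      mul_le_mul_of_nonneg_left e2 (by positivity)
    have e4 : K / t ^ 2 = (3 + Λ) / t ^ 2 + M / (2 * π) * (2 * Real.sqrt D / t ^ 2) := by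
      rw [hK]; ring
    have e5 : 3 + Λ ≤ (3 + Λ) / t ^ 2 := by
      rw [le_div_iff₀ (by positivity)]
      nlinarith
    linarith
  have hKt : 1 ≤ K / t ^ 2 := by
    rw [le_div_iff₀ (by positivity)]; linarith
  have hann : ∀ y : E2, S.R / 4 < ‖y‖ → ‖y‖ < S.R → |u y| ≤ K / t ^ 2 := by
    intro y _ hy
    have hyR : y ∈ ball (0 : E2) S.R := by rw [mem_ball, dist_zero_right]; exact hy
    obtain ⟨a1, a2, -⟩ := h.2 y (Loc.sub hR hyR)
    have b1 := low S k _ a1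
    rw [← a2] at b1
    have b2 := h.1.hmax y hyR
    rw [h.u0] at b2
    rw [abs_le]; constructor <;> linarith
  have hprof := hA t u W htp htt0 hL hann
  have hsub3 : ∀ y : E2, ‖y‖ ≤ t ^ 3 → y ∈ ball (0 : E2) (3 * S.R / 2) := by
    intro y hy; rw [mem_ball, dist_zero_right]; linarith
  constructor
  · refine (hBm t u W htp htt1 hL hprof).trans (le_of_eq ?_)
    rw [ball_translate (ff S k)]
    apply setIntegral_congr_fun measurableSet_ball
    intro y hy
    rw [mem_ball, dist_zero_right] at hy
    exact h.ff_eq (hsub3 y (by linarith [pow_pos htp 3]))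
  · intro x hx
    have hCt : C * t ^ 2 ≤ 1 / 16 := by
      have := mul_le_mul_of_nonneg_left ht2 hC.le
      linarith
    have := stepB' hR hΛ htp hCt (by linarith) hL hprof x hx
    rwa [h.ff_eq (hsub3 x hx)] at this


lemma geom_ev {m : ℕ} (S : Setting m) {Λ : ℝ} (hΛ : 0 < Λ)
    (hG : ∀ᶠ k in atTop, ∀ j : Fin m, ∃ u W, Good S Λ k j u W) :
    ∀ᶠ k in atTop, (∀ j : Fin m, tt S j k ^ 3 < S.R / 4 ∧ ball (S.xpt j k) (tt S j k ^ 3 / 2) ⊆ S.Ω) ∧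
      ∀ i j : Fin m, i ≠ j → 2 * S.R - S.R / 16 ≤ dist (S.xpt i k) (S.xpt j k) := by
  have hR := S.hR
  have hnear : ∀ᶠ k in atTop, ∀ j : Fin m, dist (S.xpt j k) (S.xstar j) < S.R / 32 := by
    rw [eventually_all]; intro j
    exact (S.hxpt_lim j).eventually (ball_mem_nhds _ (by positivity))
  have hτ : 0 < min 1 (S.R / 4) := by positivity
  filter_upwards [hnear, tt_small S hΛ hG hτ] with k hn ht
  have h3 : ∀ j : Fin m, tt S j k ^ 3 < S.R / 4 := by
    intro j
    have hp := tt_pos S j k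
    have h1 := (ht j).trans_le (min_le_left _ _)
    have h2 := (ht j).trans_le (min_le_right _ _)
    have : tt S j k ^ 3 ≤ tt S j k := by nlinarith [pow_le_one₀ hp.le h1.le (n := 2)]
    linarith
  refine ⟨fun j => ⟨h3 j, ?_⟩, ?_⟩
  · intro y hy
    apply S.hR2 j
    rw [mem_ball] at hy
    rw [mem_closedBall]
    have := dist_triangle y (S.xpt j k) (S.xstar j)
    have := h3 j; have := hn j; have := pow_pos (tt_pos S j k) 3
    linarith
  · intro i j hij
    have h1 := (disjoint_ball_ball_iff hR hR).1 (S.hRdisj i j hij)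
    have h2 := dist_triangle4 (S.xstar i) (S.xpt i k) (S.xpt j k) (S.xstar j)
    have h4 := hn i
    rw [dist_comm] at h4
    have := hn j
    linarith

lemma pass2 {m : ℕ} (S : Setting m) {Λ : ℝ} (hΛ : 0 < Λ)
    (hG : ∀ᶠ k in atTop, ∀ j : Fin m, ∃ u W, Good S Λ k j u W) {η : ℝ} (hη : 0 < η) :
    ∀ᶠ k in atTop, ∀ A : Set E2, MeasurableSet A → A ⊆ S.Ω →
      (∀ j : Fin m, Disjoint A (ball (S.xpt j k) (tt S j k ^ 3 / 2))) → (∫ x in A, ff S k x) ≤ η := by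
  have hR := S.hR
  have hm : (0 : ℝ) < m := by exact_mod_cast S.hm
  have hmass : ∀ᶠ k in atTop, (∫ x in S.Ω, ff S k x) < 8 * π * m + η / 2 :=
    S.hmass.eventually (gt_mem_nhds (show 8 * π * m < 8 * π * m + η / 2 by linarith))
  filter_upwards [hmass, geom_ev S hΛ hG, pass1 S hΛ hG (η := η / (2 * m)) (by positivity)]
    with k hk hg hp A hA hAΩ hAd
  set s : Fin m → Set E2 := fun j => ball (S.xpt j k) (tt S j k ^ 3 / 2) with hs
  have hsΩ : ∀ j, s j ⊆ S.Ω := fun j => (hg.1 j).2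
  have hsm : ∀ j, MeasurableSet (s j) := fun j => measurableSet_ball
  have hpw : Pairwise (Function.onFun Disjoint s) := by
    intro i j hij
    apply ball_disjoint_ball
    have := hg.2 i j hij
    have := (hg.1 i).1; have := (hg.1 j).1
    linarith
  have hi := integral_iUnion_fintype (μ := volume) (f := ff S k) hsm hpw
    (fun j => (ff_int S k).mono_set (hsΩ j))
  have hUm : MeasurableSet (⋃ j, s j) := MeasurableSet.iUnion hsm
  have hUΩ : (⋃ j, s j) ⊆ S.Ω := Set.iUnion_subset hsΩ
  have hu := setIntegral_union (μ := volume) (f := ff S k) (s := A) (t := ⋃ j, s j)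
    (Set.disjoint_iUnion_right.2 hAd) hUm ((ff_int S k).mono_set hAΩ) ((ff_int S k).mono_set hUΩ)
  have hle := ff_mono S k (Set.union_subset hAΩ hUΩ)
  have hsum : ∑ _j : Fin m, (8 * π - η / (2 * m)) ≤ ∑ j, ∫ x in s j, ff S k x :=
    Finset.sum_le_sum (fun j _ => (hp j).1)
  rw [Finset.sum_const, Finset.card_univ, Fintype.card_fin, nsmul_eq_mul] at hsum
  have e : (m : ℝ) * (8 * π - η / (2 * m)) = 8 * π * m - η / 2 := by field_simp
  linarith

lemma pass3 {m : ℕ} (S : Setting m) {Λ : ℝ} (hΛ : 0 < Λ)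
    (hG : ∀ᶠ k in atTop, ∀ j : Fin m, ∃ u W, Good S Λ k j u W) :
    ∀ᶠ k in atTop, ∀ j : Fin m, ∀ x : E2, ‖x‖ ≤ 9 * S.R / 8 →
      ff S k (S.xpt j k + x) * ‖x‖ ^ 2 ≤ 16 * Λ + 256 := by
  have hR := S.hR
  obtain ⟨η, hη, heps⟩ := eps_reg hΛ
  filter_upwards [hG, geom_ev S hΛ hG, pass1 S hΛ hG one_pos, pass2 S hΛ hG hη] with k hk hg hp1 hp2 j x hx
  by_cases hxt : ‖x‖ ≤ tt S j k ^ 3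
  · have := (hp1 j).2 x hxt
    linarith
  push Not at hxt
  have htp := pow_pos (tt_pos S j k) 3
  obtain ⟨u, W, h⟩ := hk j
  have hxp : 0 < ‖x‖ := htp.trans hxt
  have hsub : ∀ y ∈ ball x (‖x‖ / 4), y ∈ ball (0 : E2) (3 * S.R / 2) := by
    intro y hy
    rw [mem_ball, dist_eq_norm] at hy
    rw [mem_ball, dist_zero_right]
    have := norm_le_norm_add_norm_sub' y x
    linarith
  have hmass : (∫ y in ball x (‖x‖ / 4), W y * Real.exp (u y)) ≤ η := by
    have e : (∫ y in ball x (‖x‖ / 4), W y * Real.exp (u y))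
        = ∫ y in ball (S.xpt j k + x) (‖x‖ / 4), ff S k y := by
      rw [ball_translate, ball_translate (ff S k)]
      apply setIntegral_congr_fun measurableSet_ball
      intro y hy
      have : x + y ∈ ball x (‖x‖ / 4) := by
        rw [mem_ball, dist_zero_right] at hy
        rw [mem_ball, dist_eq_norm]; simpa using hy
      simp only [add_assoc]
      exact h.ff_eq (hsub _ this)
    rw [e]
    apply hp2 _ measurableSet_ball
    · intro y hy
      have : y - S.xpt j k ∈ ball x (‖x‖ / 4) := by
        rw [mem_ball, dist_eq_norm] at hy ⊢
        rwa [sub_sub]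
      have := (h.2 _ (hsub _ this)).1
      simpa using this
    · intro i
      apply ball_disjoint_ball
      have hd : dist (S.xpt j k + x) (S.xpt j k) = ‖x‖ := by rw [dist_eq_norm]; simp
      by_cases hij : i = j
      · subst hij
        rw [hd]; linarith
      · have h1 := hg.2 i j hij
        have h2 := dist_triangle_left (S.xpt i k) (S.xpt j k) (S.xpt j k + x)
        have := (hg.1 i).1
        linarith
  have hx0 : x ∈ ball x (‖x‖ / 4) := mem_ball_self (by positivity)
  have := heps u W h.1.hu h.1.hW.continuous x (‖x‖ / 4) (by positivity)
    (fun y hy => h.1.hPDE y (hsub y hy)) (fun y hy => h.1.hWp y (hsub y hy))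
    (fun y hy z hz => h.1.hWr y (hsub y hy) z (hsub z hz)) hmass
  rw [h.ff_eq (hsub x hx0)] at this
  have e : ff S k (S.xpt j k + x) * (‖x‖ / 4) ^ 2 = ff S k (S.xpt j k + x) * ‖x‖ ^ 2 / 16 := by ring
  linarith

lemma pass4 {m : ℕ} (S : Setting m) {Λ : ℝ} (hΛ : 0 < Λ)
    (hG : ∀ᶠ k in atTop, ∀ j : Fin m, ∃ u W, Good S Λ k j u W) {σ : ℝ} (hσ : 0 < σ) (hσR : σ ≤ S.R / 4) :
    ∃ B : ℝ, 1 ≤ B ∧ ∀ᶠ k in atTop, ∀ j : Fin m, ∀ x : E2, σ ≤ ‖x‖ → ‖x‖ < S.R →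
      |S.v k (S.xpt j k + x)| ≤ B := by
  have hR := S.hR
  have hpi := Real.pi_pos
  obtain ⟨D, hD, hRD, hΩD⟩ := D_exists S
  set K : ℝ := 16 * Λ + 256 with hK
  have hKp : 0 < K := by positivity
  have hlog : 0 ≤ Real.log (D / (σ / 2)) := by
    apply Real.log_nonneg
    rw [le_div_iff₀ (by positivity)]; linarith
  have hq : 0 ≤ (8 * π * m + 1) / (2 * π) * Real.log (D / (σ / 2)) := by positivity
  refine ⟨3 + (8 * π * m + 1) / (2 * π) * Real.log (D / (σ / 2)) + K, by linarith, ?_⟩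
  filter_upwards [hG, mass_ev S, pass3 S hΛ hG] with k hk hmk h3 j x hx1 hx2
  obtain ⟨u, W, h⟩ := hk j
  have hxΩ : S.xpt j k + x ∈ S.Ω :=
    (h.2 x (by rw [mem_ball, dist_zero_right]; linarith)).1
  have hl := low S k _ hxΩ
  have hup := pot S hmk hD hΩD (H := 4 * K / σ ^ 2) (ρ := σ / 2) (by positivity) (by positivity)
    (by linarith) hxΩ (by
      intro y hyΩ hy
      rw [mem_ball, dist_eq_norm] at hy
      set z := y - S.xpt j k with hz
      have hzx : ‖z - x‖ < σ / 2 := by rw [hz, sub_sub]; exact hy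
      have n1 := norm_le_norm_add_norm_sub' z x
      have n2 := norm_le_norm_add_norm_sub z x
      have h4 := h3 j z (by linarith)
      have e : S.xpt j k + z = y := by rw [hz]; abel
      rw [e] at h4
      have hf := ff_pos S k hyΩ
      rw [le_div_iff₀ (by positivity)]
      have : (σ / 2) ^ 2 ≤ ‖z‖ ^ 2 := by
        apply pow_le_pow_left₀ (by positivity); linarith
      have := mul_le_mul_of_nonneg_left this hf.le
      linarith)
  have e : 4 * K / σ ^ 2 * (σ / 2) ^ 2 = K := by field_simp; ring
  rw [e] at hup
  rw [abs_le]; constructor <;> linarith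

lemma main_est {m : ℕ} (S : Setting m) : ∃ C > (0:ℝ), ∀ᶠ k in atTop, ∀ j : Fin m, ∀ y : E2, ‖y‖ < S.R →
    |S.v k (S.xpt j k + y) - S.v k (S.xpt j k) + 2 * Real.log (1 + (‖y‖ / S.delta j k) ^ 2 / 8)| ≤ C := by
  have hR := S.hR
  have hpi := Real.pi_pos
  obtain ⟨Λ, hΛ, hG0⟩ := loc_exists S
  have hG : ∀ᶠ k in atTop, ∀ j : Fin m, ∃ u W, Good S Λ k j u W := hG0
  obtain ⟨B2, hB2, h2⟩ := pass4 S hΛ hG (σ := S.R / 4) (by positivity) le_rfl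
  obtain ⟨σ, hσ, hσR, δ0, hδ0, hC⟩ := stepC (R := S.R) (M := 8 * π * m + 1) (K := 16 * Λ + 256) hR hΛ
    (by positivity) (by positivity) hB2
  obtain ⟨B3, hB3, h3⟩ := pass4 S hΛ hG hσ hσR.le
  have hlog : 0 ≤ Real.log (S.R / σ) := by
    apply Real.log_nonneg
    rw [le_div_iff₀ hσ]; linarith
  refine ⟨2 + 2 * B3 + 4 * Real.log (S.R / σ), by linarith, ?_⟩
  filter_upwards [hG, h2, h3, pass3 S hΛ hG, delta_small S hΛ hG hδ0] with k hk h2 h3 hp hd j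
  obtain ⟨u, W, h⟩ := hk j
  have hsub : ∀ y : E2, ‖y‖ < S.R → y ∈ ball (0 : E2) (3 * S.R / 2) := by
    intro y hy; rw [mem_ball, dist_zero_right]; linarith
  have hu : ∀ y : E2, ‖y‖ < S.R → u y = S.v k (S.xpt j k + y) := fun y hy => (h.2 y (hsub y hy)).2.1
  have s1 := hC (S.delta j k) u W (hd j) h.1
    (fun y hy1 hy2 => by rw [hu y hy2]; exact h2 j y hy1.le hy2)
    (fun x hx => by
      rw [h.ff_eq (hsub x (by linarith))]; exact hp j x (by linarith))
  have s2 := stepD (B := B3) (R := S.R) h.1.hδ hσ (by linarith) (by linarith) s1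
    (fun y hy1 hy2 => by rw [hu y hy2]; exact h3 j y hy1 hy2)
  intro y hy
  have := s2 y hy
  rwa [hu y hy, h.u0] at this


/-- uniform estimate of Y. Y. Li type: there is `C > 0` with
`|v_k(x) − log( e^{v_k(x_{j,k})} / (1 + (1/8) λ_k V(x_{j,k}) e^{v_k(x_{j,k})} |x−x_{j,k}|²)² )| ≤ C`
on `B_R(x_{j,k})`, equivalently `|ṽ_{j,k} − U| ≤ C` on `B_{R/δ_{j,k}}(0)`. -/
theorem statement17 {m : ℕ} (S : Setting m) :
    ∃ C > (0 : ℝ), ∀ᶠ k in atTop, ∀ j : Fin m,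
      (∀ x ∈ ball (S.xpt j k) S.R,
        |S.v k x - Real.log (Real.exp (S.v k (S.xpt j k)) /
          (1 + 1 / 8 * S.lam k * S.V (S.xpt j k) * Real.exp (S.v k (S.xpt j k)) *
            dist x (S.xpt j k) ^ 2) ^ 2)| ≤ C) ∧
      (∀ x : E2, x ∈ ball (0 : E2) (S.R / S.delta j k) →
        |S.v k (S.delta j k • x + S.xpt j k) - S.v k (S.xpt j k) - U x| ≤ C) := by
  obtain ⟨C, hC, hmain⟩ := main_est S
  refine ⟨C, hC, ?_⟩
  filter_upwards [hmain] with k hk j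
  obtain ⟨hδ, hδe⟩ := delta_pos S j k
  constructor
  · intro x hx
    rw [mem_ball] at hx
    have h1 := hk j (x - S.xpt j k) (by rwa [← dist_eq_norm])
    rw [← dist_eq_norm, add_sub_cancel] at h1
    have e : 1 + 1 / 8 * S.lam k * S.V (S.xpt j k) * Real.exp (S.v k (S.xpt j k)) * dist x (S.xpt j k) ^ 2
        = 1 + (dist x (S.xpt j k) / S.delta j k) ^ 2 / 8 := by
      have : S.lam k * S.V (S.xpt j k) * Real.exp (S.v k (S.xpt j k)) = (S.delta j k ^ 2)⁻¹ :=
        eq_inv_of_mul_eq_one_right hδe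
      rw [div_pow, div_eq_mul_inv (dist x (S.xpt j k) ^ 2), ← this]; ring
    have hq : 0 < 1 + (dist x (S.xpt j k) / S.delta j k) ^ 2 / 8 := by positivity
    rw [e, Real.log_div (Real.exp_pos _).ne' (by positivity), Real.log_exp, Real.log_pow]
    refine le_of_eq_of_le ?_ h1
    congr 1
    push_cast; ring
  · intro x hx
    rw [mem_ball, dist_zero_right, lt_div_iff₀ hδ] at hx
    have hn : ‖S.delta j k • x‖ = S.delta j k * ‖x‖ := by
      rw [norm_smul, Real.norm_of_nonneg hδ.le]
    have h1 := hk j (S.delta j k • x) (by rw [hn]; linarith)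
    rw [hn, mul_div_cancel_left₀ _ hδ.ne', add_comm (S.xpt j k)] at h1
    refine le_of_eq_of_le ?_ h1
    congr 1
    unfold U
    rw [one_div, Real.log_inv, Real.log_pow]
    push_cast; ring
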